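/- Let δ > −1. There exists a constant c > 0, depending only on d, κ and δ, such that for all integers n ≥ 1 and all x, y ∈ T^d: |K_n^δ(W_κ^T;x,y)| ≤ c [ (∏_{j=1}^{d+1}(√(x_j y_j) + n^{−1}‖ξ − ζ‖ + n^{−2})^{−κ_j}) / (n^{δ−(d−1)/2} (‖ξ − ζ‖ + n^{−1})^{δ+(d+1)/2}) + (∏_{j=1}^{d+1}(√(x_j y_j) + ‖ξ − ζ‖² + n^{−2})^{−κ_j}) / (n (‖ξ − ζ‖ + n^{−1})^{d+1}) ]. -/

import Mathlib

open MeasureTheory Finset Real intervalIntegral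

/-- Generalized binomial coefficient `C(x, k) = x (x-1) ⋯ (x-k+1) / k!`. -/
noncomputable def genBinom (x : ℝ) (k : ℕ) : ℝ :=
  (∏ i ∈ Finset.range k, (x - i)) / (Nat.factorial k)

/-- Cesàro coefficient `A_m^δ = C(m+δ, m)`. -/
noncomputable def cesA (δ : ℝ) (m : ℕ) : ℝ := genBinom (m + δ) m

/-- The cube `[-1,1]^m`. -/
def cube (m : ℕ) : Set (Fin m → ℝ) := Set.univ.pi fun _ => Set.Icc (-1) 1

/-- The simplex `T^d = {x : x_i ≥ 0, Σ x_i ≤ 1}`. -/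
def simplexT (d : ℕ) : Set (Fin d → ℝ) := {x | (∀ i, 0 ≤ x i) ∧ ∑ i, x i ≤ 1}

/-- The Jacobi weight `w^{(α,β)}(t) = (1-t)^α (1+t)^β`. -/
noncomputable def wJac (a b t : ℝ) : ℝ := (1 - t) ^ a * (1 + t) ^ b

/-- Extended coordinates: `(x_1, …, x_d, 1 - |x|)`. -/
noncomputable def xext (d : ℕ) (x : Fin d → ℝ) : Fin (d + 1) → ℝ := fun i =>
  if h : (i : ℕ) < d then x ⟨i, h⟩ else 1 - ∑ j, x j

/-- `z(x,y,t) = Σ_j √(x_j y_j) t_j` with the extended coordinates. -/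
noncomputable def zST (d : ℕ) (x y : Fin d → ℝ) (t : Fin (d + 1) → ℝ) : ℝ :=
  ∑ j, Real.sqrt (xext d x j * xext d y j) * t j

/-- The Euclidean distance `‖ξ - ζ‖` between `ξ = (√x_1,…,√x_{d+1})` and
`ζ = (√y_1,…,√y_{d+1})`. -/
noncomputable def distXi (d : ℕ) (x y : Fin d → ℝ) : ℝ :=
  Real.sqrt (∑ j, (Real.sqrt (xext d x j) - Real.sqrt (xext d y j)) ^ 2)

/-- The weight `∏ (1-t_i²)^{κ_i-1}` on the cube `[-1,1]^{d+1}`. -/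
noncomputable def wcube {m : ℕ} (κ : Fin m → ℝ) (t : Fin m → ℝ) : ℝ :=
  ∏ i, (1 - t i ^ 2) ^ (κ i - 1)

/-- The Cesàro `(C,δ)` kernel `K_n^δ(W_κ^T; x, y)` on the simplex, built from the
orthonormal Jacobi family `q = (q_k^{(|κ|+(d-2)/2, -1/2)})`. -/
noncomputable def simpK (d : ℕ) (κ : Fin (d + 1) → ℝ) (q : ℕ → Polynomial ℝ) (δ : ℝ)
    (n : ℕ) (x y : Fin d → ℝ) : ℝ :=
  (∫ t in cube (d + 1), wcube κ t)⁻¹ *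
    ∫ t in cube (d + 1),
      ((cesA δ n)⁻¹ * ∑ k ∈ Finset.range (n + 1),
        cesA δ (n - k) * (q k).eval 1 * (q k).eval (2 * zST d x y t ^ 2 - 1)) * wcube κ t

/-- The projection kernel `P_n(W_κ^T; x, y)` on the simplex. -/
noncomputable def simpP (d : ℕ) (κ : Fin (d + 1) → ℝ) (q : ℕ → Polynomial ℝ)
    (n : ℕ) (x y : Fin d → ℝ) : ℝ :=
  (∫ t in cube (d + 1), wcube κ t)⁻¹ *
    ∫ t in cube (d + 1),
      ((q n).eval 1 * (q n).eval (2 * zST d x y t ^ 2 - 1)) * wcube κ t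

/-- The weight `W_κ^T(x) = ∏ x_i^{κ_i-1/2} (1-|x|)^{κ_{d+1}-1/2}` on the simplex. -/
noncomputable def WT (d : ℕ) (κ : Fin (d + 1) → ℝ) (x : Fin d → ℝ) : ℝ :=
  (∏ i : Fin d, x i ^ (κ i.castSucc - 1 / 2)) * (1 - ∑ i, x i) ^ (κ (Fin.last d) - 1 / 2)

/-- `σ_κ = (d-1)/2 + |κ| - min_i κ_i`. -/
noncomputable def sigmaK (d : ℕ) (κ : Fin (d + 1) → ℝ) : ℝ :=
  ((d : ℝ) - 1) / 2 + (∑ i, κ i) - Finset.univ.inf' (Finset.univ_nonempty) κ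

/-- The Gegenbauer polynomials `C_k^μ`. -/
noncomputable def geg (μ : ℝ) : ℕ → Polynomial ℝ
  | 0 => 1
  | 1 => Polynomial.C (2 * μ) * Polynomial.X
  | (k + 2) => Polynomial.C ((k + 2 : ℝ)⁻¹) *
      (Polynomial.C (2 * (k + 1 + μ)) * (Polynomial.X * geg μ (k + 1)) -
        Polynomial.C (k + 2 * μ) * geg μ k)

section Gegenbauer

open Polynomial

theorem geg_rec (μ : ℝ) (k : ℕ) (z : ℝ) :
    (k + 2 : ℝ) * (geg μ (k + 2)).eval z =
      2 * (k + 1 + μ) * (z * (geg μ (k + 1)).eval z) - (k + 2 * μ) * (geg μ k).eval z := by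
  have : (k + 2 : ℝ) ≠ 0 := by positivity
  rw [geg]
  simp only [eval_mul, eval_C, eval_sub, eval_X]
  field_simp

theorem geg_rec_deriv (μ : ℝ) (k : ℕ) (z : ℝ) :
    (k + 2 : ℝ) * (derivative (geg μ (k + 2))).eval z =
      2 * (k + 1 + μ) * ((geg μ (k + 1)).eval z + z * (derivative (geg μ (k + 1))).eval z) -
        (k + 2 * μ) * (derivative (geg μ k)).eval z := by
  have : (k + 2 : ℝ) ≠ 0 := by positivity
  rw [geg]
  simp only [derivative_mul, derivative_C, derivative_sub, derivative_X, eval_mul, eval_C,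
    eval_sub, eval_X, eval_add, eval_one, eval_zero]
  field_simp
  ring

theorem geg_deriv_aux (μ : ℝ) (z : ℝ) (k : ℕ) :
    ((k : ℝ) + 1) * (geg μ (k + 1)).eval z =
        z * (derivative (geg μ (k + 1))).eval z - (derivative (geg μ k)).eval z ∧
      ((k : ℝ) + 2 * μ) * (geg μ k).eval z =
        (derivative (geg μ (k + 1))).eval z - z * (derivative (geg μ k)).eval z ∧
      ((k : ℝ) + 1 + 2 * μ) * (geg μ (k + 1)).eval z =
        (derivative (geg μ (k + 2))).eval z - z * (derivative (geg μ (k + 1))).eval z := by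
  induction k with
  | zero =>
    have h := geg_rec_deriv μ 0 z
    have e0 : geg μ 0 = 1 := rfl
    have e1 : geg μ 1 = C (2 * μ) * X := rfl
    simp only [zero_add, e0, e1] at h ⊢
    simp only [derivative_mul, derivative_C, derivative_X, eval_mul, eval_C,
      eval_X, eval_add, eval_one, eval_zero, derivative_one, Nat.cast_zero] at h ⊢
    refine ⟨by ring, by ring, by linear_combination (-1/2 : ℝ) * h⟩
  | succ k ih =>
    obtain ⟨h1, h2, h3⟩ := ih
    have r := geg_rec μ k z
    have r1 := geg_rec_deriv μ (k + 1) z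
    have n1 : ((k + 1 : ℕ) : ℝ) = k + 1 := by push_cast; ring
    simp only [n1, show k + 1 + 1 = k + 2 from rfl, show k + 1 + 2 = k + 3 from rfl] at r1 ⊢
    have h4 : ((k : ℝ) + 1 + 1) * (geg μ (k + 2)).eval z =
        z * (derivative (geg μ (k + 2))).eval z - (derivative (geg μ (k + 1))).eval z := by
      linear_combination r + z * h3 - h2 + z * h1
    refine ⟨h4, h3, ?_⟩
    have hk : ((k : ℝ) + 3) ≠ 0 := by positivity
    apply mul_left_cancel₀ hk
    linear_combination (-1 : ℝ) * r1 + (k + 1 + 2 * μ) * h4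

theorem geg_deriv (μ : ℝ) (z : ℝ) (k : ℕ) :
    (1 - z ^ 2) * (derivative (geg μ (k + 1))).eval z =
      (k + 2 * μ) * (geg μ k).eval z - (k + 1) * (z * (geg μ (k + 1)).eval z) := by
  obtain ⟨h1, h2, h3⟩ := geg_deriv_aux μ z k
  linear_combination z * h1 - h2

theorem geg_ode (μ : ℝ) (z : ℝ) (k : ℕ) :
    (1 - z ^ 2) * (derivative (derivative (geg μ k))).eval z -
      (2 * μ + 1) * (z * (derivative (geg μ k)).eval z) +
        k * (k + 2 * μ) * (geg μ k).eval z = 0 := by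
  rcases k with _ | k
  · simp [geg]
  · have hp : (1 - X ^ 2) * derivative (geg μ (k + 1)) =
        C (k + 2 * μ) * geg μ k - C ((k : ℝ) + 1) * (X * geg μ (k + 1)) := by
      apply Polynomial.funext
      intro z
      simpa using geg_deriv μ z k
    have hd := congrArg (fun p => (derivative p).eval z) hp
    obtain ⟨h1, h2, h3⟩ := geg_deriv_aux μ z k
    simp only [derivative_mul, derivative_C, derivative_sub, derivative_X, eval_mul, eval_C,
      eval_sub, eval_X, eval_add, eval_one, eval_zero, derivative_one, derivative_pow,
      eval_pow] at hd
    push_cast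
    norm_num at hd
    linear_combination hd + (k + 2 * μ) * h1

theorem geg_natDegree_le (μ : ℝ) (k : ℕ) : (geg μ k).natDegree ≤ k := by
  induction k using Nat.strong_induction_on with
  | _ k ih =>
    match k, ih with
    | 0, _ => simp [geg]
    | 1, _ => rw [geg]; compute_degree
    | (k + 2), ih =>
      rw [geg]
      have a := ih (k + 1) (by omega)
      have b := ih k (by omega)
      refine (natDegree_C_mul_le _ _).trans ((natDegree_sub_le _ _).trans (max_le ?_ ?_))
      · refine (natDegree_C_mul_le _ _).trans (natDegree_mul_le.trans ?_)
        rw [natDegree_X]; omega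
      · exact (natDegree_C_mul_le _ _).trans (by omega)

theorem geg_coeff_pos {μ : ℝ} (hμ : 0 < μ) (k : ℕ) : 0 < (geg μ k).coeff k := by
  induction k using Nat.strong_induction_on with
  | _ k ih =>
    match k, ih with
    | 0, _ => simp [geg]
    | 1, _ => rw [geg]; simp [hμ]
    | (k + 2), ih =>
      rw [geg]
      have a := ih (k + 1) (by omega)
      have b : (geg μ k).coeff (k + 2) = 0 :=
        coeff_eq_zero_of_natDegree_lt (by have := geg_natDegree_le μ k; omega)
      rw [coeff_C_mul, coeff_sub, coeff_C_mul, coeff_C_mul, b, coeff_X_mul]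
      have : 0 < (k : ℝ) + 1 + μ := by positivity
      simp only [mul_zero, sub_zero]
      positivity

/-- A sequence of polynomials with `deg p_k = k` spans. -/
theorem exists_sum_of_natDegree_le {p : ℕ → Polynomial ℝ} (hp : ∀ k, (p k).natDegree ≤ k)
    (hc : ∀ k, (p k).coeff k ≠ 0) (n : ℕ) (f : Polynomial ℝ) (hf : f.natDegree < n) :
    ∃ a : ℕ → ℝ, f = ∑ k ∈ Finset.range n, C (a k) * p k := by
  induction n generalizing f with
  | zero => omega
  | succ n ih =>
    set g := f - C (f.coeff n / (p n).coeff n) * p n with hg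
    have hgc : g.coeff n = 0 := by
      rw [hg, coeff_sub, coeff_C_mul, div_mul_cancel₀ _ (hc n), sub_self]
    have hgd : g.natDegree ≤ n := by
      refine (natDegree_sub_le _ _).trans (max_le (by omega) ?_)
      exact (natDegree_C_mul_le _ _).trans (hp n)
    rcases Nat.eq_zero_or_pos n with rfl | hn
    · refine ⟨fun _ => f.coeff 0 / (p 0).coeff 0, ?_⟩
      have : g = 0 := by
        rw [eq_C_of_natDegree_le_zero hgd, hgc, C_0]
      rw [Finset.sum_range_one]
      exact sub_eq_zero.mp this
    · have hlt : g.natDegree < n := by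
        refine lt_of_le_of_ne hgd fun h => ?_
        have h0 : g.leadingCoeff = 0 := by rw [leadingCoeff, h, hgc]
        rw [leadingCoeff_eq_zero] at h0
        rw [h0, natDegree_zero] at h
        omega
      obtain ⟨a, ha⟩ := ih g hlt
      refine ⟨fun k => if k = n then f.coeff n / (p n).coeff n else a k, ?_⟩
      rw [Finset.sum_range_succ]
      simp only [if_true]
      have : ∑ k ∈ Finset.range n, C (if k = n then f.coeff n / (p n).coeff n else a k) * p k =
          ∑ k ∈ Finset.range n, C (a k) * p k := by
        refine Finset.sum_congr rfl fun k hk => ?_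
        rw [if_neg (Finset.mem_range.mp hk).ne]
      rw [this, ← ha, hg]
      ring

end Gegenbauer

theorem intervalIntegrable_wJac {a b : ℝ} (ha : -1 < a) (hb : -1 < b) :
    IntervalIntegrable (wJac a b) volume (-1) 1 := by
  have h1 : IntervalIntegrable (wJac a b) volume 0 1 := by
    have e : IntervalIntegrable (fun t : ℝ => (1 - t) ^ a) volume 0 1 := by
      have := (intervalIntegrable_rpow' (a := 0) (b := 1) ha).comp_sub_left 1
      simpa using this.symm
    refine e.mul_continuousOn ?_
    refine ContinuousOn.rpow_const (by fun_prop) fun x hx => Or.inl ?_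
    rw [Set.uIcc_of_le zero_le_one] at hx
    linarith [hx.1]
  have h2 : IntervalIntegrable (wJac a b) volume (-1) 0 := by
    have e : IntervalIntegrable (fun t : ℝ => (1 + t) ^ b) volume (-1) 0 := by
      have := (intervalIntegrable_rpow' (a := 0) (b := 1) hb).comp_add_left 1
      simpa using this
    refine e.continuousOn_mul (g := fun t : ℝ => (1 - t) ^ a) ?_
    refine ContinuousOn.rpow_const (by fun_prop) fun x hx => Or.inl ?_
    rw [Set.uIcc_of_le (by norm_num)] at hx
    linarith [hx.2]
  exact h2.trans h1

theorem one_sub_sq_rpow {a t : ℝ} (h1 : -1 ≤ t) (h2 : t ≤ 1) :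
    (1 - t ^ 2) ^ a = wJac a a t := by
  rw [wJac, ← Real.mul_rpow (by linarith) (by linarith)]
  congr 1; ring

theorem intervalIntegrable_one_sub_sq_rpow {a : ℝ} (ha : -1 < a) :
    IntervalIntegrable (fun t : ℝ => (1 - t ^ 2) ^ a) volume (-1) 1 := by
  refine (intervalIntegrable_wJac ha ha).congr fun t ht => ?_
  rw [Set.uIoc_of_le (by norm_num)] at ht
  exact (one_sub_sq_rpow ht.1.le ht.2).symm

theorem intervalIntegrable_poly_wJac {a b : ℝ} (ha : -1 < a) (hb : -1 < b) (f : Polynomial ℝ) :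
    IntervalIntegrable (fun t => f.eval t * wJac a b t) volume (-1) 1 :=
  (intervalIntegrable_wJac ha hb).continuousOn_mul f.continuous.continuousOn

theorem intervalIntegrable_poly_one_sub_sq {a : ℝ} (ha : -1 < a) (f : Polynomial ℝ) :
    IntervalIntegrable (fun t => f.eval t * (1 - t ^ 2) ^ a) volume (-1) 1 :=
  (intervalIntegrable_one_sub_sq_rpow ha).continuousOn_mul f.continuous.continuousOn

theorem hasDerivAt_one_sub_sq_rpow {a z : ℝ} (hz : z ∈ Set.Ioo (-1 : ℝ) 1) (f : Polynomial ℝ) :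
    HasDerivAt (fun z : ℝ => (1 - z ^ 2) ^ (a + 1) * f.eval z)
      ((1 - z ^ 2) ^ a * ((1 - z ^ 2) * f.derivative.eval z - 2 * (a + 1) * (z * f.eval z))) z := by
  have hp : 0 < 1 - z ^ 2 := by nlinarith [hz.1, hz.2]
  have h1 : HasDerivAt (fun z : ℝ => 1 - z ^ 2) (-(2 * z)) z := by
    simpa using ((hasDerivAt_pow 2 z).const_sub 1)
  refine ((h1.rpow_const (p := a + 1) (Or.inl hp.ne')).mul (f.hasDerivAt z)).congr_deriv ?_
  rw [show a + 1 - 1 = a by ring, Real.rpow_add_one hp.ne']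
  ring

/-- A polynomial multiple of the weight that is an exact derivative integrates to zero. -/
theorem integral_deriv_one_sub_sq {a : ℝ} (ha : -1 < a) (f g : Polynomial ℝ)
    (h : ∀ z, g.eval z = (1 - z ^ 2) * f.derivative.eval z - 2 * (a + 1) * (z * f.eval z)) :
    ∫ z in (-1 : ℝ)..1, g.eval z * (1 - z ^ 2) ^ a = 0 := by
  rw [integral_eq_sub_of_hasDerivAt_of_le (f := fun z : ℝ => (1 - z ^ 2) ^ (a + 1) * f.eval z)
    (by norm_num) ?_ ?_ (intervalIntegrable_poly_one_sub_sq ha g)]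
  · have : (a + 1) ≠ 0 := by linarith
    norm_num [Real.zero_rpow this]
  · refine ContinuousOn.mul ?_ f.continuous.continuousOn
    exact ContinuousOn.rpow_const (by fun_prop) fun x hx => Or.inr (by linarith)
  · intro z hz
    have := hasDerivAt_one_sub_sq_rpow (a := a) hz f
    rwa [← h, mul_comm] at this

theorem geg_orthogonal {a : ℝ} (ha : -1 / 2 < a) {j k : ℕ} (hjk : j ≠ k) :
    ∫ z in (-1 : ℝ)..1, (geg (a + 3 / 2) k).eval z * (geg (a + 3 / 2) j).eval z *
      (1 - z ^ 2) ^ (a + 1) = 0 := by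
  set μ := a + 3 / 2 with hμ
  set u := Polynomial.derivative (geg μ k) * geg μ j - Polynomial.derivative (geg μ j) * geg μ k
  have key := integral_deriv_one_sub_sq (a := a + 1) (by linarith) u
    (Polynomial.C ((j - k) * (j + k + 2 * μ) : ℝ) * (geg μ k * geg μ j)) (by
      intro z
      have e1 := geg_ode μ z k
      have e2 := geg_ode μ z j
      simp only [u, Polynomial.eval_mul, Polynomial.eval_C, Polynomial.derivative_sub,
        Polynomial.derivative_mul, Polynomial.eval_sub, Polynomial.eval_add]
      have : a + 1 + 1 = μ + 1 / 2 := by rw [hμ]; ring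
      rw [this]
      linear_combination (geg μ j).eval z * e1 * (-1) + (geg μ k).eval z * e2)
  simp only [Polynomial.eval_mul, Polynomial.eval_C, mul_assoc] at key
  rw [intervalIntegral.integral_const_mul] at key
  have h1 : (j - k : ℝ) ≠ 0 := sub_ne_zero.mpr (by exact_mod_cast hjk)
  have hμ0 : 0 < μ := by linarith
  have h2 : ((j : ℝ) + k + 2 * μ) ≠ 0 := by positivity
  rw [intervalIntegral.integral_const_mul] at key
  simpa [h1, h2, mul_assoc] using key

theorem geg_orthogonal_poly {a : ℝ} (ha : -1 / 2 < a) {n : ℕ} (f : Polynomial ℝ)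
    (hf : f.natDegree < n) :
    ∫ z in (-1 : ℝ)..1, (geg (a + 3 / 2) n).eval z * f.eval z * (1 - z ^ 2) ^ (a + 1) = 0 := by
  obtain ⟨b, rfl⟩ := exists_sum_of_natDegree_le (geg_natDegree_le (a + 3 / 2))
    (fun k => (geg_coeff_pos (by linarith) k).ne') n f hf
  simp only [Polynomial.eval_finsetSum, Finset.mul_sum, Finset.sum_mul]
  rw [intervalIntegral.integral_finsetSum]
  · refine Finset.sum_eq_zero fun k hk => ?_
    have hkn : k ≠ n := (Finset.mem_range.mp hk).ne
    have := geg_orthogonal ha hkn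
    simp only [Polynomial.eval_mul, Polynomial.eval_C]
    calc _ = ∫ z in (-1 : ℝ)..1, b k * ((geg (a + 3 / 2) n).eval z *
          (geg (a + 3 / 2) k).eval z * (1 - z ^ 2) ^ (a + 1)) := by
          congr 1; ext z; ring
      _ = 0 := by rw [intervalIntegral.integral_const_mul, this, mul_zero]
  · intro k _
    have := intervalIntegrable_poly_one_sub_sq (a := a + 1) (by linarith)
      (geg (a + 3 / 2) n * (Polynomial.C (b k) * geg (a + 3 / 2) k))
    simpa only [Polynomial.eval_mul] using this

theorem integral_geg_add_two {a : ℝ} (ha : -1 / 2 < a) (k : ℕ) :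
    ∫ z in (-1 : ℝ)..1, (geg (a + 3 / 2) (k + 2)).eval z * (1 - z ^ 2) ^ a =
      ∫ z in (-1 : ℝ)..1, (geg (a + 3 / 2) k).eval z * (1 - z ^ 2) ^ a := by
  set μ := a + 3 / 2 with hμ
  have key := integral_deriv_one_sub_sq (a := a) (by linarith) (geg μ (k + 1))
    (Polynomial.C ((k + 2 * μ) * (k + 2) / (2 * (k + 1 + μ)) : ℝ) *
      (geg μ k - geg μ (k + 2))) (by
      intro z
      have e1 := geg_deriv μ z k
      have e2 := geg_rec μ k z
      have : (k + 1 + μ) ≠ 0 := by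
        have : 0 < μ := by linarith
        positivity
      simp only [Polynomial.eval_mul, Polynomial.eval_C, Polynomial.eval_sub]
      rw [e1, show a = μ - 3 / 2 by rw [hμ]; ring]
      field_simp
      linear_combination (-1 : ℝ) * (k + 2 * μ) * e2)
  simp only [Polynomial.eval_mul, Polynomial.eval_C, mul_assoc, Polynomial.eval_sub] at key
  rw [intervalIntegral.integral_const_mul] at key
  have hμ0 : 0 < μ := by linarith
  have h1 : ((k + 2 * μ) * (k + 2) / (2 * (k + 1 + μ)) : ℝ) ≠ 0 := by positivity
  have key := (mul_eq_zero.mp key).resolve_left h1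
  simp only [sub_mul] at key
  rw [intervalIntegral.integral_sub] at key
  · linarith
  · exact intervalIntegrable_poly_one_sub_sq (by linarith) _
  · exact intervalIntegrable_poly_one_sub_sq (by linarith) _

theorem integral_geg_even {a : ℝ} (ha : -1 / 2 < a) (n : ℕ) :
    ∫ z in (-1 : ℝ)..1, (geg (a + 3 / 2) (2 * n)).eval z * (1 - z ^ 2) ^ a =
      ∫ z in (-1 : ℝ)..1, (1 - z ^ 2) ^ a := by
  induction n with
  | zero => simp [geg]
  | succ n ih => rw [show 2 * (n + 1) = 2 * n + 2 by ring, integral_geg_add_two ha, ih]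

theorem integral_geg_mul_comp {a : ℝ} (ha : -1 / 2 < a) (n : ℕ) (f : Polynomial ℝ)
    (hf : f.natDegree ≤ n) :
    ∫ z in (-1 : ℝ)..1, (geg (a + 3 / 2) (2 * n)).eval z * f.eval (2 * z ^ 2 - 1) *
      (1 - z ^ 2) ^ a = f.eval 1 * ∫ z in (-1 : ℝ)..1, (1 - z ^ 2) ^ a := by
  obtain ⟨g, hg⟩ : Polynomial.X - Polynomial.C 1 ∣ f - Polynomial.C (f.eval 1) := by
    rw [Polynomial.dvd_iff_isRoot]; simp
  have hz : ∀ z : ℝ, f.eval (2 * z ^ 2 - 1) = f.eval 1 +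
      -2 * ((1 - z ^ 2) * g.eval (2 * z ^ 2 - 1)) := by
    intro z
    have := congrArg (Polynomial.eval (2 * z ^ 2 - 1)) hg
    simp only [Polynomial.eval_sub, Polynomial.eval_C, Polynomial.eval_mul, Polynomial.eval_X]
      at this
    linear_combination this
  set g2 : Polynomial ℝ := g.comp (2 * Polynomial.X ^ 2 - 1) with hg2
  have hg2e : ∀ z : ℝ, g2.eval z = g.eval (2 * z ^ 2 - 1) := by
    intro z; simp [hg2, Polynomial.eval_comp]
  have h0 : ∫ z in (-1 : ℝ)..1, (geg (a + 3 / 2) (2 * n)).eval z * g2.eval z *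
      (1 - z ^ 2) ^ (a + 1) = 0 := by
    by_cases hgz : g = 0
    · simp [hg2, hgz]
    apply geg_orthogonal_poly ha
    have h1 : (f - Polynomial.C (f.eval 1)).natDegree = 1 + g.natDegree := by
      rw [hg, Polynomial.natDegree_mul (Polynomial.X_sub_C_ne_zero 1) hgz,
        Polynomial.natDegree_X_sub_C]
    rw [Polynomial.natDegree_sub_C] at h1
    have h2 : (2 * Polynomial.X ^ 2 - 1 : Polynomial ℝ).natDegree ≤ 2 := by compute_degree
    have h3 : g2.natDegree ≤ g.natDegree * 2 :=
      Polynomial.natDegree_comp_le.trans (Nat.mul_le_mul_left _ h2)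
    omega
  have hsplit : ∀ z ∈ Set.uIcc (-1 : ℝ) 1, (geg (a + 3 / 2) (2 * n)).eval z *
      f.eval (2 * z ^ 2 - 1) * (1 - z ^ 2) ^ a =
      f.eval 1 * ((geg (a + 3 / 2) (2 * n)).eval z * (1 - z ^ 2) ^ a) +
      -2 * ((geg (a + 3 / 2) (2 * n)).eval z * g2.eval z *
        ((1 - z ^ 2) * (1 - z ^ 2) ^ a)) := by
    intro z _
    rw [hz, hg2e]; ring
  have e1 : ∀ z ∈ Set.uIoo (-1 : ℝ) 1, (geg (a + 3 / 2) (2 * n)).eval z * g2.eval z *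
      ((1 - z ^ 2) * (1 - z ^ 2) ^ a) = (geg (a + 3 / 2) (2 * n)).eval z * g2.eval z *
      (1 - z ^ 2) ^ (a + 1) := by
    intro z hz
    rw [Set.uIoo_of_le (by norm_num)] at hz
    have : 1 - z ^ 2 ≠ 0 := by nlinarith [hz.1, hz.2]
    rw [Real.rpow_add_one this]; ring
  have i1 := intervalIntegrable_poly_one_sub_sq (a := a) (by linarith) (geg (a + 3 / 2) (2 * n))
  have i2 := intervalIntegrable_poly_one_sub_sq (a := a) (by linarith)
    (geg (a + 3 / 2) (2 * n) * g2 * (1 - Polynomial.X ^ 2))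
  simp only [Polynomial.eval_mul, Polynomial.eval_sub, Polynomial.eval_one, Polynomial.eval_pow,
    Polynomial.eval_X, mul_assoc] at i2
  rw [integral_congr hsplit, intervalIntegral.integral_add (i1.const_mul _)
    (by simpa only [mul_assoc] using i2.const_mul (-2)), intervalIntegral.integral_const_mul,
    intervalIntegral.integral_const_mul, integral_geg_even ha,
    integral_congr_uIoo e1, h0]
  ring

theorem geg_parity (μ : ℝ) (n : ℕ) :
    (∃ E : Polynomial ℝ, E.natDegree ≤ n ∧ ∀ z, (geg μ (2 * n)).eval z = E.eval (2 * z ^ 2 - 1)) ∧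
      ∃ O : Polynomial ℝ, O.natDegree ≤ n ∧
        ∀ z, (geg μ (2 * n + 1)).eval z = z * O.eval (2 * z ^ 2 - 1) := by
  induction n with
  | zero =>
    refine ⟨⟨1, by simp, by simp [geg]⟩, ⟨Polynomial.C (2 * μ), (Polynomial.natDegree_C _).le, ?_⟩⟩
    intro z; simp [geg]; ring
  | succ n ih =>
    obtain ⟨⟨E, hE, hEz⟩, ⟨O, hO, hOz⟩⟩ := ih
    set c : ℝ := (((2 * n : ℕ) : ℝ) + 2)⁻¹ with hc
    set E' : Polynomial ℝ := Polynomial.C c * (Polynomial.C (2 * ((2 * n : ℕ) + 1 + μ) * (1 / 2)) *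
      ((Polynomial.X + Polynomial.C 1) * O) - Polynomial.C ((2 * n : ℕ) + 2 * μ) * E) with hE'
    have hEd : E'.natDegree ≤ n + 1 := by
      refine (Polynomial.natDegree_C_mul_le _ _).trans ((Polynomial.natDegree_sub_le _ _).trans
        (max_le ?_ ?_))
      · refine (Polynomial.natDegree_C_mul_le _ _).trans (Polynomial.natDegree_mul_le.trans ?_)
        rw [Polynomial.natDegree_X_add_C]; omega
      · exact (Polynomial.natDegree_C_mul_le _ _).trans (by omega)
    have hEe : ∀ z, (geg μ (2 * (n + 1))).eval z = E'.eval (2 * z ^ 2 - 1) := by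
      intro z
      have hr := geg_rec μ (2 * n) z
      rw [hEz, hOz] at hr
      have h2 : (((2 * n : ℕ) : ℝ) + 2) ≠ 0 := by positivity
      apply mul_left_cancel₀ h2
      rw [show 2 * (n + 1) = 2 * n + 2 by ring, hr, hE']
      simp only [Polynomial.eval_mul, Polynomial.eval_C, Polynomial.eval_sub, Polynomial.eval_add,
        Polynomial.eval_X]
      rw [← mul_assoc _ c, hc, mul_inv_cancel₀ h2]
      ring
    set c' : ℝ := (((2 * n + 1 : ℕ) : ℝ) + 2)⁻¹ with hc'
    refine ⟨⟨E', hEd, hEe⟩, ⟨Polynomial.C c' * (Polynomial.C (2 * ((2 * n + 1 : ℕ) + 1 + μ)) * E' -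
      Polynomial.C ((2 * n + 1 : ℕ) + 2 * μ) * O), ?_, ?_⟩⟩
    · refine (Polynomial.natDegree_C_mul_le _ _).trans ((Polynomial.natDegree_sub_le _ _).trans
        (max_le ((Polynomial.natDegree_C_mul_le _ _).trans hEd)
          ((Polynomial.natDegree_C_mul_le _ _).trans (by omega))))
    · intro z
      have hr := geg_rec μ (2 * n + 1) z
      have e2 := hEe z
      rw [show 2 * (n + 1) = 2 * n + 1 + 1 by ring] at e2
      rw [e2, hOz] at hr
      have h2 : (((2 * n + 1 : ℕ) : ℝ) + 2) ≠ 0 := by positivity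
      apply mul_left_cancel₀ h2
      rw [show 2 * (n + 1) + 1 = 2 * n + 1 + 2 by ring, hr]
      simp only [Polynomial.eval_mul, Polynomial.eval_C, Polynomial.eval_sub]
      rw [hc']
      field_simp

/-- The quadratic substitution `t = 2 z² - 1`. -/
theorem integral_wJac_comp (a : ℝ) (f : ℝ → ℝ) :
    ∫ t in (-1 : ℝ)..1, f t * wJac a (-(1 / 2)) t =
      2 * (2 : ℝ) ^ a * (2 : ℝ) ^ (-(1 / 2) : ℝ) *
        ∫ z in (-1 : ℝ)..1, f (2 * z ^ 2 - 1) * (1 - z ^ 2) ^ a := by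
  have himg : (fun z : ℝ => 2 * z ^ 2 - 1) '' Set.Ioo 0 1 = Set.Ioo (-1) 1 := by
    ext t
    constructor
    · rintro ⟨z, hz, rfl⟩
      constructor <;> simp only <;> nlinarith [hz.1, hz.2]
    · intro ht
      have hp : 0 < (t + 1) / 2 := by linarith [ht.1]
      refine ⟨√((t + 1) / 2), ⟨Real.sqrt_pos.mpr hp, ?_⟩, ?_⟩
      · rw [Real.sqrt_lt' one_pos]; linarith [ht.2]
      · simp only; rw [Real.sq_sqrt hp.le]; ring
  have hev : ∫ z in (-1 : ℝ)..1, f (2 * z ^ 2 - 1) * (1 - z ^ 2) ^ a =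
      2 * ∫ z in (0 : ℝ)..1, f (2 * z ^ 2 - 1) * (1 - z ^ 2) ^ a := by
    have habs := integral_comp_abs (f := fun z : ℝ => Set.indicator (Set.Ioc (0 : ℝ) 1)
      (fun z => f (2 * z ^ 2 - 1) * (1 - z ^ 2) ^ a) z)
    rw [integral_of_le (by norm_num), integral_of_le (by norm_num)]
    rw [← MeasureTheory.integral_indicator measurableSet_Ioc,
      ← MeasureTheory.integral_indicator measurableSet_Ioc]
    rw [← MeasureTheory.integral_indicator measurableSet_Ioi] at habs
    have e2 : (Set.Ioi (0 : ℝ)).indicator (Set.indicator (Set.Ioc (0 : ℝ) 1)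
      (fun z => f (2 * z ^ 2 - 1) * (1 - z ^ 2) ^ a)) = (Set.Ioc (0 : ℝ) 1).indicator
      (fun z => f (2 * z ^ 2 - 1) * (1 - z ^ 2) ^ a) := by
      rw [Set.indicator_indicator]
      congr 1; ext z; simp
    rw [e2] at habs
    rw [← habs]
    apply MeasureTheory.integral_congr_ae
    have hne : ∀ᵐ z : ℝ, z ≠ 0 ∧ z ≠ -1 := by
      have h0 : ∀ᵐ z : ℝ, z ≠ 0 := by simp [ae_iff]
      have h1 : ∀ᵐ z : ℝ, z ≠ -1 := by simp [ae_iff]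
      filter_upwards [h0, h1] with z a b using ⟨a, b⟩
    filter_upwards [hne] with z hz
    by_cases h : z ∈ Set.Ioc (-1 : ℝ) 1
    · have h' : |z| ∈ Set.Ioc (0 : ℝ) 1 :=
        ⟨abs_pos.mpr hz.1, abs_le.mpr ⟨h.1.le, h.2⟩⟩
      rw [Set.indicator_of_mem h, Set.indicator_of_mem h', sq_abs]
    · have h' : |z| ∉ Set.Ioc (0 : ℝ) 1 := fun h' =>
        h ⟨lt_of_le_of_ne (abs_le.mp h'.2).1 (Ne.symm hz.2), (abs_le.mp h'.2).2⟩
      rw [Set.indicator_of_notMem h, Set.indicator_of_notMem h']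
  have hsub := integral_image_eq_integral_abs_deriv_smul (s := Set.Ioo (0 : ℝ) 1)
    (f := fun z : ℝ => 2 * z ^ 2 - 1) (f' := fun z => 4 * z) measurableSet_Ioo
    (fun z _ => by
      have : HasDerivAt (fun z : ℝ => 2 * z ^ 2 - 1) (4 * z) z := by
        have := ((hasDerivAt_pow 2 z).const_mul 2).sub_const 1
        refine this.congr_deriv ?_
        norm_num; ring
      exact this.hasDerivWithinAt)
    (fun x hx y hy h => by
      simp only at h
      have : (x - y) * (x + y) = 0 := by linarith
      rcases mul_eq_zero.mp this with h | h
      · linarith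
      · linarith [hx.1, hy.1])
    (fun t => f t * wJac a (-(1 / 2)) t)
  rw [himg] at hsub
  rw [integral_of_le (by norm_num), integral_Ioc_eq_integral_Ioo, hsub, hev,
    integral_of_le (by norm_num), integral_Ioc_eq_integral_Ioo, ← MeasureTheory.integral_const_mul,
    ← MeasureTheory.integral_const_mul]
  refine setIntegral_congr_fun measurableSet_Ioo fun z hz => ?_
  have h1 : 1 - (2 * z ^ 2 - 1) = 2 * (1 - z ^ 2) := by ring
  have h2 : 1 + (2 * z ^ 2 - 1) = 2 * z ^ 2 := by ring
  have h3 : (z ^ 2) ^ (-(1 / 2) : ℝ) = z⁻¹ := by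
    rw [← Real.rpow_natCast, ← Real.rpow_mul hz.1.le]
    norm_num
    exact Real.rpow_neg_one z
  simp only [wJac, smul_eq_mul]
  rw [h1, h2, Real.mul_rpow (by norm_num) (by nlinarith [hz.1, hz.2]),
    Real.mul_rpow (by norm_num) (by positivity), h3, abs_of_pos (by linarith [hz.1])]
  have := hz.1.ne'
  field_simp
  ring

theorem kernel_eq_geg {a : ℝ} (ha : -1 / 2 < a) (q : ℕ → Polynomial ℝ)
    (hqdeg : ∀ k, (q k).degree = k)
    (hqorth : ∀ j k, (∫ t in (-1 : ℝ)..1, (q j).eval t * (q k).eval t * wJac a (-(1 / 2)) t) =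
      if j = k then 1 else 0) :
    ∃ c : ℝ, ∀ n z, ∑ k ∈ Finset.range (n + 1), (q k).eval 1 * (q k).eval (2 * z ^ 2 - 1) =
      c * (geg (a + 3 / 2) (2 * n)).eval z := by
  set C : ℝ := 2 * (2 : ℝ) ^ a * (2 : ℝ) ^ (-(1 / 2) : ℝ)
  set M : ℝ := ∫ z in (-1 : ℝ)..1, (1 - z ^ 2) ^ a
  have hnd : ∀ k, (q k).natDegree = k := fun k => Polynomial.natDegree_eq_of_degree_eq_some (hqdeg k)
  have hco : ∀ k, (q k).coeff k ≠ 0 := by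
    intro k
    have : (q k).leadingCoeff ≠ 0 := by
      rw [Ne, Polynomial.leadingCoeff_eq_zero]
      intro h; have := hqdeg k; rw [h] at this; simp at this
    rwa [Polynomial.leadingCoeff, hnd] at this
  have hint : ∀ f : Polynomial ℝ, IntervalIntegrable (fun t => f.eval t * wJac a (-(1 / 2)) t)
      volume (-1) 1 := fun f =>
    intervalIntegrable_poly_wJac (by linarith) (by norm_num) f
  have main : ∀ n z, (geg (a + 3 / 2) (2 * n)).eval z =
      (C * M) * ∑ k ∈ Finset.range (n + 1), (q k).eval 1 * (q k).eval (2 * z ^ 2 - 1) := by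
    intro n z
    obtain ⟨⟨E, hEd, hE⟩, -⟩ := geg_parity (a + 3 / 2) n
    obtain ⟨b, hb⟩ := exists_sum_of_natDegree_le (fun k => (hnd k).le) hco (n + 1) E (by omega)
    have hbk : ∀ k ∈ Finset.range (n + 1), b k = C * M * (q k).eval 1 := by
      intro k hk
      have h1 : ∫ t in (-1 : ℝ)..1, (E.eval t * (q k).eval t) * wJac a (-(1 / 2)) t = b k := by
        rw [hb]
        simp only [Polynomial.eval_finsetSum, Finset.sum_mul]
        rw [intervalIntegral.integral_finsetSum]
        · have : ∀ i, ∫ t in (-1 : ℝ)..1, (Polynomial.C (b i) * q i).eval t * (q k).eval t *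
              wJac a (-(1 / 2)) t = b i * if i = k then 1 else 0 := by
            intro i
            rw [← hqorth, ← intervalIntegral.integral_const_mul]
            congr 1; ext t
            simp only [Polynomial.eval_mul, Polynomial.eval_C]; ring
          simp only [this]
          simp [hk, Finset.sum_ite_eq']
        · intro i _
          have := hint ((Polynomial.C (b i) * q i) * q k)
          simpa only [Polynomial.eval_mul] using this
      rw [← h1, integral_wJac_comp a (fun t => E.eval t * (q k).eval t)]
      simp only [← hE]
      rw [integral_geg_mul_comp ha n (q k) (by rw [hnd]; simp at hk; omega)]
      simp only [C, M]
      ring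
    rw [hE, hb, Polynomial.eval_finsetSum, Finset.mul_sum]
    refine Finset.sum_congr rfl fun k hk => ?_
    rw [Polynomial.eval_mul, Polynomial.eval_C, hbk k hk]; ring
  have hCM : C * M ≠ 0 := by
    intro h
    have := main 0 0
    rw [h] at this
    simp [geg] at this
  refine ⟨(C * M)⁻¹, fun n z => ?_⟩
  rw [main, ← mul_assoc, inv_mul_cancel₀ hCM, one_mul]

theorem genBinom_eq_choose (x : ℝ) (k : ℕ) : genBinom x k = Ring.choose x k := by
  have h := Ring.descPochhammer_eq_factorial_smul_choose x k
  rw [genBinom, div_eq_iff (by positivity)]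
  have h2 : (descPochhammer ℤ k).smeval x = ∏ i ∈ Finset.range k, (x - i) := by
    rw [← descPochhammer_eval_eq_prod_range, ← Polynomial.aeval_eq_smeval, Polynomial.aeval_def,
      ← Polynomial.eval_map, descPochhammer_map]
  rw [← h2, h, nsmul_eq_mul]; ring

theorem cesA_succ (δ : ℝ) (m : ℕ) : cesA δ (m + 1) = cesA δ m + cesA (δ - 1) (m + 1) := by
  simp only [cesA, genBinom_eq_choose]
  have := Ring.choose_succ_succ ((m : ℝ) + δ) m
  push_cast
  rw [show (m : ℝ) + 1 + δ = m + δ + 1 by ring, this,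
    show (m : ℝ) + 1 + (δ - 1) = m + δ by ring]

theorem cesA_zero (δ : ℝ) : cesA δ 0 = 1 := by simp [cesA, genBinom]

theorem cesA_eq_sum (δ : ℝ) (m : ℕ) : cesA δ m = ∑ j ∈ Finset.range (m + 1), cesA (δ - 1) j := by
  induction m with
  | zero => simp [cesA_zero]
  | succ m ih => rw [cesA_succ, ih, Finset.sum_range_succ _ (m + 1)]

theorem sum_cesA_mul (δ : ℝ) (n : ℕ) (f : ℕ → ℝ) :
    ∑ k ∈ Finset.range (n + 1), cesA δ (n - k) * f k =
      ∑ j ∈ Finset.range (n + 1), cesA (δ - 1) j * ∑ k ∈ Finset.range (n - j + 1), f k := by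
  simp only [cesA_eq_sum δ, Finset.sum_mul, Finset.mul_sum]
  apply Finset.sum_comm'
  intro k j
  simp only [Finset.mem_range]
  omega

theorem cesA_eq_prod (δ : ℝ) (n : ℕ) :
    cesA δ n = (∏ j ∈ Finset.range n, (δ + 1 + j)) / (Nat.factorial n) := by
  rw [cesA, genBinom, ← Finset.prod_range_reflect]
  congr 1
  refine Finset.prod_congr rfl fun j hj => ?_
  have := Finset.mem_range.mp hj
  rw [Nat.cast_sub (by omega), Nat.cast_sub (by omega)]
  push_cast; ring

theorem cesA_pos {δ : ℝ} (hδ : -1 < δ) (n : ℕ) : 0 < cesA δ n := by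
  rw [cesA_eq_prod]
  refine div_pos (Finset.prod_pos fun j _ => ?_) (by positivity)
  have : (0 : ℝ) ≤ j := by positivity
  linarith

theorem cesA_inv_le {δ : ℝ} (hδ : -1 < δ) :
    ∃ C : ℝ, 0 < C ∧ ∀ n : ℕ, 1 ≤ n → (cesA δ n)⁻¹ ≤ C * (n : ℝ) ^ (-δ) := by
  obtain ⟨B, hB⟩ := (Real.GammaSeq_tendsto_Gamma (δ + 1)).bddAbove_range
  have hB0 : 0 ≤ B := by
    have := hB ⟨0, rfl⟩
    have h0 : Real.GammaSeq (δ + 1) 0 = 0 := by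
      simp [Real.GammaSeq, Real.zero_rpow (by linarith : δ + 1 ≠ 0)]
    rwa [h0] at this
  refine ⟨(B + 1) * (δ + 2), by nlinarith, fun n hn => ?_⟩
  have hn' : (1 : ℝ) ≤ n := by exact_mod_cast hn
  have hBn : Real.GammaSeq (δ + 1) n ≤ B := hB ⟨n, rfl⟩
  have hpos : 0 < ∏ j ∈ Finset.range n, (δ + 1 + j) := by
    refine Finset.prod_pos fun j _ => ?_
    have : (0 : ℝ) ≤ j := by positivity
    linarith
  have hnp : (0 : ℝ) < (n : ℝ) ^ (δ + 1) := by positivity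
  have e1 : (cesA δ n)⁻¹ = Real.GammaSeq (δ + 1) n * (δ + 1 + n) / (n : ℝ) ^ (δ + 1) := by
    rw [cesA_eq_prod, Real.GammaSeq, Finset.prod_range_succ]
    have : δ + 1 + n ≠ 0 := by linarith
    field_simp
  have e2 : (n : ℝ) ^ (-δ) = n / (n : ℝ) ^ (δ + 1) := by
    rw [eq_div_iff hnp.ne', ← Real.rpow_add (by linarith)]
    simp
  rw [e1, e2, ← mul_div_assoc, div_le_div_iff_of_pos_right hnp]
  calc Real.GammaSeq (δ + 1) n * (δ + 1 + n) ≤ (B + 1) * ((δ + 2) * n) := by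
        apply mul_le_mul (by linarith) _ (by nlinarith) (by linarith)
        nlinarith
    _ = _ := by ring

/-- The denominator of the Gegenbauer generating function. -/
noncomputable def gegDen (z : ℝ) (r : ℂ) : ℂ := 1 - 2 * z * r + r ^ 2

/-- `∫₀^{2π} F(r) r^{-k} dφ` over the circle `|r| = ρ`. -/
noncomputable def circCoeff (ρ : ℝ) (F : ℂ → ℂ) (k : ℤ) : ℂ :=
  ∫ φ in (0 : ℝ)..(2 * π), F (circleMap 0 ρ φ) * circleMap 0 ρ φ ^ (-k)

theorem gegDen_mem_slitPlane {z : ℝ} (h1 : -1 ≤ z) (h2 : z ≤ 1) {r : ℂ} (hr : ‖r‖ < 1) :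
    gegDen z r ∈ Complex.slitPlane := by
  have hn : r.re ^ 2 + r.im ^ 2 < 1 := by
    have := Complex.sq_norm r
    rw [Complex.normSq_apply] at this
    nlinarith [norm_nonneg r]
  rw [Complex.mem_slitPlane_iff]
  have hre : (gegDen z r).re = 1 - 2 * z * r.re + r.re ^ 2 - r.im ^ 2 := by
    simp [gegDen, pow_two]; ring
  have him : (gegDen z r).im = 2 * r.im * (r.re - z) := by
    simp [gegDen, pow_two]; ring
  rw [hre, him]
  by_cases h : r.im = 0
  · left
    rw [h] at hn ⊢
    have h3 : r.re < 1 := by nlinarith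
    have h4 : -1 < r.re := by nlinarith
    rcases le_total 0 r.re with h5 | h5 <;> nlinarith
  · by_cases h' : r.re = z
    · left; rw [h'] at hn ⊢; nlinarith
    · right
      exact mul_ne_zero (mul_ne_zero two_ne_zero h) (sub_ne_zero.mpr h')

theorem one_sub_sq_mem_slitPlane {r : ℂ} (hr : ‖r‖ < 1) : 1 - r ^ 2 ∈ Complex.slitPlane := by
  rw [Complex.mem_slitPlane_iff]
  left
  have : (r ^ 2).re ≤ ‖r ^ 2‖ := Complex.re_le_norm _
  rw [norm_pow] at this
  simp only [Complex.sub_re, Complex.one_re]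
  nlinarith [norm_nonneg r]

theorem norm_circleMap_lt {ρ : ℝ} (h0 : 0 < ρ) (h1 : ρ < 1) (φ : ℝ) : ‖circleMap 0 ρ φ‖ < 1 := by
  rwa [norm_circleMap_zero, abs_of_pos h0]

theorem circleMap_ne_zero' {ρ : ℝ} (h0 : 0 < ρ) (φ : ℝ) : circleMap 0 ρ φ ≠ 0 :=
  circleMap_ne_center h0.ne'

theorem continuous_circCoeff {ρ : ℝ} (h0 : 0 < ρ) (h1 : ρ < 1) {F : ℂ → ℂ}
    (hF : ContinuousOn F (Metric.ball 0 1)) (k : ℤ) :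
    Continuous fun φ => F (circleMap 0 ρ φ) * circleMap 0 ρ φ ^ (-k) := by
  refine Continuous.mul ?_ ?_
  · exact hF.comp_continuous (continuous_circleMap 0 ρ) fun φ => by
      simpa using norm_circleMap_lt h0 h1 φ
  · exact (continuous_circleMap 0 ρ).zpow₀ _ fun φ => Or.inl (circleMap_ne_zero' h0 φ)

theorem circCoeff_const_mul (ρ : ℝ) (c : ℂ) (F : ℂ → ℂ) (k : ℤ) :
    circCoeff ρ (fun r => c * F r) k = c * circCoeff ρ F k := by
  simp only [circCoeff, mul_assoc, intervalIntegral.integral_const_mul]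

theorem circCoeff_add {ρ : ℝ} (h0 : 0 < ρ) (h1 : ρ < 1) {F G : ℂ → ℂ}
    (hF : ContinuousOn F (Metric.ball 0 1)) (hG : ContinuousOn G (Metric.ball 0 1)) (k : ℤ) :
    circCoeff ρ (fun r => F r + G r) k = circCoeff ρ F k + circCoeff ρ G k := by
  simp only [circCoeff, add_mul]
  exact intervalIntegral.integral_add ((continuous_circCoeff h0 h1 hF k).intervalIntegrable _ _)
    ((continuous_circCoeff h0 h1 hG k).intervalIntegrable _ _)

theorem circCoeff_pow_mul {ρ : ℝ} (h0 : 0 < ρ) (F : ℂ → ℂ) (m : ℕ) (k : ℤ) :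
    circCoeff ρ (fun r => r ^ m * F r) k = circCoeff ρ F (k - m) := by
  simp only [circCoeff]
  congr 1; ext φ
  rw [show -(k - (m : ℤ)) = -k + m by ring, zpow_add₀ (circleMap_ne_zero' h0 φ), zpow_natCast]
  ring

theorem circCoeff_congr {ρ : ℝ} (h0 : 0 < ρ) (h1 : ρ < 1) {F G : ℂ → ℂ}
    (h : ∀ r, ‖r‖ < 1 → F r = G r) (k : ℤ) : circCoeff ρ F k = circCoeff ρ G k := by
  simp only [circCoeff]
  congr 1; ext φ
  rw [h _ (norm_circleMap_lt h0 h1 φ)]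

theorem circCoeff_deriv {ρ : ℝ} (h0 : 0 < ρ) (h1 : ρ < 1) {F F' : ℂ → ℂ}
    (hF : ∀ r, ‖r‖ < 1 → HasDerivAt F (F' r) r) (hF' : ContinuousOn F' (Metric.ball 0 1)) (k : ℤ) :
    circCoeff ρ (fun r => r * F' r) k = k * circCoeff ρ F k := by
  have hFc : ContinuousOn F (Metric.ball 0 1) := fun r hr =>
    (hF r (by simpa using hr)).continuousAt.continuousWithinAt
  have hcF' : ContinuousOn (fun r => r * F' r) (Metric.ball 0 1) := continuousOn_id.mul hF'
  have key : ∫ φ in (0 : ℝ)..(2 * π), Complex.I *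
      ((circleMap 0 ρ φ * F' (circleMap 0 ρ φ)) * circleMap 0 ρ φ ^ (-k) -
        k * (F (circleMap 0 ρ φ) * circleMap 0 ρ φ ^ (-k))) = 0 := by
    rw [integral_eq_sub_of_hasDerivAt
      (f := fun φ => F (circleMap 0 ρ φ) * circleMap 0 ρ φ ^ (-k))]
    · have : circleMap 0 ρ (2 * π) = circleMap 0 ρ 0 := by simp [circleMap]
      simp only [this, sub_self]
    · intro φ _
      have hne := circleMap_ne_zero' h0 φ
      have hc := hasDerivAt_circleMap 0 ρ φ
      have e1 := (hF _ (norm_circleMap_lt h0 h1 φ)).comp φ hc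
      have e2 := (hasDerivAt_zpow (-k) (circleMap 0 ρ φ) (Or.inl hne)).comp φ hc
      refine (e1.mul e2).congr_deriv ?_
      simp only [Function.comp, zpow_sub_one₀ hne]
      push_cast
      field_simp
      ring
    · refine Continuous.intervalIntegrable ?_ _ _
      refine continuous_const.mul (Continuous.sub ?_ (continuous_const.mul ?_))
      · exact continuous_circCoeff h0 h1 hcF' k
      · exact continuous_circCoeff h0 h1 hFc k
  have hcc : Continuous fun φ => (k : ℂ) * (F (circleMap 0 ρ φ) * circleMap 0 ρ φ ^ (-k)) :=
    continuous_const.mul (continuous_circCoeff h0 h1 hFc k)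
  rw [intervalIntegral.integral_const_mul, intervalIntegral.integral_sub
    ((continuous_circCoeff h0 h1 hcF' k).intervalIntegrable _ _) (hcc.intervalIntegrable _ _),
    intervalIntegral.integral_const_mul] at key
  have := (mul_eq_zero.mp key).resolve_left Complex.I_ne_zero
  exact sub_eq_zero.mp this

theorem circCoeff_zero {ρ : ℝ} (h0 : 0 < ρ) (h1 : ρ < 1) {F : ℂ → ℂ}
    (hF : DifferentiableOn ℂ F (Metric.ball 0 1)) : circCoeff ρ F 0 = 2 * π * F 0 := by
  have hsub : Metric.closedBall (0 : ℂ) |ρ| ⊆ Metric.ball 0 1 :=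
    Metric.closedBall_subset_ball (by rwa [abs_of_pos h0])
  have hd : DiffContOnCl ℂ F (Metric.ball 0 |ρ|) := by
    apply DifferentiableOn.diffContOnCl
    rw [closure_ball _ (by simpa using h0.ne')]
    exact hF.mono hsub
  have := hd.circleAverage
  rw [Real.circleAverage_def] at this
  rw [← this, circCoeff, Complex.real_smul]
  simp only [neg_zero, zpow_zero, mul_one]
  push_cast
  rw [← mul_assoc, mul_inv_cancel₀, one_mul]
  simp [Real.pi_ne_zero]

theorem circCoeff_neg {ρ : ℝ} (h0 : 0 < ρ) (h1 : ρ < 1) {F : ℂ → ℂ}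
    (hF : DifferentiableOn ℂ F (Metric.ball 0 1)) {m : ℕ} (hm : m ≠ 0) :
    circCoeff ρ F (-m) = 0 := by
  have h := circCoeff_zero h0 h1 (F := fun r => r ^ m * F r)
    ((differentiable_id.pow m).differentiableOn.mul hF)
  rw [circCoeff_pow_mul h0, zero_sub] at h
  rw [h]; simp [hm]

theorem hasDerivAt_gegDen (z : ℝ) (r : ℂ) : HasDerivAt (gegDen z) (2 * r - 2 * z) r := by
  have h1 := ((hasDerivAt_id r).const_mul (2 * z : ℂ)).const_sub 1
  refine (h1.add (hasDerivAt_pow 2 r)).congr_deriv ?_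
  push_cast; ring

theorem hasDerivAt_gegDen_cpow {z : ℝ} (h1 : -1 ≤ z) (h2 : z ≤ 1) (b : ℂ) {r : ℂ} (hr : ‖r‖ < 1) :
    HasDerivAt (fun r => gegDen z r ^ b) (b * gegDen z r ^ (b - 1) * (2 * r - 2 * z)) r :=
  (hasDerivAt_gegDen z r).cpow_const (gegDen_mem_slitPlane h1 h2 hr)

theorem differentiableOn_gegDen_cpow {z : ℝ} (h1 : -1 ≤ z) (h2 : z ≤ 1) (b : ℂ) :
    DifferentiableOn ℂ (fun r => gegDen z r ^ b) (Metric.ball 0 1) := fun r hr =>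
  (hasDerivAt_gegDen_cpow h1 h2 b
    (by simpa using hr)).differentiableAt.differentiableWithinAt

theorem hasDerivAt_one_sub_sq_cpow (a : ℂ) {r : ℂ} (hr : ‖r‖ < 1) :
    HasDerivAt (fun r : ℂ => (1 - r ^ 2) ^ a) (a * (1 - r ^ 2) ^ (a - 1) * (-(2 * r))) r := by
  have : HasDerivAt (fun r : ℂ => 1 - r ^ 2) (-(2 * r)) r := by
    simpa using (hasDerivAt_pow 2 r).const_sub 1
  exact this.cpow_const (one_sub_sq_mem_slitPlane hr)

theorem differentiableOn_one_sub_sq_cpow (a : ℂ) :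
    DifferentiableOn ℂ (fun r : ℂ => (1 - r ^ 2) ^ a) (Metric.ball 0 1) := fun r hr =>
  (hasDerivAt_one_sub_sq_cpow a (by simpa using hr)).differentiableAt.differentiableWithinAt

theorem circCoeff_gegDen_rec {z : ℝ} (h1 : -1 ≤ z) (h2 : z ≤ 1) {ρ : ℝ} (h0 : 0 < ρ) (hρ : ρ < 1)
    (μ : ℂ) (k : ℤ) :
    (k : ℂ) * circCoeff ρ (fun r => gegDen z r ^ (-μ)) k =
      2 * z * (k + μ - 1) * circCoeff ρ (fun r => gegDen z r ^ (-μ)) (k - 1) -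
        (k + 2 * μ - 2) * circCoeff ρ (fun r => gegDen z r ^ (-μ)) (k - 2) := by
  set G : ℂ → ℂ := fun r => gegDen z r ^ (-μ) with hG
  have hGd : ContinuousOn G (Metric.ball 0 1) := (differentiableOn_gegDen_cpow h1 h2 _).continuousOn
  have e := circCoeff_deriv h0 hρ (F := fun r => gegDen z r ^ (1 - μ))
    (F' := fun r => (1 - μ) * G r * (2 * r - 2 * z))
    (fun r hr => by
      have := hasDerivAt_gegDen_cpow h1 h2 (1 - μ) hr
      rwa [show 1 - μ - 1 = -μ by ring] at this)
    ((continuousOn_const.mul hGd).mul (by fun_prop)) k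
  have s1 : ∀ m : ℕ, ContinuousOn (fun r => r ^ m * G r) (Metric.ball 0 1) := fun m =>
    (continuousOn_id.pow m).mul hGd
  have s2 : ∀ (c : ℂ) (m : ℕ), ContinuousOn (fun r => c * (r ^ m * G r)) (Metric.ball 0 1) :=
    fun c m => continuousOn_const.mul (s1 m)
  have s3 : ContinuousOn (fun r => -2 * z * (r ^ 1 * G r) + r ^ 2 * G r) (Metric.ball 0 1) :=
    (s2 _ _).add (s1 _)
  have e1 : circCoeff ρ (fun r => r * ((1 - μ) * G r * (2 * r - 2 * z))) k =
      2 * (1 - μ) * circCoeff ρ G (k - 2) + -(2 * (1 - μ) * z) * circCoeff ρ G (k - 1) := by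
    rw [show k - 2 = k - (2 : ℕ) by norm_num, show k - 1 = k - (1 : ℕ) by norm_num,
      ← circCoeff_pow_mul h0, ← circCoeff_pow_mul h0, ← circCoeff_const_mul, ← circCoeff_const_mul,
      ← circCoeff_add h0 hρ (s2 _ _) (s2 _ _)]
    congr 1; ext r; ring
  have e2 : circCoeff ρ (fun r => gegDen z r ^ (1 - μ)) k =
      circCoeff ρ G k + (-2 * z * circCoeff ρ G (k - 1) + circCoeff ρ G (k - 2)) := by
    rw [show k - 2 = k - (2 : ℕ) by norm_num, show k - 1 = k - (1 : ℕ) by norm_num,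
      ← circCoeff_pow_mul h0, ← circCoeff_pow_mul h0, ← circCoeff_const_mul,
      ← circCoeff_add h0 hρ (s2 _ _) (s1 _),
      ← circCoeff_add h0 hρ hGd s3]
    refine circCoeff_congr h0 hρ (fun r hr => ?_) k
    have hne : gegDen z r ≠ 0 := Complex.slitPlane_ne_zero (gegDen_mem_slitPlane h1 h2 hr)
    rw [show 1 - μ = -μ + 1 by ring, Complex.cpow_add _ _ hne, Complex.cpow_one]
    simp only [hG]
    nth_rewrite 2 [gegDen]
    ring
  rw [e1, e2] at e
  linear_combination -e

theorem circCoeff_gegDen {z : ℝ} (h1 : -1 ≤ z) (h2 : z ≤ 1) {ρ : ℝ} (h0 : 0 < ρ) (hρ : ρ < 1)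
    (μ : ℝ) (k : ℕ) :
    circCoeff ρ (fun r => gegDen z r ^ (-μ : ℂ)) k = 2 * π * ((geg μ k).eval z : ℝ) := by
  set G : ℂ → ℂ := fun r => gegDen z r ^ (-μ : ℂ) with hG
  have hGd := differentiableOn_gegDen_cpow h1 h2 (-μ : ℂ)
  have g0 : circCoeff ρ G 0 = 2 * π := by
    rw [circCoeff_zero h0 hρ hGd]; simp [gegDen]
  have gm : circCoeff ρ G (-1) = 0 := by
    simpa using circCoeff_neg h0 hρ hGd (m := 1) one_ne_zero
  have main : ∀ k : ℕ, circCoeff ρ G k = 2 * π * ((geg μ k).eval z : ℝ) ∧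
      circCoeff ρ G (k + 1 : ℕ) = 2 * π * ((geg μ (k + 1)).eval z : ℝ) := by
    intro k
    induction k with
    | zero =>
      have hr := circCoeff_gegDen_rec h1 h2 h0 hρ (μ : ℂ) 1
      norm_num at hr
      rw [gm, g0] at hr
      refine ⟨by simp [geg, g0], ?_⟩
      rw [Nat.zero_add, Nat.cast_one, hr]
      simp [geg]; ring
    | succ k ih =>
      refine ⟨ih.2, ?_⟩
      have hr := circCoeff_gegDen_rec h1 h2 h0 hρ (μ : ℂ) (k + 2 : ℕ)
      rw [show ((k + 2 : ℕ) : ℤ) - 1 = (k + 1 : ℕ) by push_cast; ring,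
        show ((k + 2 : ℕ) : ℤ) - 2 = (k : ℕ) by push_cast; ring, ← hG, ih.1, ih.2] at hr
      have hg := congrArg (fun x : ℝ => (x : ℂ)) (geg_rec μ k z)
      push_cast at hg hr
      have hk : (k + 2 : ℂ) ≠ 0 := by exact_mod_cast (by omega : k + 2 ≠ 0)
      apply mul_left_cancel₀ hk
      rw [show k + 1 + 1 = k + 2 from rfl]
      push_cast
      rw [hr]
      linear_combination -(2 * π : ℂ) * hg
  exact (main k).1

theorem choose_eq_cesA (δ : ℝ) (j : ℕ) :
    Ring.choose ((δ : ℂ) + j - 1) j = ((cesA (δ - 1) j : ℝ) : ℂ) := by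
  rw [cesA, genBinom_eq_choose, Complex.ofReal_choose]
  push_cast
  congr 1; ring

theorem sq_mem_eball {r : ℂ} (hr : ‖r‖ < 1) : r ^ 2 ∈ Metric.eball (0 : ℂ) 1 := by
  rw [Metric.mem_eball, edist_zero_right]
  have : ‖r ^ 2‖ < 1 := by rw [norm_pow]; nlinarith [norm_nonneg r]
  rw [← ofReal_norm, ENNReal.ofReal_lt_one]; exact this

theorem hasSum_one_sub_sq_cpow (δ : ℝ) {r : ℂ} (hr : ‖r‖ < 1) :
    HasSum (fun j : ℕ => ((cesA (δ - 1) j : ℝ) : ℂ) * r ^ (2 * j)) ((1 - r ^ 2) ^ (-δ : ℂ)) := by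
  have hs := (Complex.one_div_one_sub_cpow_hasFPowerSeriesOnBall_zero (δ : ℂ)).hasSum
    (sq_mem_eball hr)
  simp only [FormalMultilinearSeries.ofScalars_apply_eq, zero_add, one_div, choose_eq_cesA,
    smul_eq_mul, ← pow_mul] at hs
  rwa [Complex.cpow_neg]

theorem summable_cesA_mul_pow (δ : ℝ) {ρ : ℝ} (h0 : 0 < ρ) (h1 : ρ < 1) :
    Summable (fun j : ℕ => |cesA (δ - 1) j| * ρ ^ (2 * j)) := by
  have h := Complex.one_div_one_sub_cpow_hasFPowerSeriesOnBall_zero (δ : ℂ)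
  have hr : ‖(ρ : ℂ)‖ < 1 := by rwa [Complex.norm_real, Real.norm_of_nonneg h0.le]
  have hs := FormalMultilinearSeries.summable_norm_apply _
    (Metric.eball_subset_eball h.r_le (sq_mem_eball hr))
  simp only [FormalMultilinearSeries.ofScalars_apply_eq, choose_eq_cesA,
    smul_eq_mul, ← pow_mul, norm_mul, norm_pow, Complex.norm_real, Real.norm_eq_abs,
    abs_of_pos h0] at hs
  exact hs

theorem circCoeff_cesaro {z : ℝ} (h1 : -1 ≤ z) (h2 : z ≤ 1) {ρ : ℝ} (h0 : 0 < ρ) (hρ : ρ < 1)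
    (μ δ : ℝ) (n : ℕ) :
    circCoeff ρ (fun r => (1 - r ^ 2) ^ (-δ : ℂ) * gegDen z r ^ (-μ : ℂ)) (2 * n : ℕ) =
      2 * π * ((∑ j ∈ Finset.range (n + 1), cesA (δ - 1) j *
        (geg μ (2 * (n - j))).eval z : ℝ) : ℂ) := by
  set G : ℂ → ℂ := fun r => gegDen z r ^ (-μ : ℂ) with hG
  have hGd : DifferentiableOn ℂ G (Metric.ball 0 1) := differentiableOn_gegDen_cpow h1 h2 (-μ : ℂ)
  have hcont := continuous_circCoeff h0 hρ hGd.continuousOn (2 * n : ℕ)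
  obtain ⟨B, hB⟩ := (isCompact_Icc (a := (0 : ℝ)) (b := 2 * π)).exists_bound_of_continuousOn
    hcont.continuousOn
  have hS := summable_cesA_mul_pow δ h0 hρ
  have hsum : HasSum (fun j : ℕ => circCoeff ρ (fun r => ((cesA (δ - 1) j : ℝ) : ℂ) *
      (r ^ (2 * j) * G r)) (2 * n : ℕ))
      (circCoeff ρ (fun r => (1 - r ^ 2) ^ (-δ : ℂ) * G r) (2 * n : ℕ)) := by
    refine hasSum_integral_of_dominated_convergence
      (fun j _ => |cesA (δ - 1) j| * ρ ^ (2 * j) * B) ?_ ?_ ?_ ?_ ?_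
    · intro j
      refine Continuous.aestronglyMeasurable ?_
      exact continuous_circCoeff h0 hρ
        (continuousOn_const.mul ((continuousOn_id.pow _).mul hGd.continuousOn)) _
    · intro j
      refine ae_of_all _ fun φ hφ => ?_
      rw [Set.uIoc_of_le (by positivity)] at hφ
      have hb := hB φ ⟨hφ.1.le, hφ.2⟩
      calc _ = |cesA (δ - 1) j| * ρ ^ (2 * j) *
            ‖G (circleMap 0 ρ φ) * circleMap 0 ρ φ ^ (-((2 * n : ℕ) : ℤ))‖ := by
            simp only [norm_mul, norm_pow, Complex.norm_real, Real.norm_eq_abs,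
              norm_circleMap_zero, abs_of_pos h0]
            ring
        _ ≤ _ := by gcongr
    · exact ae_of_all _ fun φ _ => hS.mul_right B
    · simp
    · refine ae_of_all _ fun φ _ => ?_
      have := (hasSum_one_sub_sq_cpow δ (norm_circleMap_lt h0 hρ φ)).mul_right
        (G (circleMap 0 ρ φ) * circleMap 0 ρ φ ^ (-((2 * n : ℕ) : ℤ)))
      simpa only [mul_assoc] using this
  rw [← hsum.tsum_eq, tsum_eq_sum (s := Finset.range (n + 1))]
  · rw [Complex.ofReal_sum, Finset.mul_sum]
    refine Finset.sum_congr rfl fun j hj => ?_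
    have hjn : j ≤ n := by simp at hj; omega
    rw [circCoeff_const_mul, circCoeff_pow_mul h0,
      show ((2 * n : ℕ) : ℤ) - (2 * j : ℕ) = (2 * (n - j) : ℕ) by push_cast [hjn]; ring,
      circCoeff_gegDen h1 h2 h0 hρ]
    push_cast
    ring
  · intro j hj
    have hjn : n < j := by simp at hj; omega
    rw [circCoeff_const_mul, circCoeff_pow_mul h0,
      show ((2 * n : ℕ) : ℤ) - (2 * j : ℕ) = -(2 * (j - n) : ℕ) by push_cast [hjn.le]; ring,
      circCoeff_neg h0 hρ hGd (by omega), mul_zero]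

/-- Integration by parts on the circle, which gains one power of `N`. -/
theorem circCoeff_reduce {z : ℝ} (h1 : -1 ≤ z) (h2 : z ≤ 1) {ρ : ℝ} (h0 : 0 < ρ) (hρ : ρ < 1)
    (a μ : ℂ) (N : ℤ) :
    N * circCoeff ρ (fun r => (1 - r ^ 2) ^ a * gegDen z r ^ (-μ)) N =
      (2 * a - μ) * circCoeff ρ (fun r => (1 - r ^ 2) ^ a * gegDen z r ^ (-μ)) N +
      (-2 * a * circCoeff ρ (fun r => (1 - r ^ 2) ^ (a - 1) * gegDen z r ^ (-μ)) N +
        μ * circCoeff ρ (fun r => (1 - r ^ 2) ^ (a + 1) * gegDen z r ^ (-μ - 1)) N) := by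
  have hc : ∀ b l : ℂ, ContinuousOn (fun r => (1 - r ^ 2) ^ b * gegDen z r ^ l)
      (Metric.ball 0 1) := fun b l =>
    (differentiableOn_one_sub_sq_cpow b).continuousOn.mul
      (differentiableOn_gegDen_cpow h1 h2 l).continuousOn
  have hcc : ∀ k b l : ℂ, ContinuousOn (fun r => k * ((1 - r ^ 2) ^ b * gegDen z r ^ l))
      (Metric.ball 0 1) := fun k b l => continuousOn_const.mul (hc b l)
  have hs : ContinuousOn (fun r => -2 * a * ((1 - r ^ 2) ^ (a - 1) * gegDen z r ^ (-μ)) +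
      μ * ((1 - r ^ 2) ^ (a + 1) * gegDen z r ^ (-μ - 1))) (Metric.ball 0 1) :=
    (hcc _ _ _).add (hcc _ _ _)
  rw [← circCoeff_deriv h0 hρ (F := fun r => (1 - r ^ 2) ^ a * gegDen z r ^ (-μ))
    (F' := fun r => a * (1 - r ^ 2) ^ (a - 1) * (-(2 * r)) * gegDen z r ^ (-μ) +
      (1 - r ^ 2) ^ a * (-μ * gegDen z r ^ (-μ - 1) * (2 * r - 2 * z)))
    (fun r hr => (hasDerivAt_one_sub_sq_cpow a hr).mul (hasDerivAt_gegDen_cpow h1 h2 (-μ) hr)),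
    ← circCoeff_const_mul, ← circCoeff_const_mul, ← circCoeff_const_mul,
    ← circCoeff_add h0 hρ (hcc _ _ _) (hcc _ _ _), ← circCoeff_add h0 hρ (hcc _ _ _) hs]
  · refine circCoeff_congr h0 hρ (fun r hr => ?_) N
    have hne : gegDen z r ≠ 0 := Complex.slitPlane_ne_zero (gegDen_mem_slitPlane h1 h2 hr)
    have hne2 : 1 - r ^ 2 ≠ 0 := Complex.slitPlane_ne_zero (one_sub_sq_mem_slitPlane hr)
    have e1 : (1 - r ^ 2) ^ a = (1 - r ^ 2) ^ (a - 1) * (1 - r ^ 2) := by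
      rw [Complex.cpow_sub _ _ hne2, Complex.cpow_one, div_mul_cancel₀ _ hne2]
    have e2 : (1 - r ^ 2) ^ (a + 1) = (1 - r ^ 2) ^ (a - 1) * (1 - r ^ 2) * (1 - r ^ 2) := by
      rw [Complex.cpow_add _ _ hne2, Complex.cpow_one, e1]
    have e3 : gegDen z r ^ (-μ) = gegDen z r ^ (-μ - 1) * gegDen z r := by
      rw [Complex.cpow_sub _ _ hne, Complex.cpow_one, div_mul_cancel₀ _ hne]
    rw [e2, e1, e3]
    have e4 : gegDen z r = 1 - 2 * z * r + r ^ 2 := rfl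
    generalize gegDen z r ^ (-μ - 1) = g at *
    generalize (1 - r ^ 2) ^ (a - 1) = h at *
    rw [e4]
    ring
  · refine ContinuousOn.add ?_ ?_
    · refine ContinuousOn.mul (ContinuousOn.mul (continuousOn_const.mul
        (differentiableOn_one_sub_sq_cpow _).continuousOn) (by fun_prop))
        (differentiableOn_gegDen_cpow h1 h2 _).continuousOn
    · exact (differentiableOn_one_sub_sq_cpow _).continuousOn.mul (ContinuousOn.mul
        (continuousOn_const.mul (differentiableOn_gegDen_cpow h1 h2 _).continuousOn) (by fun_prop))

theorem one_sub_mem_slitPlane {w : ℂ} (hw : ‖w‖ ≤ 1) (h1 : w ≠ 1) : 1 - w ∈ Complex.slitPlane := by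
  rw [Complex.mem_slitPlane_iff]
  by_contra! h
  have hre : w.re ≤ ‖w‖ := Complex.re_le_norm w
  simp only [Complex.sub_re, Complex.one_re, Complex.sub_im, Complex.one_im] at h
  apply h1
  apply Complex.ext
  · simp; linarith [h.1]
  · simp; linarith [h.2]

theorem norm_one_sub_le_two_mul {w : ℂ} (hw : ‖w‖ ≤ 1) {s : ℝ} (h0 : 0 ≤ s) (h1 : s ≤ 1) :
    ‖1 - w‖ ≤ 2 * ‖1 - s * w‖ := by
  have hs : ‖(s : ℂ) * w‖ ≤ s := by
    rw [norm_mul, Complex.norm_of_nonneg h0]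
    nlinarith [norm_nonneg w]
  have h3 : 1 - s ≤ ‖1 - s * w‖ := by
    have := norm_sub_norm_le (1 : ℂ) (s * w)
    rw [norm_one] at this; linarith
  have h4 : ‖1 - w‖ ≤ ‖1 - s * w‖ + ‖((s - 1 : ℝ) : ℂ) * w‖ := by
    have := norm_add_le (1 - s * w) (((s - 1 : ℝ) : ℂ) * w)
    refine le_trans (le_of_eq ?_) this
    congr 1; push_cast; ring
  have h5 : ‖((s - 1 : ℝ) : ℂ) * w‖ ≤ 1 - s := by
    rw [norm_mul, Complex.norm_real, Real.norm_eq_abs, abs_of_nonpos (by linarith)]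
    nlinarith [norm_nonneg w]
  linarith

theorem norm_cpow_one_sub_le {w : ℂ} (hw : ‖w‖ ≤ 1) (hw1 : w ≠ 1) {s : ℝ} (h0 : 0 ≤ s) (h1 : s ≤ 1)
    (a : ℝ) : ‖(1 - s * w) ^ (a : ℂ)‖ ≤ 2 ^ |a| * (1 + ‖1 - w‖ ^ a) := by
  have hpos : 0 < ‖1 - w‖ := norm_pos_iff.mpr (sub_ne_zero.mpr hw1.symm)
  have h2 := norm_one_sub_le_two_mul hw h0 h1
  have h3 : ‖1 - (s : ℂ) * w‖ ≤ 2 := by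
    refine (norm_sub_le _ _).trans ?_
    rw [norm_one, norm_mul, Complex.norm_of_nonneg h0]
    nlinarith [norm_nonneg w]
  rw [Complex.norm_cpow_real]
  have hp := Real.rpow_pos_of_pos hpos a
  rcases le_total 0 a with ha | ha
  · rw [abs_of_nonneg ha]
    refine (Real.rpow_le_rpow (norm_nonneg _) h3 ha).trans ?_
    exact le_mul_of_one_le_right (by positivity) (by linarith)
  · rw [abs_of_nonpos ha]
    refine (Real.rpow_le_rpow_of_nonpos (by linarith : 0 < ‖1 - w‖ / 2)
      (by linarith) ha).trans ?_
    rw [Real.div_rpow hpos.le (by norm_num), div_eq_mul_inv, ← Real.rpow_neg (by norm_num), mul_comm]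
    gcongr; linarith

theorem tendsto_integral_shift {κ a b : ℝ} (hab : a ≤ b) {F : ℂ → ℂ} {γ γ' : ℝ → ℂ}
    (hF : ContinuousOn F {t | ‖t‖ ≤ 1 ∧ t.im ≤ 0}) (hγ : Continuous γ) (hγ' : Continuous γ')
    (h1 : ∀ x ∈ Set.Icc a b, ‖γ x‖ ≤ 1 ∧ (γ x).im ≤ 0)
    (hne : ∀ x ∈ Set.Ioo a b, γ x ^ 2 ≠ 1)
    (hint : IntervalIntegrable (fun x => ‖1 - γ x ^ 2‖ ^ κ) volume a b) :
    Filter.Tendsto (fun s : ℝ => ∫ x in a..b, F (γ x) * (1 - s * γ x ^ 2) ^ (κ : ℂ) * γ' x)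
      (nhdsWithin 1 (Set.Iio 1)) (nhds (∫ x in a..b, F (γ x) * (1 - γ x ^ 2) ^ (κ : ℂ) * γ' x)) := by
  have hcF : ContinuousOn (fun x => F (γ x)) (Set.Icc a b) := hF.comp hγ.continuousOn h1
  obtain ⟨M, hM⟩ := isCompact_Icc.exists_bound_of_continuousOn hcF
  obtain ⟨M', hM'⟩ := isCompact_Icc.exists_bound_of_continuousOn (hγ'.continuousOn (s := Set.Icc a b))
  have hio : ∀ᵐ x : ℝ, x ∈ Set.uIoc a b → x ∈ Set.Ioo a b := by
    have : ∀ᵐ x : ℝ, x ≠ b := by simp [ae_iff]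
    filter_upwards [this] with x hx hx'
    rw [Set.uIoc_of_le hab] at hx'
    exact ⟨hx'.1, lt_of_le_of_ne hx'.2 hx⟩
  have hev : ∀ᶠ s : ℝ in nhdsWithin 1 (Set.Iio 1), 0 < s ∧ s < 1 := by
    filter_upwards [self_mem_nhdsWithin, nhdsWithin_le_nhds (lt_mem_nhds (zero_lt_one' ℝ))] with s h2 h3
    exact ⟨h3, h2⟩
  refine intervalIntegral.tendsto_integral_filter_of_dominated_convergence
    (fun x => |M| * (2 ^ |κ| * (1 + ‖1 - γ x ^ 2‖ ^ κ)) * |M'|) ?_ ?_ ?_ ?_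
  · filter_upwards [hev] with s hs
    rw [Set.uIoc_of_le hab]
    refine (ContinuousOn.mono ?_ Set.Ioc_subset_Icc_self).aestronglyMeasurable measurableSet_Ioc
    refine (hcF.mul ?_).mul hγ'.continuousOn
    refine ContinuousOn.cpow ?_ continuousOn_const ?_
    · fun_prop
    · intro x hx
      have h4 : ‖(s : ℂ) * γ x ^ 2‖ < 1 := by
        rw [norm_mul, Complex.norm_of_nonneg hs.1.le, norm_pow]
        have := pow_le_one₀ (norm_nonneg _) (h1 x hx).1 (n := 2)
        nlinarith
      refine one_sub_mem_slitPlane h4.le ?_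
      intro h; rw [h] at h4; simp at h4
  · filter_upwards [hev] with s hs
    filter_upwards [hio] with x hx hx'
    have hx2 := Set.Ioo_subset_Icc_self (hx hx')
    rw [norm_mul, norm_mul]
    have h4 : ‖γ x ^ 2‖ ≤ 1 := by
      rw [norm_pow]; exact pow_le_one₀ (norm_nonneg _) (h1 x hx2).1
    have := norm_cpow_one_sub_le h4 (hne x (hx hx')) hs.1.le hs.2.le κ
    gcongr
    · exact (hM x hx2).trans (le_abs_self _)
    · exact (hM' x hx2).trans (le_abs_self _)
  · have hc : IntervalIntegrable (fun _ : ℝ => (1 : ℝ)) volume a b := intervalIntegrable_const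
    exact (((hc.add hint).const_mul (2 ^ |κ|)).const_mul |M|).mul_const |M'|
  · filter_upwards [hio] with x hx hx'
    have hx2 := Set.Ioo_subset_Icc_self (hx hx')
    have h4 : ‖γ x ^ 2‖ ≤ 1 := by
      rw [norm_pow]; exact pow_le_one₀ (norm_nonneg _) (h1 x hx2).1
    have h5 := one_sub_mem_slitPlane h4 (hne x (hx hx'))
    refine Filter.Tendsto.mul_const _ (Filter.Tendsto.const_mul _ ?_)
    refine Filter.Tendsto.mono_left ?_ nhdsWithin_le_nhds
    have h6 : ContinuousAt (fun s : ℝ => (1 - (s : ℂ) * γ x ^ 2) ^ (κ : ℂ)) 1 := by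
      refine ContinuousAt.cpow (by fun_prop) continuousAt_const ?_
      simpa using h5
    have := h6.tendsto
    simpa using this

theorem integral_regularized_shift {κ c : ℝ} (hc : 0 < c) {F : ℂ → ℂ}
    (hF : DifferentiableOn ℂ F {t | t.im < c}) {s : ℝ} (h0 : 0 < s) (h1 : s < 1) :
    (∫ t in (-1 : ℝ)..1, F t * (1 - s * (t : ℂ) ^ 2) ^ (κ : ℂ)) +
      ∫ θ in (0 : ℝ)..π, F (Complex.exp (-θ * Complex.I)) *
        (1 - s * Complex.exp (-θ * Complex.I) ^ 2) ^ (κ : ℂ) *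
        (-Complex.I * Complex.exp (-θ * Complex.I)) = 0 := by
  set R : ℝ := 1 / (2 * c * s) with hR
  have hRpos : 0 < R := by positivity
  have hRs : 2 * R * c = 1 / s := by rw [hR]; field_simp
  set B := Metric.ball (-(R : ℂ) * Complex.I) (√(R ^ 2 + 1 / s)) with hB
  have hmem : ∀ t : ℂ, t ∈ B ↔ t.re ^ 2 + (t.im + R) ^ 2 < R ^ 2 + 1 / s := by
    intro t
    rw [hB, Metric.mem_ball, dist_eq_norm, Real.lt_sqrt (norm_nonneg _), Complex.sq_norm,
      Complex.normSq_apply]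
    simp [pow_two]
  have hs1 : 1 < 1 / s := by rw [lt_div_iff₀ h0]; linarith
  have hdisc : ∀ t : ℂ, ‖t‖ ≤ 1 → t.im ≤ 0 → t ∈ B := by
    intro t ht hi
    rw [hmem]
    have : t.re ^ 2 + t.im ^ 2 ≤ 1 := by
      have h2 := Complex.sq_norm t
      rw [Complex.normSq_apply] at h2
      nlinarith [norm_nonneg t]
    nlinarith
  have hd : DifferentiableOn ℂ (fun t => F t * (1 - s * t ^ 2) ^ (κ : ℂ)) B := by
    refine DifferentiableOn.mul (hF.mono ?_) ?_
    · intro t ht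
      rw [hmem] at ht
      simp only [Set.mem_ofPred_eq]
      by_contra! h
      nlinarith [sq_nonneg t.re]
    · refine DifferentiableOn.cpow (by fun_prop) (by fun_prop) ?_
      intro t ht
      rw [hmem] at ht
      rw [Complex.mem_slitPlane_iff]
      by_cases hi : t.im = 0
      · left
        rw [hi] at ht
        have h3 : t.re ^ 2 < 1 / s := by linarith
        rw [lt_div_iff₀ h0] at h3
        simp [pow_two, hi]
        nlinarith
      · by_cases hr : t.re = 0
        · left
          simp [pow_two, hr]
          nlinarith [mul_nonneg h0.le (mul_self_nonneg t.im)]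
        · right
          simp [pow_two]
          refine ⟨h0.ne', fun h => ?_⟩
          exact mul_ne_zero hr hi (by linarith)
  obtain ⟨G, hG⟩ := hd.isExactOn_ball
  have e1 : ∫ t in (-1 : ℝ)..1, F t * (1 - s * (t : ℂ) ^ 2) ^ (κ : ℂ) = G (1 : ℝ) - G (-1 : ℝ) := by
    have hin : ∀ t ∈ Set.uIcc (-1 : ℝ) 1, (t : ℂ) ∈ B := by
      intro t ht
      rw [Set.uIcc_of_le (by norm_num)] at ht
      exact hdisc _ (by rw [Complex.norm_real]; exact abs_le.mpr ht) (by simp)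
    refine intervalIntegral.integral_eq_sub_of_hasDerivAt (f := fun t : ℝ => G t) ?_ ?_
    · intro t ht
      exact (hG _ (hin t ht)).comp_ofReal
    · refine ContinuousOn.intervalIntegrable ?_
      exact hd.continuousOn.comp Complex.continuous_ofReal.continuousOn hin
  have e2 : ∫ θ in (0 : ℝ)..π, F (Complex.exp (-θ * Complex.I)) *
        (1 - s * Complex.exp (-θ * Complex.I) ^ 2) ^ (κ : ℂ) *
        (-Complex.I * Complex.exp (-θ * Complex.I)) =
      G (Complex.exp (-(π : ℝ) * Complex.I)) - G (Complex.exp (-(0 : ℝ) * Complex.I)) := by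
    have hin : ∀ θ ∈ Set.uIcc (0 : ℝ) π, Complex.exp (-θ * Complex.I) ∈ B := by
      intro t ht
      rw [Set.uIcc_of_le pi_pos.le] at ht
      refine hdisc _ ?_ ?_
      · rw [← Complex.ofReal_neg, Complex.norm_exp_ofReal_mul_I]
      · rw [← Complex.ofReal_neg, Complex.exp_ofReal_mul_I_im, Real.sin_neg]
        linarith [Real.sin_nonneg_of_mem_Icc ht]
    have hexp : ∀ θ : ℝ, HasDerivAt (fun θ : ℝ => Complex.exp (-θ * Complex.I))
        (-Complex.I * Complex.exp (-θ * Complex.I)) θ := by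
      intro θ
      have h2 : HasDerivAt (fun θ : ℂ => Complex.exp (-θ * Complex.I))
          (Complex.exp (-θ * Complex.I) * (-1 * Complex.I)) θ :=
        ((hasDerivAt_neg' (θ : ℂ)).mul_const Complex.I).cexp
      exact (h2.comp_ofReal).congr_deriv (by ring)
    refine intervalIntegral.integral_eq_sub_of_hasDerivAt
      (f := fun θ : ℝ => G (Complex.exp (-θ * Complex.I))) ?_ ?_
    · intro t ht
      have := (hG _ (hin t ht)).comp t (hexp t)
      exact this
    · refine ContinuousOn.intervalIntegrable ?_
      refine ContinuousOn.mul ?_ (by fun_prop)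
      exact hd.continuousOn.comp (by fun_prop) hin
  rw [e1, e2]
  simp [Complex.exp_neg]

theorem half_le_sin {θ : ℝ} (h0 : 0 ≤ θ) (h1 : θ ≤ π / 2) : θ / 2 ≤ Real.sin θ := by
  refine le_trans ?_ (Real.mul_le_sin h0 h1)
  have : (1 : ℝ) / 2 ≤ 2 / π := by
    rw [div_le_div_iff₀ (by norm_num) pi_pos]; linarith [pi_lt_four]
  nlinarith

theorem sin_rpow_le (a : ℝ) {θ : ℝ} (h0 : 0 < θ) (h1 : θ < π) :
    Real.sin θ ^ a ≤ 2 ^ |a| * (θ ^ a + (π - θ) ^ a) := by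
  have key : ∀ x : ℝ, 0 < x → x ≤ π / 2 → Real.sin x ^ a ≤ 2 ^ |a| * x ^ a := by
    intro x hx hx'
    have h2 := half_le_sin hx.le hx'
    have h3 := Real.sin_le hx.le
    have hp := Real.rpow_pos_of_pos hx a
    rcases le_total 0 a with ha | ha
    · refine (Real.rpow_le_rpow (by linarith) h3 ha).trans ?_
      exact le_mul_of_one_le_left hp.le (Real.one_le_rpow (by norm_num) (abs_nonneg a))
    · refine (Real.rpow_le_rpow_of_nonpos (by linarith : 0 < x / 2) h2 ha).trans (le_of_eq ?_)
      rw [Real.div_rpow hx.le (by norm_num), abs_of_nonpos ha, Real.rpow_neg (by norm_num),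
        div_eq_mul_inv, mul_comm]
  have hp := Real.rpow_pos_of_pos h0 a
  have hp' := Real.rpow_pos_of_pos (sub_pos.mpr h1) a
  rcases le_total θ (π / 2) with h | h
  · refine (key θ h0 h).trans ?_
    gcongr; linarith
  · rw [← Real.sin_pi_sub]
    refine (key (π - θ) (by linarith) (by linarith)).trans ?_
    gcongr; linarith

theorem intervalIntegrable_sin_rpow {a : ℝ} (ha : -1 < a) :
    IntervalIntegrable (fun θ => Real.sin θ ^ a) volume 0 π := by
  have h1 : IntervalIntegrable (fun θ : ℝ => θ ^ a) volume 0 π :=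
    intervalIntegral.intervalIntegrable_rpow' ha
  have h2 : IntervalIntegrable (fun θ : ℝ => (π - θ) ^ a) volume 0 π := by
    have := (h1.comp_sub_left π).symm
    simpa using this
  refine ((h1.add h2).const_mul (2 ^ |a|)).mono_fun' ?_ ?_
  · exact (Real.measurable_sin.pow_const a).aestronglyMeasurable
  · rw [Filter.EventuallyLE, ae_restrict_iff' measurableSet_uIoc]
    have : ∀ᵐ x : ℝ, x ≠ π := by simp [ae_iff]
    filter_upwards [this] with x hx hx'
    rw [Set.uIoc_of_le pi_pos.le] at hx'
    have h3 := lt_of_le_of_ne hx'.2 hx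
    rw [Real.norm_of_nonneg (Real.rpow_nonneg (Real.sin_nonneg_of_mem_Icc ⟨hx'.1.le, h3.le⟩) _)]
    exact sin_rpow_le a hx'.1 h3

/-- The lower unit semicircle, traversed from `1` to `-1`. -/
noncomputable def arcPt (θ : ℝ) : ℂ := Complex.exp (-θ * Complex.I)

/-- The weight picked up when `(1-t²)^{κ-1} dt` on `[-1,1]` is moved to the lower semicircle. -/
noncomputable def arcWt (κ θ : ℝ) : ℂ :=
  (1 - arcPt θ ^ 2) ^ ((κ - 1 : ℝ) : ℂ) * (Complex.I * arcPt θ)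

theorem continuous_arcPt : Continuous arcPt := by unfold arcPt; fun_prop

theorem norm_arcPt (θ : ℝ) : ‖arcPt θ‖ = 1 := by
  rw [arcPt, ← Complex.ofReal_neg, Complex.norm_exp_ofReal_mul_I]

theorem arcPt_im (θ : ℝ) : (arcPt θ).im = -Real.sin θ := by
  rw [arcPt, ← Complex.ofReal_neg, Complex.exp_ofReal_mul_I_im, Real.sin_neg]

theorem arcPt_re (θ : ℝ) : (arcPt θ).re = Real.cos θ := by
  rw [arcPt, ← Complex.ofReal_neg, Complex.exp_ofReal_mul_I_re, Real.cos_neg]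

theorem one_sub_arcPt_sq (θ : ℝ) :
    1 - arcPt θ ^ 2 = 2 * (Real.sin θ : ℂ) * (Complex.I * arcPt θ) := by
  have h := Real.sin_sq_add_cos_sq θ
  apply Complex.ext
  · simp [pow_two, arcPt_im, arcPt_re, -Complex.ofReal_sin]; nlinarith
  · simp [pow_two, arcPt_im, arcPt_re, -Complex.ofReal_sin]; ring

theorem norm_one_sub_arcPt_sq {θ : ℝ} (h : 0 ≤ Real.sin θ) :
    ‖1 - arcPt θ ^ 2‖ = 2 * Real.sin θ := by
  rw [one_sub_arcPt_sq, norm_mul, norm_mul, norm_mul, Complex.norm_I, norm_arcPt,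
    Complex.norm_real, Real.norm_of_nonneg h]
  simp

theorem norm_arcWt (κ : ℝ) {θ : ℝ} (h : 0 ≤ Real.sin θ) :
    ‖arcWt κ θ‖ = 2 ^ (κ - 1) * Real.sin θ ^ (κ - 1) := by
  rw [arcWt, norm_mul, Complex.norm_cpow_real, norm_one_sub_arcPt_sq h, norm_mul, Complex.norm_I,
    norm_arcPt, Real.mul_rpow (by norm_num) h]
  ring

theorem measurable_arcWt (κ : ℝ) : Measurable (arcWt κ) := by
  have := continuous_arcPt.measurable
  unfold arcWt
  fun_prop

theorem integral_shift {κ c : ℝ} (hκ : 0 < κ) (hc : 0 < c) {F : ℂ → ℂ}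
    (hF : DifferentiableOn ℂ F {t | t.im < c}) :
    (∫ t in (-1 : ℝ)..1, F t * ((1 - t ^ 2) ^ (κ - 1) : ℝ)) =
      ∫ θ in (0 : ℝ)..π, F (arcPt θ) * arcWt κ θ := by
  have hFc : ContinuousOn F {t | ‖t‖ ≤ 1 ∧ t.im ≤ 0} :=
    hF.continuousOn.mono fun t ht => ht.2.trans_lt hc
  have t1 := tendsto_integral_shift (κ := κ - 1) (a := -1) (b := 1) (by norm_num) hFc
    Complex.continuous_ofReal (continuous_const (y := (1 : ℂ)))
    (fun x hx => ⟨by rw [Complex.norm_real]; exact abs_le.mpr hx, by simp⟩)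
    (fun x hx h => by
      have : x ^ 2 = 1 := by exact_mod_cast h
      nlinarith [hx.1, hx.2])
    (by
      refine (intervalIntegrable_one_sub_sq_rpow (a := κ - 1) (by linarith)).congr ?_
      intro x hx
      rw [Set.uIoc_of_le (by norm_num)] at hx
      have h2 : 0 ≤ 1 - x ^ 2 := by nlinarith [hx.1, hx.2]
      simp only
      rw [show (1 : ℂ) - (x : ℂ) ^ 2 = ((1 - x ^ 2 : ℝ) : ℂ) by push_cast; ring, Complex.norm_real,
        Real.norm_of_nonneg h2])
  have t2 := tendsto_integral_shift (κ := κ - 1) (a := 0) (b := π) pi_pos.le hFc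
    continuous_arcPt ((continuous_const (y := -Complex.I)).mul continuous_arcPt)
    (fun x hx => ⟨(norm_arcPt x).le, by
      rw [arcPt_im]; linarith [Real.sin_nonneg_of_mem_Icc hx]⟩)
    (fun x hx h => by
      have h1 := norm_one_sub_arcPt_sq (Real.sin_pos_of_mem_Ioo hx).le
      rw [h] at h1
      simp at h1
      linarith [Real.sin_pos_of_mem_Ioo hx])
    (by
      refine ((intervalIntegrable_sin_rpow (a := κ - 1) (by linarith)).const_mul
        (2 ^ (κ - 1))).congr ?_
      intro x hx
      rw [Set.uIoc_of_le pi_pos.le] at hx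
      have h2 := Real.sin_nonneg_of_mem_Icc ⟨hx.1.le, hx.2⟩
      simp only
      rw [norm_one_sub_arcPt_sq h2, Real.mul_rpow (by norm_num) h2])
  have hz : ∀ᶠ s : ℝ in nhdsWithin 1 (Set.Iio 1),
      (∫ t in (-1 : ℝ)..1, F t * (1 - s * (t : ℂ) ^ 2) ^ ((κ - 1 : ℝ) : ℂ) * 1) +
      (∫ θ in (0 : ℝ)..π, F (arcPt θ) * (1 - s * arcPt θ ^ 2) ^ ((κ - 1 : ℝ) : ℂ) *
        (-Complex.I * arcPt θ)) = 0 := by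
    filter_upwards [self_mem_nhdsWithin, nhdsWithin_le_nhds (lt_mem_nhds (zero_lt_one' ℝ))]
      with s h2 h3
    have := integral_regularized_shift (κ := κ - 1) hc hF h3 h2
    simpa [arcPt] using this
  have h0 := tendsto_nhds_unique (t1.add t2) (tendsto_const_nhds.congr' (hz.mono fun _ h => h.symm))
  have e1 : (∫ t in (-1 : ℝ)..1, F t * ((1 - t ^ 2) ^ (κ - 1) : ℝ)) =
      ∫ t in (-1 : ℝ)..1, F t * (1 - (t : ℂ) ^ 2) ^ ((κ - 1 : ℝ) : ℂ) * 1 := by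
    refine intervalIntegral.integral_congr fun t ht => ?_
    rw [Set.uIcc_of_le (by norm_num)] at ht
    have h2 : 0 ≤ 1 - t ^ 2 := by nlinarith [ht.1, ht.2]
    rw [Complex.ofReal_cpow h2, mul_one]
    push_cast; rfl
  have e2 : (∫ θ in (0 : ℝ)..π, F (arcPt θ) * arcWt κ θ) =
      -∫ θ in (0 : ℝ)..π, F (arcPt θ) * (1 - arcPt θ ^ 2) ^ ((κ - 1 : ℝ) : ℂ) *
        (-Complex.I * arcPt θ) := by
    rw [← intervalIntegral.integral_neg]
    congr 1; ext θ
    rw [arcWt]; ring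
  rw [e1, e2]
  exact eq_neg_of_add_eq_zero_left h0

theorem integral_pi_succ (ν : Measure ℝ) [SigmaFinite ν] {m : ℕ} (g : ℝ → (Fin m → ℝ) → ℂ) :
    ∫ x, g (x 0) (fun j => x j.succ) ∂Measure.pi (fun _ : Fin (m + 1) => ν) =
      ∫ z : ℝ × (Fin m → ℝ), g z.1 z.2 ∂ν.prod (Measure.pi fun _ : Fin m => ν) := by
  have := (measurePreserving_piFinSuccAbove (fun _ : Fin (m + 1) => ν) 0).integral_comp'
    (fun z : ℝ × (Fin m → ℝ) => g z.1 z.2)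
  rw [← this]
  rfl

theorem integrable_comp_add {α β : Type*} [MeasurableSpace α] [MeasurableSpace β]
    {ν₁ : Measure α} {ν₂ : Measure β} [SFinite ν₁] [SFinite ν₂] {f : ℂ → ℂ} (hf : Measurable f)
    {c M : ℝ} (hM : ∀ u : ℂ, c ≤ u.im → ‖f u‖ ≤ M) {A : α → ℂ} {B : β → ℂ}
    (hA : Measurable A) (hB : Measurable B) (u : ℂ) (hu : c ≤ u.im)
    (hA0 : ∀ᵐ x ∂ν₁, (A x).im ≤ 0) (hB0 : ∀ᵐ x ∂ν₂, (B x).im ≤ 0)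
    {w₁ : α → ℂ} {w₂ : β → ℂ} (h₁ : Integrable w₁ ν₁) (h₂ : Integrable w₂ ν₂) :
    Integrable (fun z : α × β => f (u - (A z.1 + B z.2)) * (w₁ z.1 * w₂ z.2)) (ν₁.prod ν₂) := by
  refine (h₁.mul_prod h₂).bdd_mul (c := M) ?_ ?_
  · exact (hf.comp (by fun_prop)).aestronglyMeasurable
  · filter_upwards [Measure.quasiMeasurePreserving_fst.ae hA0,
      Measure.quasiMeasurePreserving_snd.ae hB0] with z h1 h2
    refine hM _ ?_
    simp only [Complex.sub_im, Complex.add_im]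
    linarith

theorem ae_pi_of_ae {ν : Measure ℝ} [SigmaFinite ν] {m : ℕ} {p : ℝ → Prop} (h : ∀ᵐ x ∂ν, p x) :
    ∀ᵐ x ∂Measure.pi (fun _ : Fin m => ν), ∀ j, p (x j) := by
  rw [ae_all_iff]
  intro j
  exact (Measure.tendsto_eval_ae_ae (μ := fun _ : Fin m => ν) (i := j)).eventually h

/-- Replace, one variable at a time, `(ν₁, γ₁, w₁)` by `(ν₂, γ₂, w₂)` in an integral over a product. -/
theorem integral_pi_replace {ν₁ ν₂ : Measure ℝ} [SigmaFinite ν₁] [SigmaFinite ν₂]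
    {γ₁ γ₂ : ℝ → ℂ} (hγ₁ : Measurable γ₁) (hγ₂ : Measurable γ₂)
    (h1 : ∀ᵐ x ∂ν₁, (γ₁ x).im ≤ 0) (h2 : ∀ᵐ x ∂ν₂, (γ₂ x).im ≤ 0)
    {f : ℂ → ℂ} (hf : Measurable f) (hM : ∀ c : ℝ, 0 < c → ∃ M, ∀ u : ℂ, c ≤ u.im → ‖f u‖ ≤ M)
    {m : ℕ} (w₁ w₂ : Fin m → ℝ → ℂ) (hw₁ : ∀ j, Integrable (w₁ j) ν₁)
    (hw₂ : ∀ j, Integrable (w₂ j) ν₂) (b : Fin m → ℝ) (hb : ∀ j, 0 ≤ b j)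
    (hstep : ∀ j, ∀ u : ℂ, 0 < u.im →
      ∫ x, f (u - b j * γ₁ x) * w₁ j x ∂ν₁ = ∫ x, f (u - b j * γ₂ x) * w₂ j x ∂ν₂)
    (u : ℂ) (hu : 0 < u.im) :
    ∫ x, f (u - ∑ j, b j * γ₁ (x j)) * ∏ j, w₁ j (x j) ∂Measure.pi (fun _ : Fin m => ν₁) =
      ∫ x, f (u - ∑ j, b j * γ₂ (x j)) * ∏ j, w₂ j (x j) ∂Measure.pi (fun _ : Fin m => ν₂) := by
  induction m generalizing u with
  | zero =>
    have : Measure.pi (fun _ : Fin 0 => ν₁) = Measure.pi (fun _ : Fin 0 => ν₂) := by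
      rw [Measure.pi_of_empty, Measure.pi_of_empty]
    simp [this]
  | succ m ih =>
    obtain ⟨M, hM'⟩ := hM u.im hu
    have him : ∀ {γ : ℝ → ℂ} {β : ℝ}, 0 ≤ β → ∀ {x : ℝ}, (γ x).im ≤ 0 → ((β : ℂ) * γ x).im ≤ 0 := by
      intro γ β hβ x hx
      rw [Complex.im_ofReal_mul]
      exact mul_nonpos_of_nonneg_of_nonpos hβ hx
    have hsum : ∀ {γ : ℝ → ℂ} {x : Fin m → ℝ}, (∀ j, (γ (x j)).im ≤ 0) →
        (∑ j, (b (Fin.succ j) : ℂ) * γ (x j)).im ≤ 0 := by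
      intro γ x hx
      rw [Complex.im_sum]
      exact Finset.sum_nonpos fun j _ => him (hb _) (hx j)
    have hA : ∀ {ν : Measure ℝ} {γ : ℝ → ℂ}, (∀ᵐ x ∂ν, (γ x).im ≤ 0) →
        ∀ᵐ x ∂ν, ((b 0 : ℂ) * γ x).im ≤ 0 := by
      intro ν γ h; filter_upwards [h] with x hx using him (hb 0) hx
    have hB : ∀ {ν : Measure ℝ} [SigmaFinite ν] {γ : ℝ → ℂ}, (∀ᵐ x ∂ν, (γ x).im ≤ 0) →
        ∀ᵐ x ∂Measure.pi (fun _ : Fin m => ν), (∑ j, (b (Fin.succ j) : ℂ) * γ (x j)).im ≤ 0 := by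
      intro ν _ γ h; filter_upwards [ae_pi_of_ae h] with x hx using hsum hx
    have hP : ∀ {ν : Measure ℝ} [SigmaFinite ν] {w : Fin (m + 1) → ℝ → ℂ},
        (∀ j, Integrable (w j) ν) →
        Integrable (fun x => ∏ j : Fin m, w j.succ (x j)) (Measure.pi (fun _ : Fin m => ν)) := by
      intro ν _ w h
      exact Integrable.fintype_prod (f := fun j : Fin m => w j.succ) fun j => h _
    have hsucc : ∀ (ν : Measure ℝ) [SigmaFinite ν] (γ : ℝ → ℂ) (w : Fin (m + 1) → ℝ → ℂ),
        ∫ x, f (u - ∑ j, b j * γ (x j)) * ∏ j, w j (x j) ∂Measure.pi (fun _ : Fin (m + 1) => ν) =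
        ∫ z : ℝ × (Fin m → ℝ), f (u - (b 0 * γ z.1 + ∑ j, b (Fin.succ j) * γ (z.2 j))) *
          (w 0 z.1 * ∏ j : Fin m, w j.succ (z.2 j)) ∂ν.prod (Measure.pi fun _ : Fin m => ν) := by
      intro ν _ γ w
      rw [← integral_pi_succ ν (fun x y => f (u - (b 0 * γ x + ∑ j, b (Fin.succ j) * γ (y j))) *
          (w 0 x * ∏ j : Fin m, w j.succ (y j)))]
      simp only [Fin.sum_univ_succ, Fin.prod_univ_succ]
    have i1 := integrable_comp_add (ν₁ := ν₁) (ν₂ := Measure.pi fun _ : Fin m => ν₁) hf hM'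
      (A := fun x => b 0 * γ₁ x) (B := fun y => ∑ j, (b (Fin.succ j) : ℂ) * γ₁ (y j))
      (by fun_prop) (by fun_prop) u le_rfl (hA h1) (hB h1) (hw₁ 0) (hP hw₁)
    have i2 := integrable_comp_add (ν₁ := ν₁) (ν₂ := Measure.pi fun _ : Fin m => ν₂) hf hM'
      (A := fun x => b 0 * γ₁ x) (B := fun y => ∑ j, (b (Fin.succ j) : ℂ) * γ₂ (y j))
      (by fun_prop) (by fun_prop) u le_rfl (hA h1) (hB h2) (hw₁ 0) (hP hw₂)
    have i3 := integrable_comp_add (ν₁ := ν₂) (ν₂ := Measure.pi fun _ : Fin m => ν₂) hf hM'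
      (A := fun x => b 0 * γ₂ x) (B := fun y => ∑ j, (b (Fin.succ j) : ℂ) * γ₂ (y j))
      (by fun_prop) (by fun_prop) u le_rfl (hA h2) (hB h2) (hw₂ 0) (hP hw₂)
    rw [hsucc, hsucc, MeasureTheory.integral_prod _ i1, MeasureTheory.integral_prod_symm _ i3]
    have e1 : ∫ x, ∫ y, f (u - (b 0 * γ₁ x + ∑ j, b (Fin.succ j) * γ₁ (y j))) *
          (w₁ 0 x * ∏ j : Fin m, w₁ j.succ (y j)) ∂(Measure.pi fun _ : Fin m => ν₁) ∂ν₁ =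
        ∫ x, ∫ y, f (u - (b 0 * γ₁ x + ∑ j, b (Fin.succ j) * γ₂ (y j))) *
          (w₁ 0 x * ∏ j : Fin m, w₂ j.succ (y j)) ∂(Measure.pi fun _ : Fin m => ν₂) ∂ν₁ := by
      refine MeasureTheory.integral_congr_ae ?_
      filter_upwards [h1] with x hx
      have hx' := him (hb 0) hx
      have := ih (fun j => w₁ j.succ) (fun j => w₂ j.succ) (fun j => hw₁ _) (fun j => hw₂ _)
        (fun j => b j.succ) (fun j => hb _) (fun j => hstep _) (u - b 0 * γ₁ x)
        (by simp only [Complex.sub_im]; linarith)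
      simp only [← sub_sub, mul_left_comm _ (w₁ 0 x), MeasureTheory.integral_const_mul]
      rw [this]
    have e2 : ∫ y, ∫ x, f (u - (b 0 * γ₁ x + ∑ j, b (Fin.succ j) * γ₂ (y j))) *
          (w₁ 0 x * ∏ j : Fin m, w₂ j.succ (y j)) ∂ν₁ ∂(Measure.pi fun _ : Fin m => ν₂) =
        ∫ y, ∫ x, f (u - (b 0 * γ₂ x + ∑ j, b (Fin.succ j) * γ₂ (y j))) *
          (w₂ 0 x * ∏ j : Fin m, w₂ j.succ (y j)) ∂ν₂ ∂(Measure.pi fun _ : Fin m => ν₂) := by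
      refine MeasureTheory.integral_congr_ae ?_
      filter_upwards [ae_pi_of_ae h2] with y hy
      have hy' := hsum hy
      have := hstep 0 (u - ∑ j, b (Fin.succ j) * γ₂ (y j))
        (by simp only [Complex.sub_im]; linarith)
      simp only [sub_add_eq_sub_sub_swap, ← mul_assoc, MeasureTheory.integral_mul_const]
      rw [this]
    rw [e1]
    refine Eq.trans ?_ e2
    exact MeasureTheory.integral_integral_swap i2

theorem intervalIntegrable_add_mul_rpow {κ μ W b : ℝ} (hκ : 0 < κ) (hW : 0 < W) (hb : 0 ≤ b)
    {x y : ℝ} (hx : 0 ≤ x) (hxy : x ≤ y) :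
    IntervalIntegrable (fun θ : ℝ => (W + b * θ) ^ (-μ) * θ ^ (κ - 1)) volume x y := by
  refine IntervalIntegrable.continuousOn_mul
    (intervalIntegral.intervalIntegrable_rpow' (by linarith)) ?_
  refine ContinuousOn.rpow_const (by fun_prop) ?_
  intro θ hθ
  rw [Set.uIcc_of_le hxy] at hθ
  left
  have := mul_nonneg hb (hx.trans hθ.1)
  linarith

theorem integral_add_mul_rpow_le {κ μ : ℝ} (hκ : 0 < κ) (hμ : κ < μ) :
    ∃ C, 0 < C ∧ ∀ W b : ℝ, 0 < W → 0 ≤ b →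
      ∫ θ in (0 : ℝ)..π, (W + b * θ) ^ (-μ) * θ ^ (κ - 1) ≤
        C * (W ^ (-(μ - κ)) * (W + b) ^ (-κ)) := by
  have hd : 0 < μ - κ := sub_pos.mpr hμ
  refine ⟨2 ^ κ * (π ^ κ / κ + (1 / κ + 1 / (μ - κ))), by positivity, fun W b hW hb => ?_⟩
  have hWμ : ∀ θ : ℝ, 0 ≤ θ → (W + b * θ) ^ (-μ) ≤ W ^ (-μ) := fun θ hθ =>
    Real.rpow_le_rpow_of_nonpos hW (by have := mul_nonneg hb hθ; linarith) (by linarith)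
  have hint : ∀ a : ℝ, 0 ≤ a → ∫ θ in (0 : ℝ)..a, (W + b * θ) ^ (-μ) * θ ^ (κ - 1) ≤
      W ^ (-μ) * (a ^ κ / κ) := by
    intro a ha
    have h1 : ∫ θ in (0 : ℝ)..a, W ^ (-μ) * θ ^ (κ - 1) = W ^ (-μ) * (a ^ κ / κ) := by
      rw [intervalIntegral.integral_const_mul, integral_rpow (Or.inl (by linarith)),
        sub_add_cancel, Real.zero_rpow hκ.ne', sub_zero]
    rw [← h1]
    refine intervalIntegral.integral_mono_on ha
      (intervalIntegrable_add_mul_rpow hκ hW hb le_rfl ha)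
      ((intervalIntegral.intervalIntegrable_rpow' (by linarith)).const_mul _) ?_
    intro θ hθ
    exact mul_le_mul_of_nonneg_right (hWμ θ hθ.1) (Real.rpow_nonneg hθ.1 _)
  have hsplit : ∀ B : ℝ, 0 < B → W + b ≤ 2 * B → B ^ (-κ) ≤ 2 ^ κ * (W + b) ^ (-κ) := by
    intro B hB hB2
    have : (2 * B) ^ (-κ) ≤ (W + b) ^ (-κ) :=
      Real.rpow_le_rpow_of_nonpos (by linarith) hB2 (by linarith)
    rw [Real.mul_rpow (by norm_num) hB.le] at this
    calc B ^ (-κ) = 2 ^ κ * (2 ^ (-κ) * B ^ (-κ)) := by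
          rw [← mul_assoc, ← Real.rpow_add (by norm_num)]; simp
      _ ≤ _ := by gcongr
  have hp1 : 0 < W ^ (-(μ - κ)) := Real.rpow_pos_of_pos hW _
  have hp2 : 0 < (W + b) ^ (-κ) := Real.rpow_pos_of_pos (by linarith) _
  rcases le_or_gt b W with hbW | hbW
  · refine (hint π pi_pos.le).trans ?_
    have h1 : W ^ (-μ) = W ^ (-(μ - κ)) * W ^ (-κ) := by
      rw [← Real.rpow_add hW]; congr 1; ring
    have h2 := hsplit W hW (by linarith)
    rw [h1]
    calc W ^ (-(μ - κ)) * W ^ (-κ) * (π ^ κ / κ)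
        ≤ W ^ (-(μ - κ)) * (2 ^ κ * (W + b) ^ (-κ)) * (π ^ κ / κ) := by gcongr
      _ = 2 ^ κ * (π ^ κ / κ + 0) * (W ^ (-(μ - κ)) * (W + b) ^ (-κ)) := by ring
      _ ≤ _ := by gcongr; positivity
  · have hb0 : 0 < b := hW.trans hbW
    set a := W / b with ha
    have ha0 : 0 < a := div_pos hW hb0
    have ha1 : a ≤ π := by
      have : a ≤ 1 := by rw [ha, div_le_one hb0]; exact hbW.le
      linarith [pi_gt_three]
    have hWa : W = b * a := by rw [ha]; field_simp
    rw [← intervalIntegral.integral_add_adjacent_intervals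
      (intervalIntegrable_add_mul_rpow hκ hW hb le_rfl ha0.le)
      (intervalIntegrable_add_mul_rpow hκ hW hb ha0.le ha1)]
    have e0 : W ^ (-μ) * a ^ κ = W ^ (-(μ - κ)) * b ^ (-κ) := by
      rw [ha, Real.div_rpow hW.le hb, Real.rpow_neg hb, show -(μ - κ) = -μ + κ by ring,
        Real.rpow_add hW]
      ring
    have e1 : b ^ (-μ) * a ^ (κ - μ) = W ^ (-(μ - κ)) * b ^ (-κ) := by
      have : b ^ (-κ) = b ^ (-μ) / b ^ (κ - μ) := by
        rw [← Real.rpow_sub hb0]; congr 1; ring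
      rw [ha, Real.div_rpow hW.le hb, show -(μ - κ) = κ - μ by ring, this]
      exact mul_div_left_comm _ _ _
    have h2 : ∫ θ in a..π, (W + b * θ) ^ (-μ) * θ ^ (κ - 1) ≤
        b ^ (-μ) * (a ^ (κ - μ) / (μ - κ)) := by
      have hne : ∀ θ ∈ Set.uIcc a π, θ ≠ 0 := by
        intro θ hθ
        rw [Set.uIcc_of_le ha1] at hθ
        exact (ha0.trans_le hθ.1).ne'
      have h0 : (0 : ℝ) ∉ Set.uIcc a π := fun h => hne 0 h rfl
      have h3 : ∫ θ in a..π, b ^ (-μ) * θ ^ (κ - μ - 1) =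
          b ^ (-μ) * ((π ^ (κ - μ) - a ^ (κ - μ)) / (κ - μ)) := by
        rw [intervalIntegral.integral_const_mul,
          integral_rpow (Or.inr ⟨by linarith, h0⟩), sub_add_cancel]
      refine le_trans (b := ∫ θ in a..π, b ^ (-μ) * θ ^ (κ - μ - 1)) ?_ ?_
      · refine intervalIntegral.integral_mono_on ha1
          (intervalIntegrable_add_mul_rpow hκ hW hb ha0.le ha1) ?_ ?_
        · exact (intervalIntegral.intervalIntegrable_rpow (Or.inr h0)).const_mul _
        · intro θ hθ
          have hθ0 : 0 < θ := ha0.trans_le hθ.1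
          rw [show κ - μ - 1 = -μ + (κ - 1) by ring, Real.rpow_add hθ0, ← mul_assoc,
            ← Real.mul_rpow hb hθ0.le]
          refine mul_le_mul_of_nonneg_right ?_ (Real.rpow_nonneg hθ0.le _)
          exact Real.rpow_le_rpow_of_nonpos (by positivity) (by linarith) (by linarith)
      · rw [h3]
        refine mul_le_mul_of_nonneg_left ?_ (Real.rpow_nonneg hb _)
        rw [← neg_sub μ κ, div_neg, ← neg_div]
        gcongr
        have : 0 < π ^ (-(μ - κ)) := by positivity
        linarith
    have h4 := hsplit b hb0 (by linarith)
    calc _ ≤ W ^ (-μ) * (a ^ κ / κ) + b ^ (-μ) * (a ^ (κ - μ) / (μ - κ)) :=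
          add_le_add (hint a ha0.le) h2
      _ = W ^ (-(μ - κ)) * b ^ (-κ) * (1 / κ + 1 / (μ - κ)) := by
          rw [mul_add]
          nth_rw 1 [← e0]
          rw [← e1]; ring
      _ ≤ W ^ (-(μ - κ)) * (2 ^ κ * (W + b) ^ (-κ)) * (1 / κ + 1 / (μ - κ)) := by gcongr
      _ = 2 ^ κ * (0 + (1 / κ + 1 / (μ - κ))) * (W ^ (-(μ - κ)) * (W + b) ^ (-κ)) := by ring
      _ ≤ _ := by gcongr; positivity

theorem intervalIntegrable_add_mul_sin_rpow {κ μ W b : ℝ} (hκ : 0 < κ) (hW : 0 < W) (hb : 0 ≤ b) :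
    IntervalIntegrable (fun θ : ℝ => (W + b * Real.sin θ) ^ (-μ) * Real.sin θ ^ (κ - 1))
      volume 0 π := by
  refine IntervalIntegrable.continuousOn_mul (intervalIntegrable_sin_rpow (by linarith)) ?_
  refine ContinuousOn.rpow_const (by fun_prop) ?_
  intro θ hθ
  rw [Set.uIcc_of_le pi_pos.le] at hθ
  left
  have := mul_nonneg hb (Real.sin_nonneg_of_mem_Icc hθ)
  linarith

theorem add_mul_sin_rpow_le (κ : ℝ) {μ W b : ℝ} (hμ : 0 ≤ μ) (hW : 0 < W)
    (hb : 0 ≤ b) {θ : ℝ} (h0 : 0 < θ) (h1 : θ < π) :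
    (W + b * Real.sin θ) ^ (-μ) * Real.sin θ ^ (κ - 1) ≤
      2 ^ μ * 2 ^ |κ - 1| * ((W + b * θ) ^ (-μ) * θ ^ (κ - 1) +
        (W + b * (π - θ)) ^ (-μ) * (π - θ) ^ (κ - 1)) := by
  have key : ∀ x : ℝ, 0 < x → x ≤ π / 2 → (W + b * Real.sin x) ^ (-μ) * Real.sin x ^ (κ - 1) ≤
      2 ^ μ * 2 ^ |κ - 1| * ((W + b * x) ^ (-μ) * x ^ (κ - 1)) := by
    intro x hx hx'
    have h2 := half_le_sin hx.le hx'
    have h3 := Real.sin_le hx.le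
    have hp := Real.rpow_pos_of_pos hx (κ - 1)
    have hbx := mul_nonneg hb hx.le
    have hs : Real.sin x ^ (κ - 1) ≤ 2 ^ |κ - 1| * x ^ (κ - 1) := by
      rcases le_total 0 (κ - 1) with ha | ha
      · refine (Real.rpow_le_rpow (by linarith) h3 ha).trans ?_
        exact le_mul_of_one_le_left hp.le (Real.one_le_rpow (by norm_num) (abs_nonneg _))
      · refine (Real.rpow_le_rpow_of_nonpos (by linarith : 0 < x / 2) h2 ha).trans (le_of_eq ?_)
        rw [Real.div_rpow hx.le (by norm_num), abs_of_nonpos ha, Real.rpow_neg (by norm_num),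
          div_eq_mul_inv, mul_comm]
    have hw : (W + b * Real.sin x) ^ (-μ) ≤ 2 ^ μ * (W + b * x) ^ (-μ) := by
      refine (Real.rpow_le_rpow_of_nonpos (by linarith : 0 < (W + b * x) / 2) ?_
        (by linarith)).trans (le_of_eq ?_)
      · nlinarith
      · rw [Real.div_rpow (by linarith) (by norm_num), Real.rpow_neg (by norm_num : (0:ℝ) ≤ 2),
          div_eq_mul_inv, inv_inv, mul_comm]
    calc _ ≤ (2 ^ μ * (W + b * x) ^ (-μ)) * (2 ^ |κ - 1| * x ^ (κ - 1)) := by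
          refine mul_le_mul hw hs (Real.rpow_nonneg (by linarith) _) ?_
          exact mul_nonneg (by positivity) (Real.rpow_nonneg (by linarith) _)
      _ = _ := by ring
  have hq : ∀ x : ℝ, 0 < x → 0 ≤ (W + b * x) ^ (-μ) * x ^ (κ - 1) := fun x hx =>
    mul_nonneg (Real.rpow_nonneg (by have := mul_nonneg hb hx.le; linarith) _)
      (Real.rpow_nonneg hx.le _)
  have hp := hq θ h0
  have hp' := hq (π - θ) (by linarith)
  rcases le_total θ (π / 2) with h | h
  · refine (key θ h0 h).trans ?_
    gcongr; linarith
  · rw [← Real.sin_pi_sub]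
    refine (key (π - θ) (by linarith) (by linarith)).trans ?_
    gcongr; linarith

theorem integral_add_mul_sin_rpow_le {κ μ : ℝ} (hκ : 0 < κ) (hμ : κ < μ) :
    ∃ C, 0 < C ∧ ∀ W b : ℝ, 0 < W → 0 ≤ b →
      ∫ θ in (0 : ℝ)..π, (W + b * Real.sin θ) ^ (-μ) * Real.sin θ ^ (κ - 1) ≤
        C * (W ^ (-(μ - κ)) * (W + b) ^ (-κ)) := by
  obtain ⟨C, hC, h⟩ := integral_add_mul_rpow_le hκ hμ
  refine ⟨2 ^ μ * 2 ^ |κ - 1| * (C + C), by positivity, fun W b hW hb => ?_⟩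
  have i1 := intervalIntegrable_add_mul_rpow (μ := μ) hκ hW hb le_rfl pi_pos.le
  have i2 : IntervalIntegrable (fun θ : ℝ => (W + b * (π - θ)) ^ (-μ) * (π - θ) ^ (κ - 1))
      volume 0 π := by
    have := (i1.comp_sub_left π).symm
    simpa using this
  have e2 : ∫ θ in (0 : ℝ)..π, (W + b * (π - θ)) ^ (-μ) * (π - θ) ^ (κ - 1) =
      ∫ θ in (0 : ℝ)..π, (W + b * θ) ^ (-μ) * θ ^ (κ - 1) := by
    have := intervalIntegral.integral_comp_sub_left (a := 0) (b := π)
      (fun θ : ℝ => (W + b * θ) ^ (-μ) * θ ^ (κ - 1)) π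
    simpa using this
  have hm : ∫ θ in (0 : ℝ)..π, (W + b * Real.sin θ) ^ (-μ) * Real.sin θ ^ (κ - 1) ≤
      ∫ θ in (0 : ℝ)..π, 2 ^ μ * 2 ^ |κ - 1| * ((W + b * θ) ^ (-μ) * θ ^ (κ - 1) +
        (W + b * (π - θ)) ^ (-μ) * (π - θ) ^ (κ - 1)) := by
    refine intervalIntegral.integral_mono_on_of_le_Ioo pi_pos.le
      (intervalIntegrable_add_mul_sin_rpow hκ hW hb) ((i1.add i2).const_mul _) ?_
    intro θ hθ
    exact add_mul_sin_rpow_le κ (by linarith) hW hb hθ.1 hθ.2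
  refine hm.trans ?_
  rw [intervalIntegral.integral_const_mul, intervalIntegral.integral_add i1 i2, e2, mul_assoc (2 ^ μ * 2 ^ |κ - 1|),
    add_mul]
  have := h W b hW hb
  gcongr

theorem restrict_cube (m : ℕ) : (volume : Measure (Fin m → ℝ)).restrict (cube m) =
    Measure.pi fun _ => volume.restrict (Set.Ioc (-1 : ℝ) 1) := by
  rw [cube, volume_pi, Measure.restrict_pi_pi]
  congr 1
  ext1 _
  exact Measure.restrict_congr_set Ioc_ae_eq_Icc.symm

theorem integrable_one_sub_sq_rpow {κ : ℝ} (hκ : 0 < κ) :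
    Integrable (fun t : ℝ => (1 - t ^ 2) ^ (κ - 1)) (volume.restrict (Set.Ioc (-1) 1)) := by
  have := intervalIntegrable_one_sub_sq_rpow (a := κ - 1) (by linarith)
  rwa [intervalIntegrable_iff_integrableOn_Ioc_of_le (by norm_num)] at this

theorem integrable_wcube {m : ℕ} {κ : Fin m → ℝ} (hκ : ∀ i, 0 < κ i) :
    Integrable (wcube κ) (volume.restrict (cube m)) := by
  rw [restrict_cube]
  exact Integrable.fintype_prod (f := fun j : Fin m => fun t : ℝ => (1 - t ^ 2) ^ (κ j - 1))
    fun j => integrable_one_sub_sq_rpow (hκ j)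

theorem integrable_arcWt {κ : ℝ} (hκ : 0 < κ) :
    Integrable (arcWt κ) (volume.restrict (Set.Ioc 0 π)) := by
  have := intervalIntegrable_sin_rpow (a := κ - 1) (by linarith)
  rw [intervalIntegrable_iff_integrableOn_Ioc_of_le pi_pos.le] at this
  refine (Integrable.const_mul this (2 ^ (κ - 1))).mono' (measurable_arcWt κ).aestronglyMeasurable ?_
  filter_upwards [ae_restrict_mem measurableSet_Ioc] with θ hθ
  exact (norm_arcWt κ (Real.sin_nonneg_of_mem_Icc ⟨hθ.1.le, hθ.2⟩)).le

theorem cube_integral_eq_arc {m : ℕ} {κ : Fin m → ℝ} (hκ : ∀ i, 0 < κ i) {μ : ℝ} (hμ : 0 ≤ μ)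
    {b : Fin m → ℝ} (hb : ∀ j, 0 ≤ b j) {u : ℂ} (hu : 0 < u.im) :
    ∫ t in cube m, (u - ∑ j, b j * t j) ^ (-μ : ℂ) * (wcube κ t : ℂ) =
      ∫ θ, (u - ∑ j, b j * arcPt (θ j)) ^ (-μ : ℂ) * ∏ j, arcWt (κ j) (θ j)
        ∂Measure.pi (fun _ : Fin m => volume.restrict (Set.Ioc 0 π)) := by
  rw [restrict_cube]
  have hd : DifferentiableOn ℂ (fun v : ℂ => v ^ (-μ : ℂ)) {v | 0 < v.im} := by
    refine DifferentiableOn.cpow_const (by fun_prop) ?_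
    intro v hv
    rw [Complex.mem_slitPlane_iff]
    exact Or.inr (ne_of_gt hv)
  have := integral_pi_replace (ν₁ := volume.restrict (Set.Ioc (-1 : ℝ) 1))
    (ν₂ := volume.restrict (Set.Ioc 0 π)) (γ₁ := fun t : ℝ => (t : ℂ)) (γ₂ := arcPt)
    (by fun_prop) continuous_arcPt.measurable (by simp)
    (by
      filter_upwards [ae_restrict_mem measurableSet_Ioc] with θ hθ
      rw [arcPt_im]
      linarith [Real.sin_nonneg_of_mem_Icc ⟨hθ.1.le, hθ.2⟩])
    (f := fun v : ℂ => v ^ (-μ : ℂ)) (by fun_prop)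
    (by
      intro c hc
      refine ⟨c ^ (-μ), fun v hv => ?_⟩
      have h1 : c ≤ ‖v‖ := hv.trans ((le_abs_self _).trans (Complex.abs_im_le_norm v))
      rw [← Complex.ofReal_neg, Complex.norm_cpow_real]
      exact Real.rpow_le_rpow_of_nonpos hc h1 (by linarith))
    (fun j => fun t : ℝ => (((1 - t ^ 2) ^ (κ j - 1) : ℝ) : ℂ)) (fun j => arcWt (κ j))
    (fun j => (integrable_one_sub_sq_rpow (hκ j)).ofReal) (fun j => integrable_arcWt (hκ j)) b hb
    (by
      intro j v hv
      rw [← intervalIntegral.integral_of_le (by norm_num),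
        ← intervalIntegral.integral_of_le pi_pos.le]
      have hb1 : 0 < b j + 1 := by linarith [hb j]
      refine integral_shift (κ := κ j) (c := v.im / (b j + 1)) (hκ j) (div_pos hv hb1)
        (F := fun t => (v - b j * t) ^ (-μ : ℂ)) ?_
      refine hd.comp (by fun_prop) ?_
      intro t ht
      simp only [Set.mem_ofPred_eq] at ht ⊢
      rw [lt_div_iff₀ hb1] at ht
      rw [Complex.sub_im, Complex.im_ofReal_mul]
      rcases le_total t.im 0 with h | h
      · nlinarith [hb j]
      · nlinarith [hb j]) u hu
  rw [← this]
  simp only [wcube, Complex.ofReal_prod, Complex.ofReal_sum, Complex.ofReal_mul]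

/-- The sign attached to a Boolean. -/
def boolSign (e : Bool) : ℝ := if e then 1 else -1

theorem norm_sub_arcPt_le {θ : ℝ} (h : 0 ≤ Real.sin θ) :
    ‖((boolSign (decide (0 ≤ Real.cos θ)) : ℝ) : ℂ) - arcPt θ‖ ≤ 2 * Real.sin θ := by
  have h1 := Real.sin_sq_add_cos_sq θ
  rw [← abs_of_nonneg (mul_nonneg zero_le_two h), ← sq_le_sq₀ (norm_nonneg _) (abs_nonneg _), sq_abs,
    Complex.sq_norm, Complex.normSq_apply]
  simp only [Complex.sub_re, Complex.sub_im, Complex.ofReal_re, Complex.ofReal_im, arcPt_re, arcPt_im,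
    boolSign, decide_eq_true_eq]
  split_ifs with hc
  · nlinarith [Real.cos_le_one θ]
  · push Not at hc
    nlinarith [Real.neg_one_le_cos θ]

theorem norm_sign_le {m : ℕ} {b : Fin m → ℝ} (hb : ∀ j, 0 ≤ b j) {u : ℂ} (hu : 0 < u.im)
    {θ : Fin m → ℝ} (hθ : ∀ j, 0 ≤ Real.sin (θ j)) :
    ‖u - ∑ j, (b j : ℂ) * (boolSign (decide (0 ≤ Real.cos (θ j))) : ℝ)‖ + ∑ j, b j * Real.sin (θ j) ≤
      4 * ‖u - ∑ j, b j * arcPt (θ j)‖ := by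
  set v := u - ∑ j, b j * arcPt (θ j) with hv
  have hT : ∑ j, b j * Real.sin (θ j) ≤ ‖v‖ := by
    refine le_trans ?_ ((le_abs_self _).trans (Complex.abs_im_le_norm v))
    rw [hv, Complex.sub_im, Complex.im_sum]
    simp only [Complex.im_ofReal_mul, arcPt_im, mul_neg, Finset.sum_neg_distrib]
    linarith
  have h2 : u - ∑ j, (b j : ℂ) * (boolSign (decide (0 ≤ Real.cos (θ j))) : ℝ) =
      v - ∑ j, (b j : ℂ) * ((boolSign (decide (0 ≤ Real.cos (θ j))) : ℝ) - arcPt (θ j)) := by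
    rw [hv]; simp only [mul_sub, Finset.sum_sub_distrib]; ring
  have h3 : ‖∑ j, (b j : ℂ) * (((boolSign (decide (0 ≤ Real.cos (θ j))) : ℝ) : ℂ) - arcPt (θ j))‖ ≤
      2 * ∑ j, b j * Real.sin (θ j) := by
    rw [Finset.mul_sum]
    refine norm_sum_le_of_le _ fun j _ => ?_
    rw [norm_mul, Complex.norm_of_nonneg (hb j)]
    have := mul_le_mul_of_nonneg_left (norm_sub_arcPt_le (hθ j)) (hb j)
    linarith
  rw [h2]
  have := norm_sub_le v (∑ j, (b j : ℂ) *
    (((boolSign (decide (0 ≤ Real.cos (θ j))) : ℝ) : ℂ) - arcPt (θ j)))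
  linarith

theorem rpow_neg_sum_le {m : ℕ} {W : ℝ} (hW : 0 < W) {c : Fin m → ℝ} (hc : ∀ j, 0 ≤ c j)
    {μ : Fin m → ℝ} (hμ : ∀ j, 0 ≤ μ j) :
    (W + ∑ j, c j) ^ (-∑ j, μ j) ≤ ∏ j, (W + c j) ^ (-μ j) := by
  have hp : 0 < W + ∑ j, c j := add_pos_of_pos_of_nonneg hW (Finset.sum_nonneg fun j _ => hc j)
  rw [← Finset.sum_neg_distrib, Real.rpow_sum_of_pos hp]
  refine Finset.prod_le_prod (fun j _ => Real.rpow_nonneg hp.le _) fun j _ => ?_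
  refine Real.rpow_le_rpow_of_nonpos (by linarith [hc j]) ?_ (by linarith [hμ j])
  have := Finset.single_le_sum (fun i _ => hc i) (Finset.mem_univ j)
  linarith

theorem norm_cube_integral_le {m : ℕ} (hm : 0 < m) {κ : Fin m → ℝ} (hκ : ∀ i, 0 < κ i) {μ : ℝ}
    (hμ : ∑ j, κ j < μ) :
    ∃ C, 0 < C ∧ ∀ b : Fin m → ℝ, (∀ j, 0 ≤ b j) → ∀ u : ℂ, 0 < u.im →
      ‖∫ t in cube m, (u - (∑ j, b j * t j : ℝ)) ^ (-μ : ℂ) * (wcube κ t : ℂ)‖ ≤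
        C * ∑ ε : Fin m → Bool, (‖u - (∑ j, b j * boolSign (ε j) : ℝ)‖ ^ (-(μ - ∑ j, κ j)) *
          ∏ j, (‖u - (∑ j, b j * boolSign (ε j) : ℝ)‖ + b j) ^ (-κ j)) := by
  have hm' : (0 : ℝ) < m := by exact_mod_cast hm
  have hsum : 0 < μ - ∑ j, κ j := sub_pos.mpr hμ
  set η := (μ - ∑ j, κ j) / m with hη
  have hη0 : 0 < η := div_pos hsum hm'
  set μs : Fin m → ℝ := fun j => κ j + η with hμs
  have hμsum : ∑ j, μs j = μ := by
    simp only [hμs, Finset.sum_add_distrib, Finset.sum_const, Finset.card_univ, Fintype.card_fin,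
      nsmul_eq_mul, hη]
    field_simp; ring
  have hμ0 : 0 ≤ μ := (Finset.sum_nonneg fun j _ => (hκ j).le).trans hμ.le
  choose C hC hCb using fun j => integral_add_mul_sin_rpow_le (hκ j) (show κ j < μs j by
    simp only [hμs]; linarith)
  refine ⟨4 ^ μ * ∏ j, (2 ^ (κ j - 1) * C j), by
    exact mul_pos (by positivity) (Finset.prod_pos fun j _ => mul_pos (by positivity) (hC j)), fun b hb u hu => ?_⟩
  rw [cube_integral_eq_arc hκ hμ0 hb hu]
  set W : (Fin m → Bool) → ℝ := fun ε => ‖u - (∑ j, b j * boolSign (ε j) : ℝ)‖ with hW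
  have hWpos : ∀ ε, 0 < W ε := by
    intro ε
    refine norm_pos_iff.mpr fun h => ?_
    have := congrArg Complex.im h
    simp only [Complex.sub_im, Complex.ofReal_im, sub_zero, Complex.zero_im] at this
    linarith
  set g : (Fin m → Bool) → Fin m → ℝ → ℝ := fun ε j θ =>
    (W ε + b j * Real.sin θ) ^ (-μs j) * (2 ^ (κ j - 1) * Real.sin θ ^ (κ j - 1)) with hg
  have hgi : ∀ ε j, Integrable (g ε j) (volume.restrict (Set.Ioc 0 π)) := by
    intro ε j
    have := intervalIntegrable_add_mul_sin_rpow (μ := μs j) (hκ j) (hWpos ε) (hb j)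
    rw [intervalIntegrable_iff_integrableOn_Ioc_of_le pi_pos.le] at this
    refine (Integrable.const_mul this (2 ^ (κ j - 1))).congr (Filter.Eventually.of_forall fun θ => ?_)
    simp only [hg]; ring
  have hgI : ∀ ε, Integrable (fun θ : Fin m → ℝ => ∏ j, g ε j (θ j))
      (Measure.pi fun _ : Fin m => volume.restrict (Set.Ioc 0 π)) := fun ε =>
    Integrable.fintype_prod (hgi ε)
  have hbound : ∀ᵐ θ ∂(Measure.pi fun _ : Fin m => volume.restrict (Set.Ioc 0 π)),
      ‖(u - ∑ j, b j * arcPt (θ j)) ^ (-μ : ℂ) * ∏ j, arcWt (κ j) (θ j)‖ ≤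
        4 ^ μ * ∑ ε, ∏ j, g ε j (θ j) := by
    filter_upwards [ae_pi_of_ae (m := m) (ae_restrict_mem (μ := volume)
      (measurableSet_Ioc (a := (0 : ℝ)) (b := π)))] with θ hθ
    have hs : ∀ j, 0 ≤ Real.sin (θ j) := fun j =>
      Real.sin_nonneg_of_mem_Icc ⟨(hθ j).1.le, (hθ j).2⟩
    set ε : Fin m → Bool := fun j => decide (0 ≤ Real.cos (θ j)) with hε
    have h1 := norm_sign_le hb hu hs
    have hWε : W ε = ‖u - ∑ j, (b j : ℂ) * (boolSign (decide (0 ≤ Real.cos (θ j))) : ℝ)‖ := by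
      simp only [hW, hε]; push_cast; rfl
    rw [← hWε] at h1
    have hT : 0 ≤ ∑ j, b j * Real.sin (θ j) :=
      Finset.sum_nonneg fun j _ => mul_nonneg (hb j) (hs j)
    have hgnn : ∀ ε, 0 ≤ ∏ j, g ε j (θ j) := fun ε => Finset.prod_nonneg fun j _ => by
      have := mul_nonneg (hb j) (hs j)
      have h2 := hWpos ε
      exact mul_nonneg (Real.rpow_nonneg (by linarith) _)
        (mul_nonneg (by positivity) (Real.rpow_nonneg (hs j) _))
    have h3 : ‖u - ∑ j, b j * arcPt (θ j)‖ ^ (-μ) ≤ 4 ^ μ * ∏ j, (W ε + b j * Real.sin (θ j)) ^ (-μs j) := by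
      have hp : 0 < W ε + ∑ j, b j * Real.sin (θ j) := by linarith [hWpos ε]
      calc ‖u - ∑ j, b j * arcPt (θ j)‖ ^ (-μ)
          ≤ ((W ε + ∑ j, b j * Real.sin (θ j)) / 4) ^ (-μ) :=
            Real.rpow_le_rpow_of_nonpos (by linarith) (by linarith) (by linarith)
        _ = 4 ^ μ * (W ε + ∑ j, b j * Real.sin (θ j)) ^ (-μ) := by
            rw [Real.div_rpow hp.le (by norm_num), Real.rpow_neg (by norm_num : (0 : ℝ) ≤ 4),
              div_eq_mul_inv, inv_inv, mul_comm]
        _ ≤ _ := by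
            gcongr
            have := rpow_neg_sum_le (hWpos ε) (c := fun j => b j * Real.sin (θ j)) (μ := μs)
              (fun j => mul_nonneg (hb j) (hs j)) (fun j => by simp only [hμs]; linarith [hκ j])
            rwa [hμsum] at this
    rw [norm_mul, ← Complex.ofReal_neg, Complex.norm_cpow_real, norm_prod]
    calc _ ≤ (4 ^ μ * ∏ j, (W ε + b j * Real.sin (θ j)) ^ (-μs j)) * ∏ j, ‖arcWt (κ j) (θ j)‖ := by
          gcongr
      _ = 4 ^ μ * ∏ j, g ε j (θ j) := by
          rw [mul_assoc, ← Finset.prod_mul_distrib]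
          congr 1
          refine Finset.prod_congr rfl fun j _ => ?_
          rw [norm_arcWt _ (hs j)]
      _ ≤ _ := by
          gcongr
          exact Finset.single_le_sum (f := fun ε => ∏ j, g ε j (θ j)) (fun ε _ => hgnn ε)
            (Finset.mem_univ ε)
  refine (norm_integral_le_of_norm_le
    (Integrable.const_mul (integrable_finsetSum _ fun ε _ => hgI ε) _) hbound).trans ?_
  rw [MeasureTheory.integral_const_mul, MeasureTheory.integral_finsetSum _ fun ε _ => hgI ε,
    mul_assoc, Finset.mul_sum _ _ (∏ j, (2 ^ (κ j - 1) * C j))]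
  gcongr with ε _
  rw [MeasureTheory.integral_fintype_prod_eq_prod]
  have h4 : ∀ j, ∫ θ, g ε j θ ∂(volume.restrict (Set.Ioc 0 π)) ≤
      (2 ^ (κ j - 1) * C j) * (W ε ^ (-η) * (W ε + b j) ^ (-κ j)) := by
    intro j
    rw [← intervalIntegral.integral_of_le pi_pos.le]
    have e : ∫ θ in (0 : ℝ)..π, g ε j θ = 2 ^ (κ j - 1) *
        ∫ θ in (0 : ℝ)..π, (W ε + b j * Real.sin θ) ^ (-μs j) * Real.sin θ ^ (κ j - 1) := by
      rw [← intervalIntegral.integral_const_mul]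
      congr 1; ext θ
      simp only [hg]; ring
    rw [e, mul_assoc]
    have := hCb j (W ε) (b j) (hWpos ε) (hb j)
    simp only [hμs, add_sub_cancel_left] at this
    gcongr
  have h5 : W ε ^ (-(μ - ∑ j, κ j)) = ∏ _j : Fin m, W ε ^ (-η) := by
    rw [Finset.prod_const, Finset.card_univ, Fintype.card_fin, ← Real.rpow_natCast,
      ← Real.rpow_mul (hWpos ε).le, hη]
    congr 1; field_simp
  rw [h5, ← Finset.prod_mul_distrib, ← Finset.prod_mul_distrib]
  refine Finset.prod_le_prod (fun j _ => ?_) fun j _ => h4 j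
  refine MeasureTheory.setIntegral_nonneg measurableSet_Ioc fun θ hθ => ?_
  have hs := Real.sin_nonneg_of_mem_Icc ⟨hθ.1.le, hθ.2⟩
  have := mul_nonneg (hb j) hs
  have h2 := hWpos ε
  exact mul_nonneg (Real.rpow_nonneg (by linarith) _)
    (mul_nonneg (by positivity) (Real.rpow_nonneg hs _))

theorem abs_sum_mul_le_one {m : ℕ} {a t : Fin m → ℝ} (ha : ∀ j, 0 ≤ a j) (ha1 : ∑ j, a j ≤ 1)
    (ht : ∀ j, |t j| ≤ 1) : |∑ j, a j * t j| ≤ 1 := by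
  refine (Finset.abs_sum_le_sum_abs _ _).trans (le_trans (Finset.sum_le_sum fun j _ => ?_) ha1)
  rw [abs_mul, abs_of_nonneg (ha j)]
  exact mul_le_of_le_one_right (ha j) (ht j)

theorem abs_le_one_of_mem_cube {m : ℕ} {t : Fin m → ℝ} (ht : t ∈ cube m) (j : Fin m) : |t j| ≤ 1 :=
  abs_le.mpr (ht j (Set.mem_univ j))

theorem abs_boolSign (e : Bool) : |boolSign e| = 1 := by
  cases e <;> simp [boolSign]

theorem measurableSet_cube (m : ℕ) : MeasurableSet (cube m) :=
  MeasurableSet.univ_pi fun _ => measurableSet_Icc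

theorem gegDen_eq_mul (z : ℝ) {r : ℂ} (hr : r ≠ 0) :
    gegDen z r = r * (r + r⁻¹ - (2 * z : ℝ)) := by
  rw [gegDen]; push_cast; field_simp; ring

theorem add_inv_im_pos {r : ℂ} (h1 : ‖r‖ < 1) (hi : r.im < 0) : 0 < (r + r⁻¹).im := by
  have h0 : r ≠ 0 := by rintro rfl; simp at hi
  have hn : 0 < Complex.normSq r := Complex.normSq_pos.mpr h0
  have hn1 : Complex.normSq r < 1 := by
    rw [Complex.normSq_eq_norm_sq]; nlinarith [norm_nonneg r]
  rw [Complex.add_im, Complex.inv_im]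
  rw [show r.im + -r.im / Complex.normSq r =
    -r.im * (1 - Complex.normSq r) / Complex.normSq r by field_simp; ring]
  refine div_pos (mul_pos (by linarith) (by linarith)) hn

theorem gegDen_cpow_eq (z μ : ℝ) {r : ℂ} (h1 : ‖r‖ < 1) (hi : r.im < 0) :
    gegDen z r ^ (-μ : ℂ) = r ^ (-μ : ℂ) * (r + r⁻¹ - (2 * z : ℝ)) ^ (-μ : ℂ) := by
  have h0 : r ≠ 0 := by rintro rfl; simp at hi
  have hw : 0 < (r + r⁻¹ - (2 * z : ℝ)).im := by
    have := add_inv_im_pos h1 hi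
    rw [Complex.sub_im, Complex.ofReal_im]; linarith
  have hw0 : r + r⁻¹ - (2 * z : ℝ) ≠ 0 := by
    intro h; rw [h] at hw; simp at hw
  rw [gegDen_eq_mul z h0, Complex.cpow_def_of_ne_zero (mul_ne_zero h0 hw0),
    Complex.cpow_def_of_ne_zero h0, Complex.cpow_def_of_ne_zero hw0, Complex.log_mul h0 hw0 ?_,
    ← Complex.exp_add, add_mul]
  have a1 := Complex.arg_neg_iff.mpr hi
  have a2 := Complex.neg_pi_lt_arg r
  have a3 := Complex.arg_nonneg_iff.mpr hw.le
  have a4 := Complex.arg_le_pi (r + r⁻¹ - (2 * z : ℝ))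
  constructor <;> linarith

theorem gegDen_conj (z : ℝ) (r : ℂ) :
    gegDen z ((starRingEnd ℂ) r) = (starRingEnd ℂ) (gegDen z r) := by
  simp only [gegDen, map_add, map_sub, map_mul, map_pow, map_one, Complex.conj_ofReal,
    map_ofNat]

/-- The average of `Q^{-μ}` over the cube. -/
noncomputable def cubeAvg {m : ℕ} (a κ : Fin m → ℝ) (μ : ℝ) (r : ℂ) : ℂ :=
  ∫ t in cube m, gegDen (∑ j, a j * t j) r ^ (-μ : ℂ) * (wcube κ t : ℂ)

theorem cubeAvg_conj {m : ℕ} {a : Fin m → ℝ} (κ : Fin m → ℝ) (ha : ∀ j, 0 ≤ a j)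
    (ha1 : ∑ j, a j ≤ 1) (μ : ℝ) {r : ℂ} (h1 : ‖r‖ < 1) :
    cubeAvg a κ μ ((starRingEnd ℂ) r) = (starRingEnd ℂ) (cubeAvg a κ μ r) := by
  rw [cubeAvg, cubeAvg, ← integral_conj]
  refine MeasureTheory.setIntegral_congr_fun (measurableSet_cube m) fun t ht => ?_
  have hz := abs_le.mp (abs_sum_mul_le_one ha ha1 (abs_le_one_of_mem_cube ht))
  have hs := Complex.mem_slitPlane_iff_arg.mp (gegDen_mem_slitPlane hz.1 hz.2 h1)
  simp only [map_mul, Complex.conj_ofReal]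
  have hc := Complex.cpow_conj _ (-μ : ℂ) hs.1
  rw [map_neg, Complex.conj_ofReal] at hc
  rw [gegDen_conj, hc, Complex.conj_conj]

theorem norm_cubeAvg_le {m : ℕ} (hm : 0 < m) {κ : Fin m → ℝ} (hκ : ∀ i, 0 < κ i) {μ : ℝ}
    (hμ : ∑ j, κ j < μ) :
    ∃ C, 0 < C ∧ ∀ a : Fin m → ℝ, (∀ j, 0 ≤ a j) → ∑ j, a j ≤ 1 →
      ∀ r : ℂ, 1 / 2 ≤ ‖r‖ → ‖r‖ < 1 → r.im ≠ 0 →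
      ‖cubeAvg a κ μ r‖ ≤
        C * ∑ ε : Fin m → Bool, (‖gegDen (∑ j, a j * boolSign (ε j)) r‖ ^ (-(μ - ∑ j, κ j)) *
          ∏ j, (‖gegDen (∑ j, a j * boolSign (ε j)) r‖ + a j) ^ (-κ j)) := by
  obtain ⟨C, hC, hb⟩ := norm_cube_integral_le hm hκ hμ
  have hμ0 : 0 ≤ μ := (Finset.sum_nonneg fun j _ => (hκ j).le).trans hμ.le
  refine ⟨2 ^ μ * C, by positivity, fun a ha ha1 => ?_⟩
  have main : ∀ r : ℂ, 1 / 2 ≤ ‖r‖ → ‖r‖ < 1 → r.im < 0 →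
      ‖cubeAvg a κ μ r‖ ≤
        2 ^ μ * C * ∑ ε : Fin m → Bool, (‖gegDen (∑ j, a j * boolSign (ε j)) r‖ ^ (-(μ - ∑ j, κ j)) *
          ∏ j, (‖gegDen (∑ j, a j * boolSign (ε j)) r‖ + a j) ^ (-κ j)) := by
    intro r hr hr1 hi
    have h0 : r ≠ 0 := by rintro rfl; simp at hi
    have e1 : cubeAvg a κ μ r = r ^ (-μ : ℂ) * ∫ t in cube m,
        (r + r⁻¹ - (∑ j, 2 * a j * t j : ℝ)) ^ (-μ : ℂ) * (wcube κ t : ℂ) := by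
      rw [← MeasureTheory.integral_const_mul, cubeAvg]
      congr 1; ext t
      rw [gegDen_cpow_eq _ _ hr1 hi, mul_assoc, Finset.mul_sum]
      simp only [mul_assoc]
    have hu := add_inv_im_pos hr1 hi
    rw [e1, norm_mul, mul_assoc (2 ^ μ) C]
    refine mul_le_mul ?_ ((hb (fun j => 2 * a j) (fun j => by linarith [ha j]) _ hu).trans ?_)
      (norm_nonneg _) (by positivity)
    · rw [← Complex.ofReal_neg, Complex.norm_cpow_real]
      refine (Real.rpow_le_rpow_of_nonpos (by norm_num : (0 : ℝ) < 1 / 2) hr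
        (by linarith)).trans (le_of_eq ?_)
      rw [Real.rpow_neg (by norm_num), one_div, Real.inv_rpow (by norm_num), inv_inv]
    · refine mul_le_mul_of_nonneg_left (Finset.sum_le_sum fun ε _ => ?_) hC.le
      set z := ∑ j, a j * boolSign (ε j) with hz
      have hz1 := abs_le.mp (abs_sum_mul_le_one ha ha1 fun j => (abs_boolSign (ε j)).le)
      have e2 : ∑ j, 2 * a j * boolSign (ε j) = 2 * z := by
        rw [hz, Finset.mul_sum]; simp only [mul_assoc]
      rw [e2]
      have hq : ‖gegDen z r‖ ≤ ‖r + r⁻¹ - (2 * z : ℝ)‖ := by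
        rw [gegDen_eq_mul z h0, norm_mul]
        exact mul_le_of_le_one_left (norm_nonneg _) hr1.le
      have hq0 : 0 < ‖gegDen z r‖ := norm_pos_iff.mpr
        (Complex.slitPlane_ne_zero (gegDen_mem_slitPlane hz1.1 hz1.2 hr1))
      refine mul_le_mul (Real.rpow_le_rpow_of_nonpos hq0 hq (by linarith)) ?_
        (Finset.prod_nonneg fun j _ => Real.rpow_nonneg (by linarith [ha j]) _)
        (Real.rpow_nonneg hq0.le _)
      refine Finset.prod_le_prod (fun j _ => Real.rpow_nonneg (by linarith [ha j]) _) fun j _ => ?_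
      refine Real.rpow_le_rpow_of_nonpos (by linarith [ha j]) (by linarith [ha j]) ?_
      linarith [hκ j]
  intro r hr hr1 hi
  rcases lt_or_gt_of_ne hi with h | h
  · exact main r hr hr1 h
  · have := main ((starRingEnd ℂ) r) (by rwa [Complex.norm_conj]) (by rwa [Complex.norm_conj])
      (by rw [Complex.conj_im]; linarith)
    rw [cubeAvg_conj κ ha ha1 μ hr1, Complex.norm_conj] at this
    simpa only [gegDen_conj, Complex.norm_conj] using this

theorem sq_norm_circleMap_sub (ρ φ θ : ℝ) :
    ‖circleMap 0 ρ φ - circleMap 0 1 θ‖ ^ 2 = (1 - ρ) ^ 2 + 4 * ρ * Real.sin ((φ - θ) / 2) ^ 2 := by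
  have h1 : Real.sin ((φ - θ) / 2) ^ 2 = 1 / 2 - Real.cos (φ - θ) / 2 := by
    rw [Real.sin_sq_eq_half_sub]; congr 3; ring
  rw [h1, Real.cos_sub, Complex.sq_norm, Complex.normSq_apply]
  simp only [Complex.sub_re, Complex.sub_im, circleMap_zero_re, circleMap_zero_im]
  have h2 := Real.sin_sq_add_cos_sq φ
  have h3 := Real.sin_sq_add_cos_sq θ
  linear_combination ρ ^ 2 * h2 + h3

theorem gegDen_cos (ψ : ℝ) (r : ℂ) :
    gegDen (Real.cos ψ) r = (r - circleMap 0 1 ψ) * (r - circleMap 0 1 (-ψ)) := by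
  have h1 : circleMap 0 1 ψ + circleMap 0 1 (-ψ) = 2 * (Real.cos ψ : ℂ) := by
    apply Complex.ext
    · rw [Complex.add_re, circleMap_zero_re, circleMap_zero_re, Real.cos_neg]
      simp [-Complex.ofReal_cos]; ring
    · rw [Complex.add_im, circleMap_zero_im, circleMap_zero_im, Real.sin_neg]
      simp [-Complex.ofReal_cos]
  have h2 : circleMap 0 1 ψ * circleMap 0 1 (-ψ) = 1 := by
    simp [circleMap, ← Complex.exp_add]
  rw [gegDen]
  linear_combination (-r) * h1.symm - h2

theorem inv_one_add_bounds {h : ℝ} (h0 : 0 < h) (h1 : h ≤ 1) :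
    1 / 2 ≤ (1 + h)⁻¹ ∧ (1 + h)⁻¹ < 1 ∧ h / 2 ≤ 1 - (1 + h)⁻¹ ∧ 1 - (1 + h)⁻¹ ≤ h := by
  have hp : 0 < 1 + h := by linarith
  have e : 1 - (1 + h)⁻¹ = h / (1 + h) := by field_simp; ring
  refine ⟨?_, inv_lt_one_of_one_lt₀ (by linarith), ?_, ?_⟩
  · rw [one_div]; exact inv_anti₀ hp (by linarith)
  · rw [e]; exact div_le_div_of_nonneg_left h0.le hp (by linarith)
  · rw [e, div_le_iff₀ hp]; nlinarith

theorem abs_div_pi_le_abs_sin {t : ℝ} (ht : |t| ≤ π) : |t| / 4 ≤ |Real.sin (t / 2)| := by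
  have h1 := half_le_sin (θ := |t| / 2) (by positivity) (by linarith)
  have h2 : Real.sin (|t| / 2) ≤ |Real.sin (t / 2)| := by
    rcases abs_cases t with ⟨h, _⟩ | ⟨h, _⟩
    · rw [h]; exact le_abs_self _
    · rw [h, neg_div, Real.sin_neg]; exact neg_le_abs _
  linarith

theorem norm_circleMap_sub_ge {h : ℝ} (h0 : 0 < h) (h1 : h ≤ 1) {φ ψ : ℝ} (hφ : φ ∈ Set.Icc 0 π)
    (hψ : ψ ∈ Set.Icc 0 π) :
    (|φ - ψ| + h) / 4 ≤ ‖circleMap 0 (1 + h)⁻¹ φ - circleMap 0 1 ψ‖ ∧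
      (|φ - ψ| + h + (Real.sin ψ + h)) / 8 ≤ ‖circleMap 0 (1 + h)⁻¹ φ - circleMap 0 1 (-ψ)‖ := by
  obtain ⟨a1, a2, a3, a4⟩ := inv_one_add_bounds h0 h1
  set ρ := (1 + h)⁻¹
  have hΔ : |φ - ψ| ≤ π := abs_le.mpr ⟨by linarith [hφ.1, hψ.2], by linarith [hφ.2, hψ.1]⟩
  have hs := abs_div_pi_le_abs_sin hΔ
  have hs2 : (|φ - ψ| / 4) ^ 2 ≤ Real.sin ((φ - ψ) / 2) ^ 2 := by
    rw [← sq_abs (Real.sin _)]; exact pow_le_pow_left₀ (by positivity) hs 2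
  have hρ2 : (h / 2) ^ 2 ≤ (1 - ρ) ^ 2 := pow_le_pow_left₀ (by positivity) a3 2
  have key : ∀ s : ℝ, Real.sin ((φ - ψ) / 2) ^ 2 ≤ s → ((|φ - ψ| + h) / 4) ^ 2 ≤
      (1 - ρ) ^ 2 + 4 * ρ * s := by
    intro s hs
    have h3 : 2 * (|φ - ψ| / 4) ^ 2 ≤ 4 * ρ * s := by
      have : 0 ≤ s := (sq_nonneg _).trans hs
      nlinarith
    nlinarith [sq_nonneg (|φ - ψ| - h)]
  have hsin0 := Real.sin_nonneg_of_mem_Icc hφ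
  have hsinψ := Real.sin_nonneg_of_mem_Icc hψ
  have hS : Real.sin ((φ - ψ) / 2) ^ 2 ≤ Real.sin ((φ - -ψ) / 2) ^ 2 := by
    rw [Real.sin_sq_eq_half_sub, Real.sin_sq_eq_half_sub]
    rw [show 2 * ((φ - ψ) / 2) = φ - ψ by ring, show 2 * ((φ - -ψ) / 2) = φ + ψ by ring,
      Real.cos_sub, Real.cos_add]
    nlinarith [mul_nonneg hsin0 hsinψ]
  have hS2 : (Real.sin ψ / 2) ^ 2 ≤ Real.sin ((φ - -ψ) / 2) ^ 2 := by
    refine pow_le_pow_left₀ (by positivity) ?_ 2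
    rw [show (φ - -ψ) / 2 = φ / 2 + ψ / 2 by ring, Real.sin_add]
    have e : Real.sin ψ = 2 * Real.sin (ψ / 2) * Real.cos (ψ / 2) := by
      rw [← Real.sin_two_mul]; congr 1; ring
    rw [e]
    have b1 : 0 ≤ Real.sin (ψ / 2) := Real.sin_nonneg_of_mem_Icc ⟨by linarith [hψ.1], by linarith [hψ.2, hψ.1]⟩
    have b2 : 0 ≤ Real.cos (ψ / 2) := Real.cos_nonneg_of_mem_Icc ⟨by linarith [hψ.1, pi_pos], by linarith [hψ.2]⟩
    have b3 : 0 ≤ Real.sin (φ / 2) := Real.sin_nonneg_of_mem_Icc ⟨by linarith [hφ.1], by linarith [hφ.2, hφ.1]⟩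
    have b4 : 0 ≤ Real.cos (φ / 2) := Real.cos_nonneg_of_mem_Icc ⟨by linarith [hφ.1, pi_pos], by linarith [hφ.2]⟩
    have c1 := Real.sin_le_one (ψ / 2)
    have c2 := Real.cos_le_one (ψ / 2)
    have c3 := Real.sin_le_one (φ / 2)
    have c4 := Real.cos_le_one (φ / 2)
    have c5 := Real.sin_sq_add_cos_sq (φ / 2)
    have c6 : 1 ≤ Real.sin (φ / 2) + Real.cos (φ / 2) := by nlinarith
    nlinarith [mul_nonneg b1 b2, mul_nonneg b3 b2, mul_nonneg b4 b1,
      mul_nonneg (mul_nonneg b3 b2) (sub_nonneg.mpr c1), mul_nonneg (mul_nonneg b4 b1) (sub_nonneg.mpr c2),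
      mul_nonneg (mul_nonneg b1 b2) (sub_nonneg.mpr c6)]
  constructor
  · rw [← sq_le_sq₀ (by positivity) (norm_nonneg _), sq_norm_circleMap_sub]
    exact key _ le_rfl
  · have k1 : (|φ - ψ| + h) / 4 ≤ ‖circleMap 0 ρ φ - circleMap 0 1 (-ψ)‖ := by
      rw [← sq_le_sq₀ (by positivity) (norm_nonneg _), sq_norm_circleMap_sub]
      exact key _ hS
    have k2 : (Real.sin ψ + h) / 4 ≤ ‖circleMap 0 ρ φ - circleMap 0 1 (-ψ)‖ := by
      rw [← sq_le_sq₀ (by positivity) (norm_nonneg _), sq_norm_circleMap_sub]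
      have h3 : 2 * (Real.sin ψ / 2) ^ 2 ≤ 4 * ρ * Real.sin ((φ - -ψ) / 2) ^ 2 := by
        nlinarith [sq_nonneg (Real.sin ((φ - -ψ) / 2))]
      nlinarith [sq_nonneg (Real.sin ψ - h)]
    linarith

theorem norm_gegDen_ge {h : ℝ} (h0 : 0 < h) (h1 : h ≤ 1) {φ ψ : ℝ} (hφ : φ ∈ Set.Icc 0 π)
    (hψ : ψ ∈ Set.Icc 0 π) :
    (|φ - ψ| + h) * (|φ - ψ| + h + (Real.sin ψ + h)) / 32 ≤
      ‖gegDen (Real.cos ψ) (circleMap 0 (1 + h)⁻¹ φ)‖ := by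
  obtain ⟨k1, k2⟩ := norm_circleMap_sub_ge h0 h1 hφ hψ
  rw [gegDen_cos, norm_mul]
  have := Real.sin_nonneg_of_mem_Icc hψ
  have := mul_le_mul k1 k2 (by positivity) (norm_nonneg _)
  linarith

theorem norm_one_sub_sq_bounds {h : ℝ} (h0 : 0 < h) (h1 : h ≤ 1) {φ : ℝ} (hφ : φ ∈ Set.Icc 0 π) :
    (Real.sin φ + h) / 4 ≤ ‖1 - circleMap 0 (1 + h)⁻¹ φ ^ 2‖ ∧
      ‖1 - circleMap 0 (1 + h)⁻¹ φ ^ 2‖ ≤ 4 * (Real.sin φ + h) := by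
  obtain ⟨a1, a2, a3, a4⟩ := inv_one_add_bounds h0 h1
  set ρ := (1 + h)⁻¹
  have hs := Real.sin_nonneg_of_mem_Icc hφ
  have e : ‖1 - circleMap 0 ρ φ ^ 2‖ ^ 2 = (1 - ρ ^ 2) ^ 2 + 4 * ρ ^ 2 * Real.sin φ ^ 2 := by
    rw [Complex.sq_norm, Complex.normSq_apply]
    simp only [pow_two, Complex.sub_re, Complex.sub_im, Complex.mul_re, Complex.mul_im,
      Complex.one_re, Complex.one_im, circleMap_zero_re, circleMap_zero_im]
    have := Real.sin_sq_add_cos_sq φ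
    have h3 : Real.cos φ ^ 2 = 1 - Real.sin φ ^ 2 := by linarith
    have h4 : Real.cos φ ^ 4 = (1 - Real.sin φ ^ 2) ^ 2 := by rw [← h3]; ring
    ring_nf
    rw [h3, h4]; ring
  have b1 : h / 2 ≤ 1 - ρ ^ 2 := by nlinarith
  have b2 : 1 - ρ ^ 2 ≤ 2 * h := by nlinarith
  have b3 : (1 : ℝ) / 4 ≤ ρ ^ 2 := by nlinarith
  have b4 : ρ ^ 2 ≤ 1 := by nlinarith
  have b5 := sq_nonneg (Real.sin φ)
  constructor
  · rw [← sq_le_sq₀ (by positivity) (norm_nonneg _), e]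
    have : (h / 2) ^ 2 ≤ (1 - ρ ^ 2) ^ 2 := pow_le_pow_left₀ (by positivity) b1 2
    nlinarith [sq_nonneg (Real.sin φ - h)]
  · rw [← sq_le_sq₀ (norm_nonneg _) (by positivity), e]
    have : (1 - ρ ^ 2) ^ 2 ≤ (2 * h) ^ 2 := pow_le_pow_left₀ (by linarith) b2 2
    nlinarith [mul_nonneg hs h0.le]

theorem rpow_le_of_le_mul {y S c b : ℝ} (hS : 0 < S) (hc : 1 ≤ c) (h1 : S ≤ c * y)
    (h2 : y ≤ c * S) : y ^ b ≤ c ^ |b| * S ^ b := by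
  have hc0 : 0 < c := by linarith
  have hy : 0 < y := by
    by_contra h
    push Not at h
    nlinarith
  rcases le_total 0 b with hb | hb
  · rw [abs_of_nonneg hb, ← Real.mul_rpow hc0.le hS.le]
    exact Real.rpow_le_rpow hy.le h2 hb
  · rw [abs_of_nonpos hb]
    have h3 : (c * y) ^ b ≤ S ^ b := Real.rpow_le_rpow_of_nonpos hS h1 hb
    rw [Real.mul_rpow hc0.le hy.le] at h3
    calc y ^ b = c ^ (-b) * (c ^ b * y ^ b) := by
          rw [← mul_assoc, ← Real.rpow_add hc0]; simp
      _ ≤ _ := by gcongr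

theorem prod_add_rpow_anti {m : ℕ} {κ a : Fin m → ℝ} (hκ : ∀ j, 0 ≤ κ j) (ha : ∀ j, 0 ≤ a j)
    {p q : ℝ} (hp : 0 < p) (hpq : p ≤ q) :
    ∏ j, (q + a j) ^ (-κ j) ≤ ∏ j, (p + a j) ^ (-κ j) := by
  refine Finset.prod_le_prod (fun j _ => Real.rpow_nonneg (by linarith [ha j]) _) fun j _ => ?_
  exact Real.rpow_le_rpow_of_nonpos (by linarith [ha j]) (by linarith) (by linarith [hκ j])

theorem prod_add_rpow_scale {m : ℕ} {κ a : Fin m → ℝ} (hκ : ∀ j, 0 ≤ κ j) (ha : ∀ j, 0 ≤ a j)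
    {c p q : ℝ} (hc : 1 ≤ c) (hp : 0 < p) (hpq : p ≤ c * q) :
    ∏ j, (q + a j) ^ (-κ j) ≤ c ^ (∑ j, κ j) * ∏ j, (p + a j) ^ (-κ j) := by
  have hc0 : 0 < c := by linarith
  have hq : 0 < q := by
    by_contra h
    push Not at h
    nlinarith
  rw [Real.rpow_sum_of_pos hc0, ← Finset.prod_mul_distrib]
  refine Finset.prod_le_prod (fun j _ => Real.rpow_nonneg (by linarith [ha j]) _) fun j _ => ?_
  have h1 : (c * (q + a j)) ^ (-κ j) ≤ (p + a j) ^ (-κ j) :=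
    Real.rpow_le_rpow_of_nonpos (by linarith [ha j]) (by nlinarith [ha j]) (by linarith [hκ j])
  rw [Real.mul_rpow hc0.le (by linarith [ha j])] at h1
  calc (q + a j) ^ (-κ j) = c ^ (κ j) * (c ^ (-κ j) * (q + a j) ^ (-κ j)) := by
        rw [← mul_assoc, ← Real.rpow_add hc0]; simp
    _ ≤ _ := by gcongr

theorem prod_add_rpow_nonneg {m : ℕ} {κ a : Fin m → ℝ} (ha : ∀ j, 0 ≤ a j)
    {p : ℝ} (hp : 0 ≤ p) : 0 ≤ ∏ j, (p + a j) ^ (-κ j) :=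
  Finset.prod_nonneg fun j _ => Real.rpow_nonneg (by linarith [ha j]) _

theorem singular_pointwise_bound {m : ℕ} {κ : Fin m → ℝ} (hκ : ∀ j, 0 ≤ κ j) {b M e1 e2 : ℝ}
    (hM : 0 ≤ M) (he1 : M ≤ e1) (he2 : 0 ≤ e2 + b) :
    ∃ C, 0 < C ∧ ∀ a : Fin m → ℝ, (∀ j, 0 ≤ a j) → ∀ h S t y P Q : ℝ, 0 < h → h ≤ S → h ≤ y →
      0 ≤ t → y ≤ S + t → S ≤ y + t → y / 4 ≤ P → P ≤ 4 * y → (t + h) * (t + h + S) / 32 ≤ Q →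
      P ^ b * (Q ^ (-M) * ∏ j, (Q + a j) ^ (-κ j)) ≤
        C * ((∏ j, (S * h + a j) ^ (-κ j)) * (S ^ (b - 2 * M + e1) * (t + h) ^ (-e1)) +
          (∏ j, (S ^ 2 + a j) ^ (-κ j)) * ((t + (h + S)) ^ (b - 2 * M) +
            S ^ b * (t + (h + S)) ^ (-(2 * M)) + S ^ (b + e2 - 2 * M) * y ^ (-e2))) := by
  set K : ℝ := ∑ j, κ j with hK
  have hK0 : 0 ≤ K := Finset.sum_nonneg fun j _ => hκ j
  refine ⟨4 ^ |b| * (96 ^ M * 96 ^ K * (2 ^ |b| * 2 ^ (e1 - M))), by positivity, ?_⟩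
  intro a ha h S t y P Q h0 hhS hhy ht hyS hSy hP1 hP2 hQ
  have hS : 0 < S := by linarith
  have hy : 0 < y := by linarith
  have hx : 0 < t + h := by linarith
  have hxS : 0 < t + (h + S) := by linarith
  have hE1 : (1 : ℝ) ≤ 2 ^ (e1 - M) := Real.one_le_rpow (by norm_num) (by linarith)
  have hE2 : (1 : ℝ) ≤ 2 ^ |b| := Real.one_le_rpow (by norm_num) (abs_nonneg b)
  have hPb : P ^ b ≤ 4 ^ |b| * y ^ b :=
    rpow_le_of_le_mul hy (by norm_num) (by linarith) hP2
  have hq : 0 < (t + h) * (t + h + S) / 32 := by positivity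
  have hQ0 : 0 < Q := lt_of_lt_of_le hq hQ
  have hG1 := prod_add_rpow_nonneg (κ := κ) ha (p := S * h) (by positivity)
  have hG2 := prod_add_rpow_nonneg (κ := κ) ha (p := S ^ 2) (by positivity)
  have hGQ := prod_add_rpow_nonneg (κ := κ) ha (p := Q) hQ0.le
  set G1 := ∏ j, (S * h + a j) ^ (-κ j)
  set G2 := ∏ j, (S ^ 2 + a j) ^ (-κ j)
  set GQ := ∏ j, (Q + a j) ^ (-κ j)
  have n1 : 0 ≤ S ^ (b - 2 * M + e1) * (t + h) ^ (-e1) := by positivity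
  have n2 : 0 ≤ (t + (h + S)) ^ (b - 2 * M) := by positivity
  have n3 : 0 ≤ S ^ b * (t + (h + S)) ^ (-(2 * M)) := by positivity
  have n4 : 0 ≤ S ^ (b + e2 - 2 * M) * y ^ (-e2) := by positivity
  suffices hmain : y ^ b * (Q ^ (-M) * GQ) ≤ 96 ^ M * 96 ^ K * (2 ^ |b| * 2 ^ (e1 - M)) *
      (G1 * (S ^ (b - 2 * M + e1) * (t + h) ^ (-e1)) +
          G2 * ((t + (h + S)) ^ (b - 2 * M) +
            S ^ b * (t + (h + S)) ^ (-(2 * M)) + S ^ (b + e2 - 2 * M) * y ^ (-e2))) by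
    calc P ^ b * (Q ^ (-M) * GQ) ≤ (4 ^ |b| * y ^ b) * (Q ^ (-M) * GQ) := by gcongr
      _ = 4 ^ |b| * (y ^ b * (Q ^ (-M) * GQ)) := by ring
      _ ≤ 4 ^ |b| * _ := mul_le_mul_of_nonneg_left hmain (by positivity)
      _ = _ := by ring
  have hscale : ∀ A B : ℝ, 0 < A → A ≤ 96 * B → 0 < B → B ^ (-M) ≤ 96 ^ M * A ^ (-M) := by
    intro A B hA hAB hB
    have : (96 * B) ^ (-M) ≤ A ^ (-M) := Real.rpow_le_rpow_of_nonpos hA hAB (by linarith)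
    rw [Real.mul_rpow (by norm_num) hB.le] at this
    calc B ^ (-M) = 96 ^ M * (96 ^ (-M) * B ^ (-M)) := by
          rw [← mul_assoc, ← Real.rpow_add (by norm_num)]; simp
      _ ≤ _ := by gcongr
  rcases le_or_gt t (S / 2) with hR | hR
  · have hyb : y ^ b ≤ 2 ^ |b| * S ^ b :=
      rpow_le_of_le_mul hS (by norm_num) (by linarith) (by linarith)
    have hQM : Q ^ (-M) ≤ 96 ^ M * ((t + h) * S) ^ (-M) :=
      hscale _ _ (by positivity) (by nlinarith) hQ0
    have hxM : (t + h) ^ (-M) ≤ 2 ^ (e1 - M) * S ^ (e1 - M) * (t + h) ^ (-e1) := by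
      have h1 : (t + h) ^ (e1 - M) ≤ (2 * S) ^ (e1 - M) :=
        Real.rpow_le_rpow hx.le (by linarith) (by linarith)
      rw [Real.mul_rpow (by norm_num) hS.le] at h1
      calc (t + h) ^ (-M) = (t + h) ^ (e1 - M) * (t + h) ^ (-e1) := by
            rw [← Real.rpow_add hx]; congr 1; ring
        _ ≤ _ := by gcongr
    have hG : GQ ≤ 96 ^ K * G1 :=
      prod_add_rpow_scale hκ ha (by norm_num) (by positivity) (by nlinarith)
    rw [Real.mul_rpow hx.le hS.le] at hQM
    calc y ^ b * (Q ^ (-M) * GQ) ≤ (2 ^ |b| * S ^ b) * ((96 ^ M *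
          ((2 ^ (e1 - M) * S ^ (e1 - M) * (t + h) ^ (-e1)) * S ^ (-M))) * (96 ^ K * G1)) := by
          gcongr
          refine hQM.trans ?_
          gcongr
      _ = 96 ^ M * 96 ^ K * (2 ^ |b| * 2 ^ (e1 - M)) *
          (G1 * ((S ^ b * S ^ (e1 - M) * S ^ (-M)) * (t + h) ^ (-e1))) := by ring
      _ = 96 ^ M * 96 ^ K * (2 ^ |b| * 2 ^ (e1 - M)) *
          (G1 * (S ^ (b - 2 * M + e1) * (t + h) ^ (-e1)) + 0) := by
          rw [← Real.rpow_add hS, ← Real.rpow_add hS, add_zero,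
            show b + (e1 - M) + -M = b - 2 * M + e1 by ring]
      _ ≤ _ := by gcongr; positivity
  · have hQM : Q ^ (-M) ≤ 96 ^ M * (t + (h + S)) ^ (-(2 * M)) := by
      have := hscale ((t + (h + S)) ^ 2) Q (by positivity) (by nlinarith) hQ0
      rwa [← Real.rpow_natCast, ← Real.rpow_mul hxS.le, show ((2 : ℕ) : ℝ) * -M = -(2 * M) by
        push_cast; ring] at this
    have hG : GQ ≤ 96 ^ K * G2 :=
      prod_add_rpow_scale hκ ha (by norm_num) (by positivity) (by nlinarith)
    have hW : y ^ b * (t + (h + S)) ^ (-(2 * M)) ≤ 2 ^ |b| * ((t + (h + S)) ^ (b - 2 * M) +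
            S ^ b * (t + (h + S)) ^ (-(2 * M)) + S ^ (b + e2 - 2 * M) * y ^ (-e2)) := by
      rcases le_or_gt (S / 2) y with hy2 | hy2
      · have h3 : y ^ b ≤ 2 ^ |b| * ((t + (h + S)) ^ b + S ^ b) := by
          rcases le_total 0 b with hb | hb
          · have : y ^ b ≤ (t + (h + S)) ^ b := Real.rpow_le_rpow hy.le (by linarith) hb
            have h6 : 0 < S ^ b := Real.rpow_pos_of_pos hS _
            exact le_trans (by linarith) (le_mul_of_one_le_left (by positivity) hE2)
          · have : (S / 2) ^ b ≤ 2 ^ |b| * S ^ b :=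
              rpow_le_of_le_mul hS (by norm_num) (by linarith) (by linarith)
            have h5 : y ^ b ≤ (S / 2) ^ b := Real.rpow_le_rpow_of_nonpos (by linarith) hy2 hb
            have h6 : 0 < (t + (h + S)) ^ b := Real.rpow_pos_of_pos hxS _
            refine h5.trans (this.trans (mul_le_mul_of_nonneg_left ?_ (by positivity)))
            linarith
        calc y ^ b * (t + (h + S)) ^ (-(2 * M))
            ≤ 2 ^ |b| * ((t + (h + S)) ^ b + S ^ b) * (t + (h + S)) ^ (-(2 * M)) := by gcongr
          _ = 2 ^ |b| * ((t + (h + S)) ^ b * (t + (h + S)) ^ (-(2 * M)) +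
              S ^ b * (t + (h + S)) ^ (-(2 * M)) + 0) := by ring
          _ ≤ _ := by
              rw [← Real.rpow_add hxS, ← sub_eq_add_neg]
              gcongr
      · have h3 : y ^ b ≤ y ^ (-e2) * S ^ (e2 + b) := by
          calc y ^ b = y ^ (-e2) * y ^ (e2 + b) := by
                rw [← Real.rpow_add hy]; congr 1; ring
            _ ≤ _ := by gcongr; linarith
        have h4 : (t + (h + S)) ^ (-(2 * M)) ≤ S ^ (-(2 * M)) :=
          Real.rpow_le_rpow_of_nonpos hS (by linarith) (by linarith)
        calc y ^ b * (t + (h + S)) ^ (-(2 * M)) ≤ y ^ (-e2) * S ^ (e2 + b) * S ^ (-(2 * M)) := by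
              gcongr
          _ = 1 * (0 + 0 + S ^ (b + e2 - 2 * M) * y ^ (-e2)) := by
              rw [mul_assoc, ← Real.rpow_add hS,
                show e2 + b + -(2 * M) = b + e2 - 2 * M by ring]; ring
          _ ≤ _ := by gcongr
    calc y ^ b * (Q ^ (-M) * GQ) ≤ y ^ b * ((96 ^ M * (t + (h + S)) ^ (-(2 * M))) * (96 ^ K * G2)) := by
          gcongr
      _ = 96 ^ M * 96 ^ K * G2 * (y ^ b * (t + (h + S)) ^ (-(2 * M))) := by ring
      _ ≤ 96 ^ M * 96 ^ K * G2 * (2 ^ |b| * _) := mul_le_mul_of_nonneg_left hW (by positivity)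
      _ = 96 ^ M * 96 ^ K * (2 ^ |b| * 1) * (0 + G2 * ((t + (h + S)) ^ (b - 2 * M) +
            S ^ b * (t + (h + S)) ^ (-(2 * M)) + S ^ (b + e2 - 2 * M) * y ^ (-e2))) := by ring
      _ ≤ _ := by gcongr; positivity

theorem intervalIntegrable_abs_add_rpow {e H : ℝ} (hH : 0 < H) (c x y : ℝ) :
    IntervalIntegrable (fun φ : ℝ => (|φ - c| + H) ^ (-e)) volume x y := by
  refine Continuous.intervalIntegrable ?_ _ _
  refine Continuous.rpow_const (by fun_prop) fun φ => Or.inl ?_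
  positivity

theorem integral_abs_add_rpow_le {e H c : ℝ} (he : 1 < e) (hH : 0 < H) (hc : c ∈ Set.Icc 0 π) :
    ∫ φ in (0 : ℝ)..π, (|φ - c| + H) ^ (-e) ≤ 2 / (e - 1) * H ^ (1 - e) := by
  have key : ∀ L : ℝ, 0 ≤ L → ∫ x in (0 : ℝ)..L, (x + H) ^ (-e) ≤ 1 / (e - 1) * H ^ (1 - e) := by
    intro L hL
    rw [intervalIntegral.integral_comp_add_right (fun x : ℝ => x ^ (-e)), zero_add,
      integral_rpow (Or.inr ⟨by linarith, by
        rw [Set.uIcc_of_le (by linarith)]; intro h; linarith [h.1]⟩)]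
    have h1 : 0 ≤ (L + H) ^ (-e + 1) := by positivity
    rw [show (-e + 1) = -(e - 1) by ring] at h1 ⊢
    rw [show 1 - e = -(e - 1) by ring, div_neg, ← neg_div, neg_sub, one_div_mul_eq_div]
    exact div_le_div_of_nonneg_right (by linarith) (by linarith)
  rw [← intervalIntegral.integral_add_adjacent_intervals
    (intervalIntegrable_abs_add_rpow hH c 0 c) (intervalIntegrable_abs_add_rpow hH c c π)]
  have e1 : ∫ φ in (0 : ℝ)..c, (|φ - c| + H) ^ (-e) = ∫ x in (0 : ℝ)..c, (x + H) ^ (-e) := by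
    have := intervalIntegral.integral_comp_sub_left (a := 0) (b := c) (fun x : ℝ => (x + H) ^ (-e)) c
    rw [sub_self, sub_zero] at this
    rw [← this]
    refine intervalIntegral.integral_congr fun φ hφ => ?_
    rw [Set.uIcc_of_le hc.1] at hφ
    rw [abs_of_nonpos (by linarith [hφ.2]), neg_sub]
  have e2 : ∫ φ in c..π, (|φ - c| + H) ^ (-e) = ∫ x in (0 : ℝ)..(π - c), (x + H) ^ (-e) := by
    have := intervalIntegral.integral_comp_sub_right (a := c) (b := π) (fun x : ℝ => (x + H) ^ (-e)) c
    rw [sub_self] at this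
    rw [← this]
    refine intervalIntegral.integral_congr fun φ hφ => ?_
    rw [Set.uIcc_of_le hc.2] at hφ
    rw [abs_of_nonneg (by linarith [hφ.1])]
  rw [e1, e2]
  have k1 := key c hc.1
  have k2 := key (π - c) (by linarith [hc.2])
  have : 2 / (e - 1) * H ^ (1 - e) = 1 / (e - 1) * H ^ (1 - e) + 1 / (e - 1) * H ^ (1 - e) := by ring
  linarith

theorem sin_add_rpow_le {e h φ : ℝ} (he : 0 ≤ e) (h0 : 0 < h) (hφ : φ ∈ Set.Icc 0 π) :
    (Real.sin φ + h) ^ (-e) ≤ 2 ^ e * ((|φ - 0| + h) ^ (-e) + (|φ - π| + h) ^ (-e)) := by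
  have aux : ∀ x : ℝ, 0 ≤ x → x / 2 ≤ Real.sin φ → (Real.sin φ + h) ^ (-e) ≤ 2 ^ e * (x + h) ^ (-e) := by
    intro x hx hxs
    calc (Real.sin φ + h) ^ (-e) ≤ ((x + h) / 2) ^ (-e) :=
          Real.rpow_le_rpow_of_nonpos (by linarith) (by linarith) (by linarith)
      _ = _ := by
          rw [Real.div_rpow (by linarith) (by norm_num), Real.rpow_neg (by norm_num : (0:ℝ) ≤ 2),
            div_inv_eq_mul, mul_comm]
  have p1 : 0 ≤ 2 ^ e * (|φ - 0| + h) ^ (-e) := by positivity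
  have p2 : 0 ≤ 2 ^ e * (|φ - π| + h) ^ (-e) := by positivity
  rw [mul_add]
  rcases le_total φ (π / 2) with h | h
  · have := aux φ hφ.1 (half_le_sin hφ.1 h)
    rw [sub_zero, abs_of_nonneg hφ.1] at *
    linarith
  · have := aux (π - φ) (by linarith [hφ.2]) (by
      rw [← Real.sin_pi_sub]; exact half_le_sin (by linarith [hφ.2]) (by linarith))
    rw [abs_of_nonpos (show φ - π ≤ 0 by linarith [hφ.2]), neg_sub] at *
    linarith

theorem integral_sin_add_rpow_le {e h : ℝ} (he : 1 < e) (h0 : 0 < h) :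
    ∫ φ in (0 : ℝ)..π, (Real.sin φ + h) ^ (-e) ≤ 2 ^ e * (4 / (e - 1)) * h ^ (1 - e) := by
  have h1 : ∫ φ in (0 : ℝ)..π, (Real.sin φ + h) ^ (-e) ≤
      ∫ φ in (0 : ℝ)..π, 2 ^ e * ((|φ - 0| + h) ^ (-e) + (|φ - π| + h) ^ (-e)) := by
    refine intervalIntegral.integral_mono_on pi_pos.le ?_ ?_ fun φ hφ =>
      sin_add_rpow_le (by linarith) h0 hφ
    · refine ContinuousOn.intervalIntegrable (ContinuousOn.rpow_const (by fun_prop) fun φ hφ => ?_)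
      rw [Set.uIcc_of_le pi_pos.le] at hφ
      have := Real.sin_nonneg_of_mem_Icc hφ
      left; linarith
    · exact ((intervalIntegrable_abs_add_rpow h0 0 0 π).add
        (intervalIntegrable_abs_add_rpow h0 π 0 π)).const_mul _
  rw [intervalIntegral.integral_const_mul, intervalIntegral.integral_add
    (intervalIntegrable_abs_add_rpow h0 0 0 π) (intervalIntegrable_abs_add_rpow h0 π 0 π)] at h1
  refine h1.trans ?_
  have k1 := integral_abs_add_rpow_le he h0 (c := 0) ⟨le_rfl, pi_pos.le⟩
  have k2 := integral_abs_add_rpow_le he h0 (c := π) ⟨pi_pos.le, le_rfl⟩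
  calc _ ≤ 2 ^ e * (2 / (e - 1) * h ^ (1 - e) + 2 / (e - 1) * h ^ (1 - e)) := by gcongr
    _ = _ := by ring

/-- The majorant `|1 - r²|^b |Q|^(-M) ∏ (|Q| + a_j)^(-κ_j)` with `Q = 1 - 2 z r + r²`. -/
noncomputable def arcMajorant {m : ℕ} (κ a : Fin m → ℝ) (b M z : ℝ) (r : ℂ) : ℝ :=
  ‖1 - r ^ 2‖ ^ b * (‖gegDen z r‖ ^ (-M) * ∏ j, (‖gegDen z r‖ + a j) ^ (-κ j))

theorem continuous_arcMajorant {m : ℕ} (κ : Fin m → ℝ) {a : Fin m → ℝ} (ha : ∀ j, 0 ≤ a j)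
    (b M : ℝ) {z : ℝ} (h1 : -1 ≤ z) (h2 : z ≤ 1) {ρ : ℝ} (h0 : 0 < ρ) (hρ : ρ < 1) :
    Continuous fun φ : ℝ => arcMajorant κ a b M z (circleMap 0 ρ φ) := by
  have hQ : ∀ φ, 0 < ‖gegDen z (circleMap 0 ρ φ)‖ := fun φ => norm_pos_iff.mpr
    (Complex.slitPlane_ne_zero (gegDen_mem_slitPlane h1 h2 (norm_circleMap_lt h0 hρ φ)))
  have hP : ∀ φ, 0 < ‖1 - circleMap 0 ρ φ ^ 2‖ := fun φ => norm_pos_iff.mpr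
    (Complex.slitPlane_ne_zero (one_sub_sq_mem_slitPlane (norm_circleMap_lt h0 hρ φ)))
  have cQ : Continuous fun φ : ℝ => ‖gegDen z (circleMap 0 ρ φ)‖ := by
    unfold gegDen; fun_prop
  have cP : Continuous fun φ : ℝ => ‖1 - circleMap 0 ρ φ ^ 2‖ := by fun_prop
  unfold arcMajorant
  refine (cP.rpow_const fun φ => Or.inl (hP φ).ne').mul
    ((cQ.rpow_const fun φ => Or.inl (hQ φ).ne').mul (continuous_finsetProd _ fun j _ => ?_))
  refine Continuous.rpow_const (by fun_prop) fun φ => Or.inl ?_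
  linarith [hQ φ, ha j]

theorem integral_arcMajorant_le {m : ℕ} {κ : Fin m → ℝ} (hκ : ∀ j, 0 ≤ κ j) {b M e1 e2 : ℝ}
    (hM : 1 ≤ M) (he1 : M ≤ e1) (he1' : 1 < e1) (he2 : 0 ≤ e2 + b) (he2' : 1 < e2)
    (hbM : b - 2 * M < -1) :
    ∃ C, 0 < C ∧ ∀ a : Fin m → ℝ, (∀ j, 0 ≤ a j) → ∀ h ψ : ℝ, 0 < h → h ≤ 1 → ψ ∈ Set.Icc 0 π →
      ∫ φ in (0 : ℝ)..π, arcMajorant κ a b M (Real.cos ψ) (circleMap 0 (1 + h)⁻¹ φ) ≤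
        C * ((∏ j, ((Real.sin ψ + h) * h + a j) ^ (-κ j)) *
            ((Real.sin ψ + h) ^ (b - 2 * M + e1) * h ^ (1 - e1)) +
          (∏ j, ((Real.sin ψ + h) ^ 2 + a j) ^ (-κ j)) *
            ((Real.sin ψ + h) ^ (b + e2 - 2 * M) * h ^ (1 - e2))) := by
  obtain ⟨C, hC, hCb⟩ := singular_pointwise_bound (κ := κ) hκ (by linarith : 0 ≤ M) he1 he2
  have q1 : 0 < e1 - 1 := by linarith
  have q2 : 0 < e2 - 1 := by linarith
  have q3 : 0 < 2 * M - b - 1 := by linarith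
  have q4 : 0 < 2 * M - 1 := by linarith
  set K := 2 / (e1 - 1) + (2 / (2 * M - b - 1) + 2 / (2 * M - 1) + 2 ^ e2 * (4 / (e2 - 1))) with hK
  have hK0 : 0 < K := by positivity
  refine ⟨C * K, by positivity, ?_⟩
  intro a ha h ψ h0 h1 hψ
  have hs := Real.sin_nonneg_of_mem_Icc hψ
  set S := Real.sin ψ + h with hSdef
  have hS : 0 < S := by linarith
  obtain ⟨a1, a2, -, -⟩ := inv_one_add_bounds h0 h1
  have hρ0 : 0 < (1 + h)⁻¹ := by linarith
  have hG1 := prod_add_rpow_nonneg (κ := κ) ha (p := S * h) (by positivity)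
  have hG2 := prod_add_rpow_nonneg (κ := κ) ha (p := S ^ 2) (by positivity)
  set G1 := ∏ j, (S * h + a j) ^ (-κ j)
  set G2 := ∏ j, (S ^ 2 + a j) ^ (-κ j)
  have i1 := (intervalIntegrable_abs_add_rpow (e := e1) h0 ψ 0 π).const_mul (S ^ (b - 2 * M + e1))
  have i2 := intervalIntegrable_abs_add_rpow (e := 2 * M - b) (H := h + S) (by linarith) ψ 0 π
  have i3 := (intervalIntegrable_abs_add_rpow (e := 2 * M) (H := h + S) (by linarith) ψ 0 π).const_mul
    (S ^ b)
  have i4 : IntervalIntegrable (fun φ => S ^ (b + e2 - 2 * M) * (Real.sin φ + h) ^ (-e2))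
      volume 0 π := by
    refine IntervalIntegrable.const_mul ?_ _
    refine ContinuousOn.intervalIntegrable (ContinuousOn.rpow_const (by fun_prop) fun φ hφ => ?_)
    rw [Set.uIcc_of_le pi_pos.le] at hφ
    have := Real.sin_nonneg_of_mem_Icc hφ
    left; linarith
  have hmono : ∫ φ in (0 : ℝ)..π, arcMajorant κ a b M (Real.cos ψ) (circleMap 0 (1 + h)⁻¹ φ) ≤
      ∫ φ in (0 : ℝ)..π, C * (G1 * (S ^ (b - 2 * M + e1) * (|φ - ψ| + h) ^ (-e1)) +
        G2 * (((|φ - ψ| + (h + S)) ^ (-(2 * M - b)) + S ^ b * (|φ - ψ| + (h + S)) ^ (-(2 * M))) +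
          S ^ (b + e2 - 2 * M) * (Real.sin φ + h) ^ (-e2))) := by
    refine intervalIntegral.integral_mono_on pi_pos.le
      ((continuous_arcMajorant κ ha b M (Real.neg_one_le_cos _) (Real.cos_le_one _) hρ0
        a2).intervalIntegrable _ _)
      (((i1.const_mul _).add (((i2.add i3).add i4).const_mul _)).const_mul _) fun φ hφ => ?_
    obtain ⟨b1, b2⟩ := norm_one_sub_sq_bounds h0 h1 hφ
    have b3 := norm_gegDen_ge h0 h1 hφ hψ
    have hsφ := Real.sin_nonneg_of_mem_Icc hφ
    have hlip : |Real.sin φ - Real.sin ψ| ≤ |φ - ψ| := by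
      simpa [Real.dist_eq] using Real.lipschitzWith_sin.dist_le_mul φ ψ
    have hl := abs_le.mp hlip
    have := hCb a ha h S |φ - ψ| (Real.sin φ + h) _ _ h0 (by linarith) (by linarith) (abs_nonneg _)
      (by linarith [hl.2]) (by linarith [hl.1]) b1 b2 b3
    rw [show -(2 * M - b) = b - 2 * M by ring]
    exact this
  refine hmono.trans ?_
  rw [intervalIntegral.integral_const_mul, mul_assoc]
  refine mul_le_mul_of_nonneg_left ?_ hC.le
  rw [intervalIntegral.integral_add (i1.const_mul _) (((i2.add i3).add i4).const_mul _),
    intervalIntegral.integral_const_mul, intervalIntegral.integral_const_mul,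
    intervalIntegral.integral_const_mul, intervalIntegral.integral_add (i2.add i3) i4,
    intervalIntegral.integral_add i2 i3, intervalIntegral.integral_const_mul,
    intervalIntegral.integral_const_mul]
  have k1 := integral_abs_add_rpow_le he1' h0 hψ
  have k2 := integral_abs_add_rpow_le (e := 2 * M - b) (by linarith) (H := h + S) (by linarith) hψ
  have k3 := integral_abs_add_rpow_le (e := 2 * M) (by linarith) (H := h + S) (by linarith) hψ
  have k4 := integral_sin_add_rpow_le he2' h0
  have hE : S ^ (b - 2 * M + 1) ≤ S ^ (b + e2 - 2 * M) * h ^ (1 - e2) := by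
    have : S ^ (1 - e2) ≤ h ^ (1 - e2) := Real.rpow_le_rpow_of_nonpos h0 (by linarith) (by linarith)
    calc S ^ (b - 2 * M + 1) = S ^ (b + e2 - 2 * M) * S ^ (1 - e2) := by
          rw [← Real.rpow_add hS]; congr 1; ring
      _ ≤ _ := by gcongr
  set E := S ^ (b + e2 - 2 * M) * h ^ (1 - e2) with hEdef
  have hE0 : 0 ≤ E := by positivity
  have l2 : (h + S) ^ (1 - (2 * M - b)) ≤ E := by
    refine le_trans ?_ hE
    rw [show 1 - (2 * M - b) = b - 2 * M + 1 by ring]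
    exact Real.rpow_le_rpow_of_nonpos hS (by linarith) (by linarith)
  have l3 : S ^ b * (h + S) ^ (1 - 2 * M) ≤ E := by
    refine le_trans ?_ hE
    have : (h + S) ^ (1 - 2 * M) ≤ S ^ (1 - 2 * M) :=
      Real.rpow_le_rpow_of_nonpos hS (by linarith) (by linarith)
    calc S ^ b * (h + S) ^ (1 - 2 * M) ≤ S ^ b * S ^ (1 - 2 * M) := by gcongr
      _ = _ := by rw [← Real.rpow_add hS]; congr 1; ring
  have q1' : 0 ≤ 2 / (e1 - 1) := by positivity
  have q3' : 0 ≤ 2 / (2 * M - b - 1) := by positivity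
  have q4' : 0 ≤ 2 / (2 * M - 1) := by positivity
  have q2' : 0 ≤ 2 ^ e2 * (4 / (e2 - 1)) := by positivity
  calc _ ≤ G1 * (S ^ (b - 2 * M + e1) * (2 / (e1 - 1) * h ^ (1 - e1))) +
        G2 * (2 / (2 * M - b - 1) * (h + S) ^ (1 - (2 * M - b)) +
          S ^ b * (2 / (2 * M - 1) * (h + S) ^ (1 - 2 * M)) +
          S ^ (b + e2 - 2 * M) * (2 ^ e2 * (4 / (e2 - 1)) * h ^ (1 - e2))) := by
        gcongr
    _ = 2 / (e1 - 1) * (G1 * (S ^ (b - 2 * M + e1) * h ^ (1 - e1))) +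
        G2 * (2 / (2 * M - b - 1) * (h + S) ^ (1 - (2 * M - b)) +
          2 / (2 * M - 1) * (S ^ b * (h + S) ^ (1 - 2 * M)) +
          2 ^ e2 * (4 / (e2 - 1)) * E) := by rw [hEdef]; ring
    _ ≤ 2 / (e1 - 1) * (G1 * (S ^ (b - 2 * M + e1) * h ^ (1 - e1))) +
        G2 * (2 / (2 * M - b - 1) * E + 2 / (2 * M - 1) * E + 2 ^ e2 * (4 / (e2 - 1)) * E) := by
        gcongr
    _ = 2 / (e1 - 1) * (G1 * (S ^ (b - 2 * M + e1) * h ^ (1 - e1))) +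
        (2 / (2 * M - b - 1) + 2 / (2 * M - 1) + 2 ^ e2 * (4 / (e2 - 1))) * (G2 * E) := by ring
    _ ≤ K * (G1 * (S ^ (b - 2 * M + e1) * h ^ (1 - e1))) + K * (G2 * E) := by
        refine add_le_add (mul_le_mul_of_nonneg_right ?_ (by positivity))
          (mul_le_mul_of_nonneg_right ?_ (by positivity))
        · rw [hK]; linarith
        · rw [hK]; linarith
    _ = _ := by ring

theorem arcMajorant_conj {m : ℕ} (κ a : Fin m → ℝ) (b M z : ℝ) (r : ℂ) :
    arcMajorant κ a b M z (starRingEnd ℂ r) = arcMajorant κ a b M z r := by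
  have h1 : ‖gegDen z (starRingEnd ℂ r)‖ = ‖gegDen z r‖ := by
    rw [gegDen_conj, Complex.norm_conj]
  have h2 : ‖1 - (starRingEnd ℂ r) ^ 2‖ = ‖1 - r ^ 2‖ := by
    rw [← Complex.norm_conj (1 - r ^ 2)]; simp
  rw [arcMajorant, arcMajorant, h1, h2]

theorem circleMap_two_pi_sub (ρ φ : ℝ) :
    circleMap 0 ρ (2 * π - φ) = starRingEnd ℂ (circleMap 0 ρ φ) := by
  apply Complex.ext
  · rw [Complex.conj_re, circleMap_zero_re, circleMap_zero_re, Real.cos_two_pi_sub]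
  · rw [Complex.conj_im, circleMap_zero_im, circleMap_zero_im, Real.sin_two_pi_sub]; ring

theorem integral_arcMajorant_two_pi {m : ℕ} (κ : Fin m → ℝ) {a : Fin m → ℝ} (ha : ∀ j, 0 ≤ a j)
    (b M : ℝ) {z : ℝ} (h1 : -1 ≤ z) (h2 : z ≤ 1) {ρ : ℝ} (h0 : 0 < ρ) (hρ : ρ < 1) :
    ∫ φ in (0 : ℝ)..(2 * π), arcMajorant κ a b M z (circleMap 0 ρ φ) =
      2 * ∫ φ in (0 : ℝ)..π, arcMajorant κ a b M z (circleMap 0 ρ φ) := by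
  have hc := continuous_arcMajorant κ ha b M h1 h2 h0 hρ
  rw [← intervalIntegral.integral_add_adjacent_intervals (hc.intervalIntegrable 0 π)
    (hc.intervalIntegrable π (2 * π)), two_mul (∫ φ in (0 : ℝ)..π, _)]
  congr 1
  have := intervalIntegral.integral_comp_sub_left (a := 0) (b := π)
    (fun φ => arcMajorant κ a b M z (circleMap 0 ρ φ)) (2 * π)
  rw [sub_zero, show 2 * π - π = π by ring] at this
  rw [← this]
  simp only [circleMap_two_pi_sub, arcMajorant_conj]

theorem isCompact_cube (m : ℕ) : IsCompact (cube m) := isCompact_univ_pi fun _ => isCompact_Icc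

theorem cube_integral_swap {m : ℕ} {κ : Fin m → ℝ} (hκ : ∀ i, 0 < κ i) {x y : ℝ} (hxy : x ≤ y)
    {F : (Fin m → ℝ) → ℝ → ℂ}
    (hF : ContinuousOn (fun p : (Fin m → ℝ) × ℝ => F p.1 p.2) (cube m ×ˢ Set.Icc x y)) :
    Integrable (fun t => (∫ φ in x..y, F t φ) * (wcube κ t : ℂ)) (volume.restrict (cube m)) ∧
      ∫ t in cube m, (∫ φ in x..y, F t φ) * (wcube κ t : ℂ) =
        ∫ φ in x..y, ∫ t in cube m, F t φ * (wcube κ t : ℂ) := by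
  have hfin : IsFiniteMeasure ((volume : Measure (Fin m → ℝ)).restrict (cube m)) :=
    isFiniteMeasure_restrict.mpr (isCompact_cube m).measure_lt_top.ne
  have hsub : cube m ×ˢ Set.Ioc x y ⊆ cube m ×ˢ Set.Icc x y :=
    Set.prod_mono le_rfl Set.Ioc_subset_Icc_self
  have hms : MeasurableSet (cube m ×ˢ Set.Ioc x y) :=
    (measurableSet_cube m).prod measurableSet_Ioc
  obtain ⟨B, hB⟩ := ((isCompact_cube m).prod isCompact_Icc).exists_bound_of_continuousOn hF
  have hint : Integrable (fun p : (Fin m → ℝ) × ℝ => F p.1 p.2 * (wcube κ p.1 : ℂ))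
      ((volume.restrict (cube m)).prod (volume.restrict (Set.Ioc x y))) := by
    have hw : Integrable (fun p : (Fin m → ℝ) × ℝ => (wcube κ p.1 : ℂ))
        ((volume.restrict (cube m)).prod (volume.restrict (Set.Ioc x y))) :=
      Integrable.comp_fst (f := fun t : Fin m → ℝ => (wcube κ t : ℂ)) (integrable_wcube hκ).ofReal _
    refine hw.bdd_mul (c := B) ?_ ?_
    · rw [Measure.prod_restrict]
      exact (hF.mono hsub).aestronglyMeasurable hms
    · rw [Measure.prod_restrict]
      filter_upwards [ae_restrict_mem hms] with p hp
      exact hB p (hsub hp)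
  simp only [intervalIntegral.integral_of_le hxy]
  have e : ∀ t, (∫ φ in Set.Ioc x y, F t φ) * (wcube κ t : ℂ) =
      ∫ φ in Set.Ioc x y, F t φ * (wcube κ t : ℂ) := fun t => (MeasureTheory.integral_mul_const _ _).symm
  simp only [e]
  exact ⟨hint.integral_prod_left, MeasureTheory.integral_integral_swap hint⟩

theorem continuousOn_circKernel {m : ℕ} {a : Fin m → ℝ} (ha : ∀ j, 0 ≤ a j) (ha1 : ∑ j, a j ≤ 1)
    {ρ : ℝ} (h0 : 0 < ρ) (hρ : ρ < 1) (b l : ℂ) (k : ℤ) (s : Set ℝ) :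
    ContinuousOn (fun p : (Fin m → ℝ) × ℝ => (1 - circleMap 0 ρ p.2 ^ 2) ^ b *
      gegDen (∑ j, a j * p.1 j) (circleMap 0 ρ p.2) ^ l * circleMap 0 ρ p.2 ^ k)
      (cube m ×ˢ s) := by
  have hc : Continuous fun p : (Fin m → ℝ) × ℝ => circleMap 0 ρ p.2 :=
    (continuous_circleMap 0 ρ).comp continuous_snd
  refine ContinuousOn.mul (ContinuousOn.mul ?_ ?_) ?_
  · refine ContinuousOn.cpow_const (by fun_prop) fun p _ =>
      one_sub_sq_mem_slitPlane (norm_circleMap_lt h0 hρ _)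
  · refine ContinuousOn.cpow_const ?_ fun p hp => ?_
    · unfold gegDen; fun_prop
    · have := abs_le.mp (abs_sum_mul_le_one ha ha1 (abs_le_one_of_mem_cube hp.1))
      exact gegDen_mem_slitPlane this.1 this.2 (norm_circleMap_lt h0 hρ _)
  · exact (hc.zpow₀ _ fun p => Or.inl (circleMap_ne_zero' h0 _)).continuousOn

/-- The weighted cube integral of a circle coefficient of `(1 - r²)^b Q^l`. -/
noncomputable def cubeCoeff {m : ℕ} (a κ : Fin m → ℝ) (ρ : ℝ) (b l : ℂ) (k : ℤ) : ℂ :=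
  ∫ t in cube m, circCoeff ρ (fun r => (1 - r ^ 2) ^ b * gegDen (∑ j, a j * t j) r ^ l) k *
    (wcube κ t : ℂ)

theorem integrable_cubeCoeff {m : ℕ} {a κ : Fin m → ℝ} (hκ : ∀ i, 0 < κ i) (ha : ∀ j, 0 ≤ a j)
    (ha1 : ∑ j, a j ≤ 1) {ρ : ℝ} (h0 : 0 < ρ) (hρ : ρ < 1) (b l : ℂ) (k : ℤ) :
    Integrable (fun t => circCoeff ρ (fun r => (1 - r ^ 2) ^ b *
      gegDen (∑ j, a j * t j) r ^ l) k * (wcube κ t : ℂ)) (volume.restrict (cube m)) :=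
  (cube_integral_swap hκ (by positivity : (0 : ℝ) ≤ 2 * π)
    (continuousOn_circKernel ha ha1 h0 hρ b l (-k) _)).1

theorem cubeCoeff_reduce {m : ℕ} {a κ : Fin m → ℝ} (hκ : ∀ i, 0 < κ i) (ha : ∀ j, 0 ≤ a j)
    (ha1 : ∑ j, a j ≤ 1) {ρ : ℝ} (h0 : 0 < ρ) (hρ : ρ < 1) (b μ : ℂ) (k : ℤ) :
    k * cubeCoeff a κ ρ b (-μ) k = (2 * b - μ) * cubeCoeff a κ ρ b (-μ) k +
      (-2 * b * cubeCoeff a κ ρ (b - 1) (-μ) k + μ * cubeCoeff a κ ρ (b + 1) (-μ - 1) k) := by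
  have hi := fun b l => integrable_cubeCoeff hκ ha ha1 h0 hρ b l k
  have h12 := MeasureTheory.integral_add ((hi (b - 1) (-μ)).const_mul (-2 * b))
    ((hi (b + 1) (-μ - 1)).const_mul μ)
  have h012 := MeasureTheory.integral_add ((hi b (-μ)).const_mul (2 * b - μ))
    (((hi (b - 1) (-μ)).const_mul (-2 * b)).add ((hi (b + 1) (-μ - 1)).const_mul μ))
  simp only [Pi.add_apply] at h012
  simp only [cubeCoeff]
  rw [← MeasureTheory.integral_const_mul, ← MeasureTheory.integral_const_mul,
    ← MeasureTheory.integral_const_mul, ← MeasureTheory.integral_const_mul, ← h12, ← h012]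
  refine setIntegral_congr_fun (measurableSet_cube m) fun t ht => ?_
  have hz := abs_le.mp (abs_sum_mul_le_one ha ha1 (abs_le_one_of_mem_cube ht))
  have := circCoeff_reduce hz.1 hz.2 h0 hρ b μ k
  rw [← mul_assoc, this]
  ring

theorem inv_one_add_inv_zpow_le {N : ℕ} (hN : 1 ≤ N) :
    ((1 + (N : ℝ)⁻¹)⁻¹) ^ (-(N : ℤ)) ≤ 3 := by
  have hN0 : (0 : ℝ) < N := by exact_mod_cast hN
  rw [zpow_neg, zpow_natCast, inv_pow, inv_inv]
  calc (1 + (N : ℝ)⁻¹) ^ N ≤ Real.exp ((N : ℝ)⁻¹) ^ N := by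
        refine pow_le_pow_left₀ (by positivity) ?_ N
        linarith [Real.add_one_le_exp (N : ℝ)⁻¹]
    _ = Real.exp 1 := by rw [← Real.exp_nat_mul, mul_inv_cancel₀ hN0.ne']
    _ ≤ 3 := by linarith [Real.exp_one_lt_d9]

theorem norm_cubeCoeff_le {m : ℕ} (hm : 0 < m) {κ : Fin m → ℝ} (hκ : ∀ i, 0 < κ i) (b : ℝ) {μ : ℝ}
    (hμ : ∑ j, κ j < μ) :
    ∃ C, 0 < C ∧ ∀ a : Fin m → ℝ, (∀ j, 0 ≤ a j) → ∑ j, a j ≤ 1 → ∀ N : ℕ, 1 ≤ N →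
      ‖cubeCoeff a κ (1 + (N : ℝ)⁻¹)⁻¹ b (-μ : ℂ) N‖ ≤ C * ∑ ε : Fin m → Bool,
        ∫ φ in (0 : ℝ)..(2 * π), arcMajorant κ a b (μ - ∑ j, κ j) (∑ j, a j * boolSign (ε j))
          (circleMap 0 (1 + (N : ℝ)⁻¹)⁻¹ φ) := by
  obtain ⟨C, hC, hCb⟩ := norm_cubeAvg_le hm hκ hμ
  refine ⟨3 * C, by positivity, fun a ha ha1 N hN => ?_⟩
  have hN0 : (0 : ℝ) < N := by exact_mod_cast hN
  have hN1 : (1 : ℝ) ≤ N := by exact_mod_cast hN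
  obtain ⟨r1, r2, -, -⟩ := inv_one_add_bounds (inv_pos.mpr hN0) (inv_le_one_of_one_le₀ hN1)
  have hpow := inv_one_add_inv_zpow_le hN
  set ρ := (1 + (N : ℝ)⁻¹)⁻¹
  have h0 : 0 < ρ := by linarith
  have hpi : (0 : ℝ) ≤ 2 * π := by positivity
  have hsw := (cube_integral_swap (κ := κ) hκ hpi
    (F := fun t φ => (1 - circleMap 0 ρ φ ^ 2) ^ (b : ℂ) *
      gegDen (∑ j, a j * t j) (circleMap 0 ρ φ) ^ (-μ : ℂ) * circleMap 0 ρ φ ^ (-(N : ℤ)))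
    (continuousOn_circKernel ha ha1 h0 r2 (b : ℂ) (-μ : ℂ) (-(N : ℤ)) _)).2
  have hz : ∀ ε : Fin m → Bool, |∑ j, a j * boolSign (ε j)| ≤ 1 := fun ε =>
    abs_sum_mul_le_one ha ha1 fun j => (abs_boolSign _).le
  have hcont : ∀ ε : Fin m → Bool, Continuous fun φ => arcMajorant κ a b (μ - ∑ j, κ j)
      (∑ j, a j * boolSign (ε j)) (circleMap 0 ρ φ) := fun ε =>
    continuous_arcMajorant κ ha _ _ (abs_le.mp (hz ε)).1 (abs_le.mp (hz ε)).2 h0 r2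
  rw [cubeCoeff]
  simp only [circCoeff]
  rw [hsw, mul_assoc, ← intervalIntegral.integral_finsetSum fun ε _ => (hcont ε).intervalIntegrable _ _,
    ← intervalIntegral.integral_const_mul, ← intervalIntegral.integral_const_mul]
  refine intervalIntegral.norm_integral_le_of_norm_le hpi ?_ ?_
  · filter_upwards [(Set.countable_singleton π).ae_notMem volume,
      (Set.countable_singleton (2 * π)).ae_notMem volume] with φ hφ1 hφ2 hφ
    have him : (circleMap 0 ρ φ).im ≠ 0 := by
      rw [circleMap_zero_im]
      refine mul_ne_zero h0.ne' ?_
      rcases lt_or_gt_of_ne (show φ ≠ π from hφ1) with h | h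
      · exact (Real.sin_pos_of_pos_of_lt_pi hφ.1 h).ne'
      · have h2 : φ < 2 * π := lt_of_le_of_ne hφ.2 hφ2
        have := Real.sin_pos_of_pos_of_lt_pi (x := φ - π) (by linarith) (by linarith)
        rw [Real.sin_sub_pi] at this
        linarith
    have hn : ‖circleMap 0 ρ φ‖ = ρ := by simp [abs_of_pos h0]
    have hav := hCb a ha ha1 (circleMap 0 ρ φ) (by rw [hn]; exact r1) (by rw [hn]; exact r2) him
    have e : ∫ t in cube m, (1 - circleMap 0 ρ φ ^ 2) ^ (b : ℂ) *
        gegDen (∑ j, a j * t j) (circleMap 0 ρ φ) ^ (-μ : ℂ) * circleMap 0 ρ φ ^ (-(N : ℤ)) *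
          (wcube κ t : ℂ) = (1 - circleMap 0 ρ φ ^ 2) ^ (b : ℂ) * circleMap 0 ρ φ ^ (-(N : ℤ)) *
        cubeAvg a κ μ (circleMap 0 ρ φ) := by
      rw [cubeAvg, ← MeasureTheory.integral_const_mul]
      congr 1; ext t; ring
    rw [e, norm_mul, norm_mul, Complex.norm_cpow_real, norm_zpow, hn]
    refine (mul_le_mul (mul_le_mul_of_nonneg_left hpow (by positivity)) hav (norm_nonneg _)
      (by positivity)).trans_eq ?_
    simp only [arcMajorant, Finset.mul_sum]
    refine Finset.sum_congr rfl fun ε _ => ?_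
    ring
  · refine Continuous.intervalIntegrable ?_ _ _
    fun_prop

theorem sum_integral_arcMajorant_le {m : ℕ} {κ : Fin m → ℝ} (hκ : ∀ j, 0 ≤ κ j) {b M e1 e2 : ℝ}
    (hM : 1 ≤ M) (he1 : M ≤ e1) (he1' : 1 < e1) (he2 : 0 ≤ e2 + b) (he2' : 1 < e2)
    (hbM : b - 2 * M < -1) (hs1 : b - 2 * M + e1 ≤ 0) (hs2 : b + e2 - 2 * M ≤ 0) :
    ∃ C, 0 < C ∧ ∀ a : Fin m → ℝ, (∀ j, 0 ≤ a j) → ∑ j, a j ≤ 1 → ∀ h σ : ℝ, 0 < h → h ≤ 1 →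
      σ = √(1 - ∑ j, a j) + h →
      ∑ ε : Fin m → Bool, ∫ φ in (0 : ℝ)..(2 * π), arcMajorant κ a b M (∑ j, a j * boolSign (ε j))
          (circleMap 0 (1 + h)⁻¹ φ) ≤
        C * ((∏ j, (σ * h + a j) ^ (-κ j)) * (σ ^ (b - 2 * M + e1) * h ^ (1 - e1)) +
          (∏ j, (σ ^ 2 + a j) ^ (-κ j)) * (σ ^ (b + e2 - 2 * M) * h ^ (1 - e2))) := by
  obtain ⟨C, hC, hCb⟩ := integral_arcMajorant_le hκ hM he1 he1' he2 he2' hbM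
  refine ⟨Fintype.card (Fin m → Bool) * (2 * C), by positivity, ?_⟩
  rintro a ha ha1 h σ h0 h1 rfl
  rw [mul_assoc, ← nsmul_eq_mul, Fintype.card]
  refine Finset.sum_le_card_nsmul _ _ _ fun ε _ => ?_
  set z := ∑ j, a j * boolSign (ε j) with hz
  have hzA : |z| ≤ ∑ j, a j := by
    refine (Finset.abs_sum_le_sum_abs _ _).trans (Finset.sum_le_sum fun j _ => ?_)
    rw [abs_mul, abs_boolSign, mul_one, abs_of_nonneg (ha j)]
  have hz1 := abs_le.mp (hzA.trans ha1)
  obtain ⟨r1, r2, -, -⟩ := inv_one_add_bounds h0 h1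
  rw [integral_arcMajorant_two_pi κ ha b M hz1.1 hz1.2 (by linarith) r2]
  have key := hCb a ha h (Real.arccos z) h0 h1 ⟨Real.arccos_nonneg z, Real.arccos_le_pi z⟩
  rw [Real.cos_arccos hz1.1 hz1.2, Real.sin_arccos] at key
  have hsq : √(1 - ∑ j, a j) ≤ √(1 - z ^ 2) := by
    refine Real.sqrt_le_sqrt ?_
    have := abs_nonneg z
    rw [← sq_abs z]
    nlinarith
  have hσ0 : 0 < √(1 - ∑ j, a j) + h := by positivity
  set σ := √(1 - ∑ j, a j) + h
  set S := √(1 - z ^ 2) + h with hS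
  have hσS : σ ≤ S := by simp only [hS, σ]; linarith
  have p1 : ∏ j, (S * h + a j) ^ (-κ j) ≤ ∏ j, (σ * h + a j) ^ (-κ j) :=
    prod_add_rpow_anti hκ ha (by positivity) (by gcongr)
  have p2 : ∏ j, (S ^ 2 + a j) ^ (-κ j) ≤ ∏ j, (σ ^ 2 + a j) ^ (-κ j) :=
    prod_add_rpow_anti hκ ha (by positivity) (by gcongr)
  have p3 : S ^ (b - 2 * M + e1) ≤ σ ^ (b - 2 * M + e1) := Real.rpow_le_rpow_of_nonpos hσ0 hσS hs1
  have p4 : S ^ (b + e2 - 2 * M) ≤ σ ^ (b + e2 - 2 * M) := Real.rpow_le_rpow_of_nonpos hσ0 hσS hs2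
  have q1 := prod_add_rpow_nonneg (κ := κ) ha (p := σ * h) (by positivity)
  have q2 := prod_add_rpow_nonneg (κ := κ) ha (p := σ ^ 2) (by positivity)
  rw [mul_assoc]
  refine mul_le_mul_of_nonneg_left (key.trans ?_) zero_le_two
  gcongr

theorem arcMajorant_add_one_le {m : ℕ} (κ : Fin m → ℝ) {a : Fin m → ℝ} (ha : ∀ j, 0 ≤ a j)
    (b M z : ℝ) {r : ℂ} (hr : ‖r‖ < 1) :
    arcMajorant κ a (b + 1) M z r ≤ 2 * arcMajorant κ a b M z r := by
  have hP : 0 < ‖1 - r ^ 2‖ :=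
    norm_pos_iff.mpr (Complex.slitPlane_ne_zero (one_sub_sq_mem_slitPlane hr))
  have hP2 : ‖1 - r ^ 2‖ ≤ 2 := by
    refine (norm_sub_le _ _).trans ?_
    rw [norm_one, norm_pow]
    nlinarith [norm_nonneg r]
  have hG := prod_add_rpow_nonneg (κ := κ) ha (norm_nonneg (gegDen z r))
  rw [arcMajorant, arcMajorant, Real.rpow_add_one hP.ne', mul_comm (_ ^ b) ‖1 - r ^ 2‖, mul_assoc]
  gcongr

theorem rpow_mul_rpow_le {h σ : ℝ} (h0 : 0 < h) (hσ : h ≤ σ) {e e' : ℝ} (he : e ≤ e') (c c' : ℝ) :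
    σ ^ (e - c) * h ^ (c' - e) ≤ σ ^ (e' - c) * h ^ (c' - e') := by
  have hσ0 : 0 < σ := by linarith
  calc σ ^ (e - c) * h ^ (c' - e) = σ ^ (e' - c) * σ ^ (e - e') * h ^ (c' - e) := by
        rw [← Real.rpow_add hσ0]; congr 2; ring
    _ ≤ σ ^ (e' - c) * h ^ (e - e') * h ^ (c' - e) := by
        have := Real.rpow_le_rpow_of_nonpos h0 hσ (show e - e' ≤ 0 by linarith)
        gcongr
    _ = σ ^ (e' - c) * h ^ (c' - e') := by
        rw [mul_assoc, ← Real.rpow_add h0]; congr 2; ring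

theorem mul_max_exponent_le {h σ δ ν G1 G2 e : ℝ} (h0 : 0 < h) (hσ : h ≤ σ)
    (hG2 : 0 ≤ G2) (hG : G2 ≤ G1) (he : e ≤ δ + 1 ∨ e ≤ ν + 1) :
    h * (G2 * (σ ^ (e - (δ + 1 + 2 * ν)) * h ^ (1 - e))) ≤
      G1 * (h ^ (1 - ν) * σ ^ (-δ - ν)) + G2 * (h ^ (1 - δ) * σ ^ (-(2 * ν))) := by
  have hσ0 : 0 < σ := by linarith
  have n1 : 0 ≤ G1 * (h ^ (1 - ν) * σ ^ (-δ - ν)) := mul_nonneg (by linarith) (by positivity)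
  have n2 : 0 ≤ G2 * (h ^ (1 - δ) * σ ^ (-(2 * ν))) := by positivity
  have e0 : h * (G2 * (σ ^ (e - (δ + 1 + 2 * ν)) * h ^ (1 - e))) =
      G2 * (σ ^ (e - (δ + 1 + 2 * ν)) * h ^ (2 - e)) := by
    rw [show (2 : ℝ) - e = (1 - e) + 1 by ring, Real.rpow_add_one h0.ne']; ring
  rw [e0]
  rcases he with he | he
  · have := rpow_mul_rpow_le h0 hσ he (δ + 1 + 2 * ν) 2
    rw [show δ + 1 - (δ + 1 + 2 * ν) = -(2 * ν) by ring, show 2 - (δ + 1) = 1 - δ by ring,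
      mul_comm (σ ^ (-(2 * ν)))] at this
    have := mul_le_mul_of_nonneg_left this hG2
    linarith
  · have := rpow_mul_rpow_le h0 hσ he (δ + 1 + 2 * ν) 2
    rw [show ν + 1 - (δ + 1 + 2 * ν) = -δ - ν by ring, show 2 - (ν + 1) = 1 - ν by ring,
      mul_comm (σ ^ (-δ - ν))] at this
    have h1 := mul_le_mul_of_nonneg_left this hG2
    have h2 : G2 * (h ^ (1 - ν) * σ ^ (-δ - ν)) ≤ G1 * (h ^ (1 - ν) * σ ^ (-δ - ν)) := by gcongr
    linarith

theorem norm_cubeCoeff_cesaro_le {m : ℕ} (hm : 0 < m) {κ : Fin m → ℝ} (hκ : ∀ i, 0 < κ i) {δ ν : ℝ}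
    (hδ : -1 < δ) (hν : 1 ≤ ν) :
    ∃ C, 0 < C ∧ ∀ a : Fin m → ℝ, (∀ j, 0 ≤ a j) → ∑ j, a j ≤ 1 → ∀ N : ℕ, 1 ≤ N → ∀ h σ : ℝ,
      h = (N : ℝ)⁻¹ → σ = √(1 - ∑ j, a j) + h →
      ‖cubeCoeff a κ (1 + h)⁻¹ (-δ : ℂ) (-((∑ j, κ j) + ν : ℝ) : ℂ) N‖ ≤
        C * ((∏ j, (σ * h + a j) ^ (-κ j)) * (h ^ (1 - ν) * σ ^ (-δ - ν)) +
          (∏ j, (σ ^ 2 + a j) ^ (-κ j)) * (h ^ (1 - δ) * σ ^ (-(2 * ν)))) := by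
  set μ : ℝ := (∑ j, κ j) + ν with hμ
  have hκ' : ∀ j, 0 ≤ κ j := fun j => (hκ j).le
  set e2 : ℝ := max (3 / 2) (δ + 1) with he2
  set e2' : ℝ := max (3 / 2) (δ - 1) with he2'
  have m1 : (3 : ℝ) / 2 ≤ e2 := le_max_left _ _
  have m2 : δ + 1 ≤ e2 := le_max_right _ _
  have m3 : (3 : ℝ) / 2 ≤ e2' := le_max_left _ _
  have m4 : δ - 1 ≤ e2' := le_max_right _ _
  have m5 : e2 ≤ δ + 1 + 2 * ν := max_le (by linarith) (by linarith)
  have m6 : e2' ≤ δ + 1 + 2 * ν := max_le (by linarith) (by linarith)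
  have m7 : e2 ≤ δ + 1 ∨ e2 ≤ ν + 1 := by
    rcases max_choice (3 / 2 : ℝ) (δ + 1) with h | h
    · right; rw [he2, h]; linarith
    · left; rw [he2, h]
  have m8 : e2' ≤ δ + 1 ∨ e2' ≤ ν + 1 := by
    rcases max_choice (3 / 2 : ℝ) (δ - 1) with h | h
    · right; rw [he2', h]; linarith
    · left; rw [he2', h]; linarith
  obtain ⟨K0, hK0, hJ0⟩ := norm_cubeCoeff_le hm hκ (-δ) (μ := μ) (by linarith)
  obtain ⟨K1, hK1, hJ1⟩ := norm_cubeCoeff_le hm hκ (-δ - 1) (μ := μ) (by linarith)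
  obtain ⟨K2, hK2, hJ2⟩ := norm_cubeCoeff_le hm hκ (-δ + 1) (μ := μ + 1) (by linarith)
  obtain ⟨L1, hL1, hI1⟩ := sum_integral_arcMajorant_le hκ' (b := -δ - 1) (M := ν) (e1 := ν + 1 / 2)
    (e2 := e2) hν (by linarith) (by linarith) (by linarith) (by linarith) (by linarith) (by linarith)
    (by linarith)
  obtain ⟨L2, hL2, hI2⟩ := sum_integral_arcMajorant_le hκ' (b := -δ + 1) (M := ν + 1) (e1 := ν + 1)
    (e2 := e2') (by linarith) (by linarith) (by linarith) (by linarith) (by linarith) (by linarith)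
    (by linarith) (by linarith)
  have hμ1 : μ - ∑ j, κ j = ν := by rw [hμ]; ring
  have hμ2 : μ + 1 - ∑ j, κ j = ν + 1 := by rw [hμ]; ring
  rw [hμ1] at hJ0 hJ1
  rw [hμ2] at hJ2
  refine ⟨2 * (|2 * δ + μ| * (2 * K0 * L1) + |2 * δ| * (K1 * L1) + |μ| * (K2 * L2) + 1), by positivity, ?_⟩
  rintro a ha ha1 N hN h σ rfl hσ
  have hN0 : (0 : ℝ) < N := by exact_mod_cast hN
  have hN1 : (1 : ℝ) ≤ N := by exact_mod_cast hN
  set h : ℝ := (N : ℝ)⁻¹ with hh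
  have h0 : 0 < h := inv_pos.mpr hN0
  have h1 : h ≤ 1 := inv_le_one_of_one_le₀ hN1
  obtain ⟨r1, r2, -, -⟩ := inv_one_add_bounds h0 h1
  have hρ0 : 0 < (1 + h)⁻¹ := by linarith
  have hhσ : h ≤ σ := by rw [hσ]; linarith [Real.sqrt_nonneg (1 - ∑ j, a j)]
  have hσ0 : 0 < σ := by linarith
  have H0 := hJ0 a ha ha1 N hN
  have H1 := hJ1 a ha ha1 N hN
  have H2 := hJ2 a ha ha1 N hN
  have I1 := hI1 a ha ha1 h σ h0 h1 hσ
  have I2 := hI2 a ha ha1 h σ h0 h1 hσ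
  have hdom : ∑ ε : Fin m → Bool, ∫ φ in (0 : ℝ)..(2 * π), arcMajorant κ a (-δ) ν
        (∑ j, a j * boolSign (ε j)) (circleMap 0 (1 + h)⁻¹ φ) ≤
      2 * ∑ ε : Fin m → Bool, ∫ φ in (0 : ℝ)..(2 * π), arcMajorant κ a (-δ - 1) ν
        (∑ j, a j * boolSign (ε j)) (circleMap 0 (1 + h)⁻¹ φ) := by
    rw [Finset.mul_sum]
    refine Finset.sum_le_sum fun ε _ => ?_
    have hz := abs_le.mp (abs_sum_mul_le_one ha ha1 fun j => (abs_boolSign (ε j)).le)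
    rw [← intervalIntegral.integral_const_mul]
    refine intervalIntegral.integral_mono_on (by positivity)
      ((continuous_arcMajorant κ ha _ _ hz.1 hz.2 hρ0 r2).intervalIntegrable _ _)
      (((continuous_arcMajorant κ ha _ _ hz.1 hz.2 hρ0 r2).intervalIntegrable _ _).const_mul _)
      fun φ _ => ?_
    have := arcMajorant_add_one_le κ ha (-δ - 1) ν (∑ j, a j * boolSign (ε j))
      (norm_circleMap_lt hρ0 r2 φ)
    rwa [sub_add_cancel] at this
  have hG1 := prod_add_rpow_nonneg (κ := κ) ha (p := σ * h) (by positivity)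
  have hG2 := prod_add_rpow_nonneg (κ := κ) ha (p := σ ^ 2) (by positivity)
  have hG12 : ∏ j, (σ ^ 2 + a j) ^ (-κ j) ≤ ∏ j, (σ * h + a j) ^ (-κ j) :=
    prod_add_rpow_anti hκ' ha (by positivity) (by nlinarith)
  set G1 := ∏ j, (σ * h + a j) ^ (-κ j)
  set G2 := ∏ j, (σ ^ 2 + a j) ^ (-κ j)
  set T := G1 * (h ^ (1 - ν) * σ ^ (-δ - ν)) + G2 * (h ^ (1 - δ) * σ ^ (-(2 * ν))) with hT
  have hT1 : G1 * (h ^ (1 - ν) * σ ^ (-δ - ν)) ≤ T := by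
    rw [hT]; exact le_add_of_nonneg_right (by positivity)
  have hT0 : 0 ≤ T := le_trans (by positivity) hT1
  have X1 : h * (G1 * (σ ^ (-δ - 1 - 2 * ν + (ν + 1 / 2)) * h ^ (1 - (ν + 1 / 2))) +
      G2 * (σ ^ (-δ - 1 + e2 - 2 * ν) * h ^ (1 - e2))) ≤ 2 * T := by
    have y1 := mul_max_exponent_le (δ := δ) h0 hhσ hG2 hG12 m7
    have y2 := rpow_mul_rpow_le h0 hhσ (show ν + 1 / 2 ≤ ν + 1 by linarith) (δ + 1 + 2 * ν) 2
    rw [show ν + 1 - (δ + 1 + 2 * ν) = -δ - ν by ring, show 2 - (ν + 1) = 1 - ν by ring,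
      mul_comm (σ ^ (-δ - ν)), show (2 : ℝ) - (ν + 1 / 2) = (1 - (ν + 1 / 2)) + 1 by ring,
      Real.rpow_add_one h0.ne'] at y2
    have y3 := mul_le_mul_of_nonneg_left y2 hG1
    rw [show -δ - 1 - 2 * ν + (ν + 1 / 2) = ν + 1 / 2 - (δ + 1 + 2 * ν) by ring,
      show -δ - 1 + e2 - 2 * ν = e2 - (δ + 1 + 2 * ν) by ring, mul_add]
    linarith
  have X2 : h * (G1 * (σ ^ (-δ + 1 - 2 * (ν + 1) + (ν + 1)) * h ^ (1 - (ν + 1))) +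
      G2 * (σ ^ (-δ + 1 + e2' - 2 * (ν + 1)) * h ^ (1 - e2'))) ≤ 2 * T := by
    have y1 := mul_max_exponent_le (δ := δ) h0 hhσ hG2 hG12 m8
    have y2 : h ^ (1 - ν) = h * h ^ (1 - (ν + 1)) := by
      rw [show 1 - ν = (1 - (ν + 1)) + 1 by ring, Real.rpow_add_one h0.ne', mul_comm]
    rw [show -δ + 1 - 2 * (ν + 1) + (ν + 1) = -δ - ν by ring,
      show -δ + 1 + e2' - 2 * (ν + 1) = e2' - (δ + 1 + 2 * ν) by ring, mul_add]
    rw [← hT] at y1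
    rw [y2] at hT1
    linarith
  set J0 := cubeCoeff a κ (1 + h)⁻¹ (-δ : ℂ) (-(μ : ℂ)) N with hJ0def
  set J1 := cubeCoeff a κ (1 + h)⁻¹ (-δ - 1 : ℂ) (-(μ : ℂ)) N with hJ1def
  set J2 := cubeCoeff a κ (1 + h)⁻¹ (-δ + 1 : ℂ) (-(μ : ℂ) - 1) N with hJ2def
  have c0 : ‖J0‖ ≤ 2 * K0 * L1 * (G1 * (σ ^ (-δ - 1 - 2 * ν + (ν + 1 / 2)) * h ^ (1 - (ν + 1 / 2))) +
      G2 * (σ ^ (-δ - 1 + e2 - 2 * ν) * h ^ (1 - e2))) := by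
    have e : J0 = cubeCoeff a κ (1 + h)⁻¹ ((-δ : ℝ) : ℂ) (-(μ : ℂ)) N := by
      rw [hJ0def]; push_cast; rfl
    rw [e]
    refine H0.trans ((mul_le_mul_of_nonneg_left (hdom.trans
      (mul_le_mul_of_nonneg_left I1 zero_le_two)) hK0.le).trans_eq ?_)
    ring
  have c1 : ‖J1‖ ≤ K1 * L1 * (G1 * (σ ^ (-δ - 1 - 2 * ν + (ν + 1 / 2)) * h ^ (1 - (ν + 1 / 2))) +
      G2 * (σ ^ (-δ - 1 + e2 - 2 * ν) * h ^ (1 - e2))) := by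
    have e : J1 = cubeCoeff a κ (1 + h)⁻¹ ((-δ - 1 : ℝ) : ℂ) (-(μ : ℂ)) N := by
      rw [hJ1def]; push_cast; rfl
    rw [e, mul_assoc]
    exact H1.trans (mul_le_mul_of_nonneg_left I1 hK1.le)
  have c2 : ‖J2‖ ≤ K2 * L2 * (G1 * (σ ^ (-δ + 1 - 2 * (ν + 1) + (ν + 1)) * h ^ (1 - (ν + 1))) +
      G2 * (σ ^ (-δ + 1 + e2' - 2 * (ν + 1)) * h ^ (1 - e2'))) := by
    have e : J2 = cubeCoeff a κ (1 + h)⁻¹ ((-δ + 1 : ℝ) : ℂ) (-((μ + 1 : ℝ) : ℂ)) N := by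
      rw [hJ2def]; push_cast; rw [neg_add, ← sub_eq_add_neg]
    rw [e, mul_assoc]
    exact H2.trans (mul_le_mul_of_nonneg_left I2 hK2.le)
  set Y1 := G1 * (σ ^ (-δ - 1 - 2 * ν + (ν + 1 / 2)) * h ^ (1 - (ν + 1 / 2))) +
      G2 * (σ ^ (-δ - 1 + e2 - 2 * ν) * h ^ (1 - e2))
  set Y2 := G1 * (σ ^ (-δ + 1 - 2 * (ν + 1) + (ν + 1)) * h ^ (1 - (ν + 1))) +
      G2 * (σ ^ (-δ + 1 + e2' - 2 * (ν + 1)) * h ^ (1 - e2'))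
  have hred := cubeCoeff_reduce hκ ha ha1 hρ0 r2 (-δ : ℂ) (μ : ℂ) (N : ℤ)
  rw [← hJ0def, ← hJ1def, ← hJ2def] at hred
  have hJ : J0 = (h : ℂ) * (((-(2 * δ + μ) : ℝ) : ℂ) * J0 +
      (((2 * δ : ℝ) : ℂ) * J1 + (μ : ℂ) * J2)) := by
    have hNc : ((N : ℤ) : ℂ) ≠ 0 := by
      rw [Int.cast_natCast]; exact_mod_cast hN0.ne'
    have hhc : (h : ℂ) = ((N : ℤ) : ℂ)⁻¹ := by rw [hh]; push_cast; rfl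
    rw [hhc, eq_inv_mul_iff_mul_eq₀ hNc, hred]
    push_cast; ring
  have hn : ‖J0‖ ≤ h * (|2 * δ + μ| * ‖J0‖ + (|2 * δ| * ‖J1‖ + |μ| * ‖J2‖)) := by
    conv_lhs => rw [hJ]
    rw [norm_mul, Complex.norm_of_nonneg h0.le]
    refine mul_le_mul_of_nonneg_left (norm_add_le_of_le ?_ (norm_add_le_of_le ?_ ?_)) h0.le
    · rw [norm_mul, Complex.norm_real, norm_neg, Real.norm_eq_abs]
    · rw [norm_mul, Complex.norm_real, Real.norm_eq_abs]
    · rw [norm_mul, Complex.norm_real, Real.norm_eq_abs]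
  calc ‖J0‖ ≤ h * (|2 * δ + μ| * (2 * K0 * L1 * Y1) + (|2 * δ| * (K1 * L1 * Y1) +
        |μ| * (K2 * L2 * Y2))) := by
        refine hn.trans ?_
        gcongr
    _ = (|2 * δ + μ| * (2 * K0 * L1) + |2 * δ| * (K1 * L1)) * (h * Y1) +
        |μ| * (K2 * L2) * (h * Y2) := by ring
    _ ≤ (|2 * δ + μ| * (2 * K0 * L1) + |2 * δ| * (K1 * L1)) * (2 * T) +
        |μ| * (K2 * L2) * (2 * T) := by gcongr
    _ ≤ 2 * (|2 * δ + μ| * (2 * K0 * L1) + |2 * δ| * (K1 * L1) + |μ| * (K2 * L2) + 1) * T := by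
        linarith

theorem xext_nonneg {d : ℕ} {x : Fin d → ℝ} (hx : x ∈ simplexT d) (j : Fin (d + 1)) :
    0 ≤ xext d x j := by
  unfold xext
  split_ifs with h
  · exact hx.1 _
  · linarith [hx.2]

theorem sum_xext (d : ℕ) (x : Fin d → ℝ) : ∑ j, xext d x j = 1 := by
  rw [Fin.sum_univ_castSucc]
  simp [xext]

theorem distXi_sq {d : ℕ} {x y : Fin d → ℝ} (hx : x ∈ simplexT d) (hy : y ∈ simplexT d) :
    distXi d x y ^ 2 = 2 * (1 - ∑ j, Real.sqrt (xext d x j * xext d y j)) := by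
  rw [distXi, Real.sq_sqrt (Finset.sum_nonneg fun j _ => sq_nonneg _)]
  have e : ∀ j, (Real.sqrt (xext d x j) - Real.sqrt (xext d y j)) ^ 2 =
      xext d x j + xext d y j - 2 * Real.sqrt (xext d x j * xext d y j) := fun j => by
    rw [Real.sqrt_mul (xext_nonneg hx j), sub_sq, Real.sq_sqrt (xext_nonneg hx j),
      Real.sq_sqrt (xext_nonneg hy j)]
    ring
  simp only [e, Finset.sum_sub_distrib, Finset.sum_add_distrib, sum_xext, ← Finset.mul_sum]
  ring

theorem cesaro_majorant_rescale {m : ℕ} {κ : Fin m → ℝ} (hκ : ∀ j, 0 ≤ κ j) {δ ν : ℝ}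
    (hδν : 0 ≤ δ + ν) (hν : 0 ≤ ν) :
    ∃ C, 0 < C ∧ ∀ a : Fin m → ℝ, (∀ j, 0 ≤ a j) → ∀ n r D : ℝ, 0 < n → 0 ≤ r → 0 ≤ D →
      D ^ 2 = 2 * r ^ 2 → ∀ h σ : ℝ, h = (2 * n)⁻¹ → σ = r + h →
      n ^ (-δ) * ((∏ j, (σ * h + a j) ^ (-κ j)) * (h ^ (1 - ν) * σ ^ (-δ - ν)) +
        (∏ j, (σ ^ 2 + a j) ^ (-κ j)) * (h ^ (1 - δ) * σ ^ (-(2 * ν)))) ≤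
      C * ((∏ j, (a j + n⁻¹ * D + (n ^ 2)⁻¹) ^ (-κ j)) /
          (n ^ (δ - (ν - 1)) * (D + n⁻¹) ^ (δ + ν)) +
        (∏ j, (a j + D ^ 2 + (n ^ 2)⁻¹) ^ (-κ j)) / (n * (D + n⁻¹) ^ (2 * ν))) := by
  set K := ∑ j, κ j
  refine ⟨4 ^ K * (2 ^ (ν - 1) * 2 ^ (δ + ν)) + 4 ^ K * (2 ^ (δ - 1) * 2 ^ (2 * ν)),
    by positivity, ?_⟩
  intro a ha n r D hn hr hD hDr h σ hh hσ
  have hi : 0 < n⁻¹ := inv_pos.mpr hn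
  have hh2 : h = n⁻¹ / 2 := by rw [hh, mul_inv]; ring
  have h0 : 0 < h := by rw [hh2]; positivity
  have hrD : D / 2 ≤ r := by nlinarith
  have hσs : (D + n⁻¹) / 2 ≤ σ := by rw [hσ, hh2]; linarith
  have hs0 : 0 < D + n⁻¹ := by positivity
  have hσ0 : 0 < σ := by linarith
  have g1 : ∏ j, (σ * h + a j) ^ (-κ j) ≤
      4 ^ K * ∏ j, (a j + n⁻¹ * D + (n ^ 2)⁻¹) ^ (-κ j) := by
    have := prod_add_rpow_scale (c := 4) (p := n⁻¹ * D + (n ^ 2)⁻¹) (q := σ * h) hκ ha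
      (by norm_num) (by positivity) (by rw [hh2, ← inv_pow]; nlinarith)
    refine this.trans_eq ?_
    congr 1
    exact Finset.prod_congr rfl fun j _ => by congr 1; ring
  have g2 : ∏ j, (σ ^ 2 + a j) ^ (-κ j) ≤
      4 ^ K * ∏ j, (a j + D ^ 2 + (n ^ 2)⁻¹) ^ (-κ j) := by
    have := prod_add_rpow_scale (c := 4) (p := D ^ 2 + (n ^ 2)⁻¹) (q := σ ^ 2) hκ ha
      (by norm_num) (by positivity) (by
        rw [← inv_pow]
        have h3 : ((D + n⁻¹) / 2) ^ 2 ≤ σ ^ 2 := by gcongr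
        nlinarith)
    refine this.trans_eq ?_
    congr 1
    exact Finset.prod_congr rfl fun j _ => by congr 1; ring
  have s1 : ∀ e : ℝ, 0 ≤ e → σ ^ (-e) ≤ 2 ^ e * (D + n⁻¹) ^ (-e) := fun e he => by
    refine (Real.rpow_le_rpow_of_nonpos (by positivity) hσs (by linarith)).trans_eq ?_
    rw [Real.div_rpow hs0.le zero_le_two, Real.rpow_neg zero_le_two, div_inv_eq_mul, mul_comm]
  have s2 : ∀ e : ℝ, h ^ (1 - e) = 2 ^ (e - 1) * n ^ (e - 1) := fun e => by
    rw [hh, Real.inv_rpow (by positivity), ← Real.rpow_neg (by positivity), neg_sub,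
      Real.mul_rpow zero_le_two hn.le]
  have i1 := s1 (δ + ν) hδν
  have i2 := s1 (2 * ν) (by positivity)
  rw [neg_add, ← sub_eq_add_neg] at i1
  have hP1 : 0 ≤ ∏ j, (a j + n⁻¹ * D + (n ^ 2)⁻¹) ^ (-κ j) := Finset.prod_nonneg fun j _ =>
    Real.rpow_nonneg (by have := ha j; positivity) _
  have hP2 : 0 ≤ ∏ j, (a j + D ^ 2 + (n ^ 2)⁻¹) ^ (-κ j) := Finset.prod_nonneg fun j _ =>
    Real.rpow_nonneg (by have := ha j; positivity) _
  set P1 := ∏ j, (a j + n⁻¹ * D + (n ^ 2)⁻¹) ^ (-κ j)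
  set P2 := ∏ j, (a j + D ^ 2 + (n ^ 2)⁻¹) ^ (-κ j)
  set s := D + n⁻¹
  have e1 : P1 / (n ^ (δ - (ν - 1)) * s ^ (δ + ν)) =
      P1 * ((n ^ (-δ) * n ^ (ν - 1)) * s ^ (-δ - ν)) := by
    rw [← Real.rpow_add hn, div_eq_mul_inv, mul_inv, ← Real.rpow_neg hn.le, ← Real.rpow_neg hs0.le]
    congr 3 <;> ring
  have e2 : P2 / (n * s ^ (2 * ν)) = P2 * ((n ^ (-δ) * n ^ (δ - 1)) * s ^ (-(2 * ν))) := by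
    rw [← Real.rpow_add hn, div_eq_mul_inv, mul_inv, ← Real.rpow_neg hs0.le,
      show -δ + (δ - 1) = -1 by ring, Real.rpow_neg_one]
  have t1 : 0 ≤ P1 * ((n ^ (-δ) * n ^ (ν - 1)) * s ^ (-δ - ν)) := by positivity
  have t2 : 0 ≤ P2 * ((n ^ (-δ) * n ^ (δ - 1)) * s ^ (-(2 * ν))) := by positivity
  rw [e1, e2, s2, s2]
  calc _ ≤ n ^ (-δ) * ((4 ^ K * P1) * ((2 ^ (ν - 1) * n ^ (ν - 1)) *
          (2 ^ (δ + ν) * s ^ (-δ - ν))) +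
        (4 ^ K * P2) * ((2 ^ (δ - 1) * n ^ (δ - 1)) * (2 ^ (2 * ν) * s ^ (-(2 * ν))))) := by
        gcongr
    _ = 4 ^ K * (2 ^ (ν - 1) * 2 ^ (δ + ν)) * (P1 * ((n ^ (-δ) * n ^ (ν - 1)) * s ^ (-δ - ν))) +
        4 ^ K * (2 ^ (δ - 1) * 2 ^ (2 * ν)) *
          (P2 * ((n ^ (-δ) * n ^ (δ - 1)) * s ^ (-(2 * ν)))) := by ring
    _ ≤ _ := by
        have u1 : 0 ≤ (4 : ℝ) ^ K * (2 ^ (ν - 1) * 2 ^ (δ + ν)) := by positivity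
        have u2 : 0 ≤ (4 : ℝ) ^ K * (2 ^ (δ - 1) * 2 ^ (2 * ν)) := by positivity
        nlinarith [mul_nonneg u1 t2, mul_nonneg u2 t1]

theorem simpK_eq_cubeCoeff {d : ℕ} {κ : Fin (d + 1) → ℝ} {q : ℕ → Polynomial ℝ} {c μ : ℝ}
    (hc : ∀ n z, ∑ k ∈ Finset.range (n + 1), (q k).eval 1 * (q k).eval (2 * z ^ 2 - 1) =
      c * (geg μ (2 * n)).eval z) (δ : ℝ) (n : ℕ) {x y : Fin d → ℝ}
    (ha1 : ∑ j, Real.sqrt (xext d x j * xext d y j) ≤ 1) {ρ : ℝ} (h0 : 0 < ρ) (hρ : ρ < 1) :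
    (simpK d κ q δ n x y : ℂ) = (((∫ t in cube (d + 1), wcube κ t)⁻¹ *
      ((cesA δ n)⁻¹ * c / (2 * π)) : ℝ) : ℂ) *
      cubeCoeff (fun j => Real.sqrt (xext d x j * xext d y j)) κ ρ (-δ : ℂ) (-(μ : ℂ))
        ((2 * n : ℕ) : ℤ) := by
  rw [simpK, cubeCoeff, Complex.ofReal_mul, Complex.ofReal_mul, mul_assoc,
    ← MeasureTheory.integral_const_mul, ← integral_complex_ofReal]
  congr 1
  refine MeasureTheory.setIntegral_congr_fun (measurableSet_cube _) fun t ht => ?_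
  have hz := abs_le.mp (abs_sum_mul_le_one (fun j => Real.sqrt_nonneg _) ha1
    (abs_le_one_of_mem_cube ht))
  have hcc := circCoeff_cesaro hz.1 hz.2 h0 hρ μ δ n
  have hs : ∑ k ∈ Finset.range (n + 1),
      cesA δ (n - k) * (q k).eval 1 * (q k).eval (2 * zST d x y t ^ 2 - 1) =
      c * ∑ j ∈ Finset.range (n + 1), cesA (δ - 1) j *
        (geg μ (2 * (n - j))).eval (zST d x y t) := by
    simp only [mul_assoc]
    rw [sum_cesA_mul, Finset.mul_sum]
    refine Finset.sum_congr rfl fun j _ => ?_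
    rw [hc]; ring
  have hπ : (π : ℂ) ≠ 0 := by exact_mod_cast Real.pi_ne_zero
  simp only [zST] at hs
  simp only [zST, hs, hcc]
  push_cast
  field_simp

theorem mul_chain_le {L C₁ C₂ C₃ X G p c R : ℝ} (hL : 0 ≤ L) (hC₁ : 0 ≤ C₁) (hC₂ : 0 ≤ C₂)
    (hc : 0 ≤ c) (hX : 0 ≤ X) (h₁ : X ≤ C₁ * G) (h₂ : c ≤ C₂ * p) (h₃ : p * G ≤ C₃ * R)
    (hR : 0 ≤ C₃ * R) : L * c * X ≤ (L * C₂ * C₁ + 1) * C₃ * R :=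
  calc L * c * X ≤ L * (C₂ * p) * (C₁ * G) :=
        mul_le_mul (mul_le_mul_of_nonneg_left h₂ hL) h₁ hX (mul_nonneg hL (hc.trans h₂))
    _ = L * C₂ * C₁ * (p * G) := by ring
    _ ≤ L * C₂ * C₁ * (C₃ * R) := mul_le_mul_of_nonneg_left h₃ (by positivity)
    _ ≤ (L * C₂ * C₁ + 1) * C₃ * R := by linarith

/-- Theorem 2.7, Cesàro kernel estimate on the simplex. -/
theorem cesaro_kernel_estimate_simplex (d : ℕ) (hd : 1 ≤ d) (κ : Fin (d + 1) → ℝ)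
    (hκ : ∀ i, 0 < κ i) (δ : ℝ) (hδ : -1 < δ) (q : ℕ → Polynomial ℝ)
    (hqdeg : ∀ k, (q k).degree = k) (hqlead : ∀ k, 0 < (q k).leadingCoeff)
    (hqorth : ∀ j k, (∫ t in (-1 : ℝ)..1,
        (q j).eval t * (q k).eval t * wJac ((∑ i, κ i) + ((d : ℝ) - 2) / 2) (-(1 / 2)) t) =
      if j = k then 1 else 0) :
    ∃ c : ℝ, 0 < c ∧ ∀ n : ℕ, 1 ≤ n → ∀ x ∈ simplexT d, ∀ y ∈ simplexT d,
      |simpK d κ q δ n x y| ≤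
        c * ((∏ j, (Real.sqrt (xext d x j * xext d y j) + (n : ℝ)⁻¹ * distXi d x y +
                ((n : ℝ) ^ 2)⁻¹) ^ (-κ j)) /
              ((n : ℝ) ^ (δ - ((d : ℝ) - 1) / 2) *
                (distXi d x y + (n : ℝ)⁻¹) ^ (δ + ((d : ℝ) + 1) / 2)) +
            (∏ j, (Real.sqrt (xext d x j * xext d y j) + distXi d x y ^ 2 +
                ((n : ℝ) ^ 2)⁻¹) ^ (-κ j)) /
              ((n : ℝ) * (distXi d x y + (n : ℝ)⁻¹) ^ ((d : ℝ) + 1))) := by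
  have hd' : (1 : ℝ) ≤ d := by exact_mod_cast hd
  have hK : 0 < ∑ i, κ i := Finset.sum_pos (fun i _ => hκ i) Finset.univ_nonempty
  obtain ⟨c₀, hc₀⟩ := kernel_eq_geg (by linarith) q hqdeg hqorth
  set ν : ℝ := ((d : ℝ) + 1) / 2 with hν
  have hν1 : 1 ≤ ν := by rw [hν]; linarith
  obtain ⟨C₁, hC₁, H₁⟩ := norm_cubeCoeff_cesaro_le (Nat.succ_pos d) hκ hδ hν1
  obtain ⟨C₂, hC₂, H₂⟩ := cesA_inv_le hδ
  obtain ⟨C₃, hC₃, H₃⟩ := cesaro_majorant_rescale (fun j => (hκ j).le)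
    (show 0 ≤ δ + ν by linarith) (by linarith)
  set W := |(∫ t in cube (d + 1), wcube κ t)⁻¹|
  have hW : 0 ≤ W := abs_nonneg _
  refine ⟨(W * (|c₀| / (2 * π)) * C₂ * C₁ + 1) * C₃, by positivity, fun n hn x hx y hy => ?_⟩
  have hn' : (0 : ℝ) < n := by exact_mod_cast hn
  set a : Fin (d + 1) → ℝ := fun j => Real.sqrt (xext d x j * xext d y j)
  have ha : ∀ j, 0 ≤ a j := fun j => Real.sqrt_nonneg _
  have hDsq : distXi d x y ^ 2 = 2 * (1 - ∑ j, a j) := distXi_sq hx hy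
  have ha1 : ∑ j, a j ≤ 1 := by nlinarith [sq_nonneg (distXi d x y)]
  set h : ℝ := (((2 * n : ℕ) : ℝ))⁻¹ with hh
  have h2n : (1 : ℝ) ≤ ((2 * n : ℕ) : ℝ) := by exact_mod_cast (by omega : 1 ≤ 2 * n)
  have h0 : 0 < h := by positivity
  have h1 : h ≤ 1 := inv_le_one_of_one_le₀ h2n
  have hb := inv_one_add_bounds h0 h1
  have hr : distXi d x y ^ 2 = 2 * Real.sqrt (1 - ∑ j, a j) ^ 2 := by
    rw [Real.sq_sqrt (by linarith), hDsq]
  have B₁ := H₁ a ha ha1 (2 * n) (by omega) h _ hh rfl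
  have B₃ := H₃ a ha n _ (distXi d x y) hn' (Real.sqrt_nonneg _) (Real.sqrt_nonneg _) hr h _
    (by rw [hh]; push_cast; rfl) rfl
  have hc₀' : ∀ n z, ∑ k ∈ Finset.range (n + 1), (q k).eval 1 * (q k).eval (2 * z ^ 2 - 1) =
      c₀ * (geg ((∑ i, κ i) + ν) (2 * n)).eval z := fun n z => by
    rw [hc₀ n z, show (∑ i, κ i) + ((d : ℝ) - 2) / 2 + 3 / 2 = (∑ i, κ i) + ν by rw [hν]; ring]
  have E := simpK_eq_cubeCoeff (κ := κ) hc₀' δ n ha1 (by linarith [hb.1] : 0 < (1 + h)⁻¹) hb.2.1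
  have hcA := cesA_pos hδ n
  have N : |simpK d κ q δ n x y| = W * (|c₀| / (2 * π)) * (cesA δ n)⁻¹ *
      ‖cubeCoeff a κ (1 + h)⁻¹ (-δ : ℂ) (-(((∑ i, κ i) + ν : ℝ) : ℂ)) ((2 * n : ℕ) : ℤ)‖ := by
    rw [← Real.norm_eq_abs, ← Complex.norm_real, E, norm_mul, Complex.norm_real, Real.norm_eq_abs,
      abs_mul, abs_div, abs_mul, abs_of_pos (inv_pos.mpr hcA), abs_of_pos Real.two_pi_pos]
    ring
  rw [show δ - ((d : ℝ) - 1) / 2 = δ - (ν - 1) by rw [hν]; ring,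
    show (d : ℝ) + 1 = 2 * ν by rw [hν]; ring, N]
  have hR := le_trans (by
    have hs : 0 < Real.sqrt (1 - ∑ j, a j) + h := by positivity
    have p1 := prod_add_rpow_nonneg (κ := κ) ha
      (p := (Real.sqrt (1 - ∑ j, a j) + h) * h) (by positivity)
    have p2 := prod_add_rpow_nonneg (κ := κ) ha
      (p := (Real.sqrt (1 - ∑ j, a j) + h) ^ 2) (by positivity)
    positivity) B₃
  have hL : 0 ≤ W * (|c₀| / (2 * π)) := by have := Real.two_pi_pos; positivity
  exact mul_chain_le hL hC₁.le hC₂.le (inv_pos.mpr hcA).le (norm_nonneg _) B₁ (H₂ n hn) B₃ hR
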